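/- arXiv:1210.1962 — 8 statements merged into one kernel-verified Lean document; each statement's English description precedes it below -/
import Mathlib

section
/- Suppose that every ring homomorphism F → F is surjective. Let φ be an injection of the set of lines of a 3-dimensional classical elliptic space (over F) into itself such that for all lines a, b, if a ∼ b then φ(a) ∼ φ(b). Then φ is an elliptic Plücker transformation: φ is bijective and for all lines a, b one has a ∼ b if and only if φ(a) ∼ φ(b). -/
/-- A *line* of `PG(3,F)`: a 2-dimensional `F`-subspace of a 4-dimensional vector space `V`. -/
def ELine (F V : Type*) [Field F] [AddCommGroup V] [Module F V] :=
  {W : Submodule F V // Module.finrank F W = 2}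

variable {F V : Type*} [Field F] [AddCommGroup V] [Module F V]

/-- `a ≈ b`: the subspaces `a` and `b` intersect orthogonally (w.r.t. the polarity of `B`):
`a ⊓ b ≠ ⊥` and `a ⊓ bᗮ ≠ ⊥`. -/
def OrthoMeet (B : LinearMap.BilinForm F V) (a b : Submodule F V) : Prop :=
  a ⊓ b ≠ ⊥ ∧ a ⊓ B.orthogonal b ≠ ⊥

/-- `a ∼ b`: the lines `a` and `b` are related, i.e. `a ≈ b` or `a = b`. -/
def Related (B : LinearMap.BilinForm F V) (a b : Submodule F V) : Prop :=
  OrthoMeet B a b ∨ a = b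

/-- `a ∥ b`: `a` and `b` are Clifford parallel, i.e. there are at least three lines `x`
with `x ≈ a` and `x ≈ b`. -/
def CliffPar (B : LinearMap.BilinForm F V) (a b : Submodule F V) : Prop :=
  ∃ x y z : Submodule F V,
    Module.finrank F x = 2 ∧ Module.finrank F y = 2 ∧ Module.finrank F z = 2 ∧
    x ≠ y ∧ x ≠ z ∧ y ≠ z ∧
    OrthoMeet B x a ∧ OrthoMeet B x b ∧
    OrthoMeet B y a ∧ OrthoMeet B y b ∧
    OrthoMeet B z a ∧ OrthoMeet B z b

/-- The elliptic space is *classical*: there exist Clifford parallel lines `a, b`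
with `b ∉ {a, aᗮ}`. -/
def IsClassical (B : LinearMap.BilinForm F V) : Prop :=
  ∃ a b : Submodule F V, Module.finrank F a = 2 ∧ Module.finrank F b = 2 ∧
    CliffPar B a b ∧ b ≠ a ∧ b ≠ B.orthogonal a


structure EP {E : Type*} (perp sim : E → E → Prop) : Prop where
  psymm : ∀ {p q}, perp p q → perp q p
  irr : ∀ {p}, ¬ perp p p
  uniq : ∀ {p q r s}, p ≠ q → perp r p → perp r q → perp s p → perp s q → r = s
  ex : ∀ p q, ∃ r, perp r p ∧ perp r q
  srefl : ∀ p, sim p p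
  ssymm : ∀ {p q}, sim p q → sim q p
  strans : ∀ {p q r}, sim p q → sim q r → sim p r
  frame : ∀ {a b c q}, perp a b → perp a c → perp b c → sim a q →
    ∃ q1 q2, sim b q1 ∧ sim c q2 ∧ perp q q1 ∧ perp q q2 ∧ perp q1 q2
  rot : ∀ {p r}, perp p r → ∃ r', perp p r' ∧ r' ≠ r ∧ sim r r'

structure PM {E : Type*} (perp sim : E → E → Prop) (P Q : E → E → E) : Prop where
  psim : ∀ {p q}, sim p q → sim (P p q) (Q p q)
  inj : ∀ {p q p' q'}, sim p q → sim p' q' → P p q = P p' q' → Q p q = Q p' q' → p = p' ∧ q = q'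
  perp1 : ∀ {p q p' q'}, sim p q → sim p' q' → perp p p' → perp q q' → perp (P p q) (P p' q')
  perp2 : ∀ {p q p' q'}, sim p q → sim p' q' → perp p p' → perp q q' → perp (Q p q) (Q p' q')

section comb
variable {E : Type*} {perp sim : E → E → Prop} (h : EP perp sim)

include h

theorem EP.third {a b : E} (hab : perp a b) : ∃ c, perp a c ∧ perp b c := by
  obtain ⟨c, h1, h2⟩ := h.ex a b
  exact ⟨c, h.psymm h1, h.psymm h2⟩

theorem EP.experp (a : E) : ∃ b, perp a b := by
  obtain ⟨c, h1, h2⟩ := h.ex a a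
  exact ⟨c, h.psymm h1⟩

theorem EP.frame1 {a b q : E} (hab : perp a b) (hs : sim a q) : ∃ q1, sim b q1 ∧ perp q q1 := by
  obtain ⟨c, h1, h2⟩ := h.third hab
  obtain ⟨q1, q2, h3, h4, h5, h6, h7⟩ := h.frame hab h1 h2 hs
  exact ⟨q1, h3, h5⟩

theorem EP.ne {a b : E} (hab : perp a b) : a ≠ b := by
  rintro rfl; exact h.irr hab

theorem EP.two (a : E) : ∃ b, b ≠ a ∧ sim a b := by
  obtain ⟨c, hc⟩ := h.experp a
  obtain ⟨r, h1, h2, h3⟩ := h.rot (h.psymm hc)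
  exact ⟨r, h2, h3⟩

theorem PM.swapO {P Q : E → E → E} (m : PM perp sim P Q) : PM perp sim Q P where
  psim := fun hh => h.ssymm (m.psim hh)
  inj := fun a b c d => m.inj a b d c
  perp1 := m.perp2
  perp2 := m.perp1

theorem PM.swapI {P Q : E → E → E} (m : PM perp sim P Q) :
    PM perp sim (fun p q => P q p) (fun p q => Q q p) where
  psim := fun hh => m.psim (h.ssymm hh)
  inj := fun a b c d => (m.inj (h.ssymm a) (h.ssymm b) c d).symm
  perp1 := fun a b c d => m.perp1 (h.ssymm a) (h.ssymm b) d c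
  perp2 := fun a b c d => m.perp2 (h.ssymm a) (h.ssymm b) d c

theorem PM.par {P Q : E → E → E} (m : PM perp sim P Q) {p q q' : E} (hq : sim p q)
    (hq' : sim p q') : P p q = P p q' ∨ Q p q = Q p q' := by
  by_cases hqq : q = q'
  · subst hqq; simp
  by_contra hcon
  push Not at hcon
  obtain ⟨s, hs1, hs2⟩ := h.ex q q'
  obtain ⟨r, hr1, hr2⟩ := h.frame1 (h.psymm hs1) (h.ssymm hq)
  obtain ⟨r', h1, h2, h3⟩ := h.rot hr2
  have hs : sim r s := h.ssymm hr1
  have hs' : sim r' s := h.strans (h.ssymm h3) hs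
  have e1 := h.uniq hcon.1 (m.perp1 hs hq (h.psymm hr2) hs1) (m.perp1 hs hq' (h.psymm hr2) hs2)
    (m.perp1 hs' hq (h.psymm h1) hs1) (m.perp1 hs' hq' (h.psymm h1) hs2)
  have e2 := h.uniq hcon.2 (m.perp2 hs hq (h.psymm hr2) hs1) (m.perp2 hs hq' (h.psymm hr2) hs2)
    (m.perp2 hs' hq (h.psymm h1) hs1) (m.perp2 hs' hq' (h.psymm h1) hs2)
  exact h2 (m.inj hs hs' e1 e2).1.symm

theorem PM.type {P Q : E → E → E} (m : PM perp sim P Q) (p : E) :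
    (∀ q q', sim p q → sim p q' → P p q = P p q') ∨
    (∀ q q', sim p q → sim p q' → Q p q = Q p q') := by
  by_contra hcon
  push Not at hcon
  obtain ⟨⟨q, q', a1, a2, a3⟩, s, s', b1, b2, b3⟩ := hcon
  have := m.par h a1 a2
  have := m.par h b1 b2
  have := m.par h a1 b1
  have := m.par h a1 b2
  have := m.par h a2 b1
  have := m.par h a2 b2
  grind

theorem PM.nomix {P Q : E → E → E} (m : PM perp sim P Q) {a b c : E} (hab : perp a b)
    (hca : perp c a) (hcb : perp c b)
    (ha : ∀ q q', sim a q → sim a q' → P a q = P a q')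
    (hb : ∀ q q', sim b q → sim b q' → P b q = P b q')
    (hc : ∀ q q', sim c q → sim c q' → Q c q = Q c q') : False := by
  have key : ∀ q, sim c q → perp (P c q) (P a a) ∧ perp (P c q) (P b b) := by
    intro q hq
    obtain ⟨q1, q2, h1, h2, h3, h4, h5⟩ := h.frame hca hcb hab hq
    rw [ha a q1 (h.srefl _) h1, hb b q2 (h.srefl _) h2]
    exact ⟨m.perp1 hq h1 hca h3, m.perp1 hq h2 hcb h4⟩
  obtain ⟨q, hq1, hq2⟩ := h.two c
  have h1 := key q hq2
  have h2 := key c (h.srefl c)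
  have h3 := h.ne (m.perp1 (h.srefl a) (h.srefl b) hab hab)
  have e := h.uniq h3 h1.1 h1.2 h2.1 h2.2
  exact hq1 (m.inj hq2 (h.srefl c) e (hc _ _ hq2 (h.srefl c))).2

theorem PM.perptype {P Q : E → E → E} (m : PM perp sim P Q) {a b : E} (hab : perp a b)
    (ha : ∀ q q', sim a q → sim a q' → P a q = P a q') :
    ∀ q q', sim b q → sim b q' → P b q = P b q' := by
  by_contra hb
  have hb' := (m.type h b).resolve_left hb
  obtain ⟨c, hc1, hc2⟩ := h.third hab
  rcases m.type h c with hc | hc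
  · exact m.nomix h hc1 (h.psymm hab) hc2 ha hc hb'
  · exact (m.swapO h).nomix h hc2 hab hc1 hb' hc ha

theorem PM.alltype {P Q : E → E → E} (m : PM perp sim P Q) :
    (∀ p q q', sim p q → sim p q' → P p q = P p q') ∨
    (∀ p q q', sim p q → sim p q' → Q p q = Q p q') := by
  have key : ∀ a, (∀ q q', sim a q → sim a q' → P a q = P a q') → 
      ∀ b, ∀ q q', sim b q → sim b q' → P b q = P b q' := by
    intro a ha b
    obtain ⟨c, hc1, hc2⟩ := h.ex a b
    exact m.perptype h hc2 (m.perptype h (h.psymm hc1) ha)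
  by_cases hh : ∃ a, (∀ q q', sim a q → sim a q' → P a q = P a q')
  · obtain ⟨a, ha⟩ := hh
    exact Or.inl (key a ha)
  · right
    intro p
    exact (m.type h p).resolve_left fun hp => hh ⟨p, hp⟩

theorem PM.nodeg [Nonempty E] {P Q : E → E → E} (m : PM perp sim P Q)
    (h1 : ∀ p q q', sim p q → sim p q' → P p q = P p q')
    (h2 : ∀ p p' q, sim p q → sim p' q → P p q = P p' q) : False := by
  obtain ⟨p1⟩ := ‹Nonempty E›
  obtain ⟨p2, hp⟩ := h.experp p1
  obtain ⟨p2', a1, a2, a3⟩ := h.rot hp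
  obtain ⟨p1', b1, b2, b3⟩ := h.rot (h.psymm hp)
  have s11 := h.srefl p1
  have s22 := h.srefl p2
  have s22' := h.ssymm a3
  have n : Q p1 p1 ≠ Q p1 p1' := fun e => 
    b2 (m.inj s11 b3 (h1 _ _ _ s11 b3) e).2.symm
  have e := h.uniq n (m.perp2 s22 s11 (h.psymm hp) (h.psymm hp))
    (m.perp2 s22 b3 (h.psymm hp) b1) (m.perp2 s22' s11 (h.psymm a1) (h.psymm hp))
    (m.perp2 s22' b3 (h.psymm a1) b1)
  exact a2 (m.inj s22 s22' (h2 _ _ _ s22 s22') e).1.symm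

theorem PM.main [Nonempty E] {P Q : E → E → E} (m : PM perp sim P Q) :
    (∃ f g : E → E, ∀ p q, sim p q → P p q = f p ∧ Q p q = g q) ∨
    (∃ f g : E → E, ∀ p q, sim p q → P p q = g q ∧ Q p q = f p) := by
  have aux : ∀ {P Q : E → E → E}, PM perp sim P Q → 
      (∀ p q q', sim p q → sim p q' → P p q = P p q') → 
      (∃ f g : E → E, ∀ p q, sim p q → P p q = f p ∧ Q p q = g q) := by
    intro P Q m hL
    rcases (m.swapI h).alltype h with hR | hR
    · exfalso
      exact m.nodeg h hL (fun p p' q a b => hR q p p' (h.ssymm a) (h.ssymm b))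
    · refine ⟨fun p => P p p, fun q => Q q q, fun p q hpq => ⟨hL _ _ _ hpq (h.srefl _), 
        hR q p q (h.ssymm hpq) (h.srefl q)⟩⟩
  rcases m.alltype h with hL | hL
  · exact Or.inl (aux m hL)
  · right
    obtain ⟨f, g, H⟩ := aux (m.swapO h) hL
    exact ⟨f, g, fun p q hpq => (H p q hpq).symm⟩

end comb


open scoped LinearAlgebra.Projectivization

section plane
variable {K : Type*} [Field K]

/-- diagonal form -/
def dt (d v w : Fin 3 → K) : K := d 0 * v 0 * w 0 + d 1 * v 1 * w 1 + d 2 * v 2 * w 2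

theorem dt_comm (d v w : Fin 3 → K) : dt d v w = dt d w v := by simp only [dt]; ring
theorem dt_add_left (d v v' w : Fin 3 → K) : dt d (v + v') w = dt d v w + dt d v' w := by
  simp only [dt, Pi.add_apply]; ring
theorem dt_add_right (d v w w' : Fin 3 → K) : dt d v (w + w') = dt d v w + dt d v w' := by
  simp only [dt, Pi.add_apply]; ring
theorem dt_sub_left (d v v' w : Fin 3 → K) : dt d (v - v') w = dt d v w - dt d v' w := by
  simp only [dt, Pi.sub_apply]; ring
theorem dt_sub_right (d v w w' : Fin 3 → K) : dt d v (w - w') = dt d v w - dt d v w' := by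
  simp only [dt, Pi.sub_apply]; ring
theorem dt_smul_left (d v w : Fin 3 → K) (c : K) : dt d (c • v) w = c * dt d v w := by
  simp only [dt, Pi.smul_apply, smul_eq_mul]; ring
theorem dt_smul_right (d v w : Fin 3 → K) (c : K) : dt d v (c • w) = c * dt d v w := by
  simp only [dt, Pi.smul_apply, smul_eq_mul]; ring
theorem dt_zero_left (d w : Fin 3 → K) : dt d 0 w = 0 := by
  simp [dt]
theorem dt_zero_right (d w : Fin 3 → K) : dt d w 0 = 0 := by
  simp [dt]
theorem dt_zero_left' (d v w : Fin 3 → K) (h : dt d v w ≠ 0) : v ≠ 0 := by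
  rintro rfl; exact h (dt_zero_left _ _)

/-- perpendicular points -/
def pp (d : Fin 3 → K) (p q : ℙ K (Fin 3 → K)) : Prop := dt d p.rep q.rep = 0

/-- points with the same norm class -/
def ss (d : Fin 3 → K) (p q : ℙ K (Fin 3 → K)) : Prop :=
  ∃ c : K, c ≠ 0 ∧ dt d p.rep p.rep = c ^ 2 * dt d q.rep q.rep

theorem pp_mk (d v w : Fin 3 → K) (hv : v ≠ 0) (hw : w ≠ 0) :
    pp d (.mk K v hv) (.mk K w hw) ↔ dt d v w = 0 := by
  obtain ⟨a, ha⟩ := Projectivization.exists_smul_eq_mk_rep K v hv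
  obtain ⟨b, hb⟩ := Projectivization.exists_smul_eq_mk_rep K w hw
  rw [pp, ← ha, ← hb, Units.smul_def, Units.smul_def, dt_smul_left, dt_smul_right]
  simp

theorem ss_mk (d v w : Fin 3 → K) (hv : v ≠ 0) (hw : w ≠ 0) :
    ss d (.mk K v hv) (.mk K w hw) ↔ ∃ c : K, c ≠ 0 ∧ dt d v v = c ^ 2 * dt d w w := by
  obtain ⟨a, ha⟩ := Projectivization.exists_smul_eq_mk_rep K v hv
  obtain ⟨b, hb⟩ := Projectivization.exists_smul_eq_mk_rep K w hw
  rw [ss, ← ha, ← hb, Units.smul_def, Units.smul_def, dt_smul_left, dt_smul_right,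
    dt_smul_left, dt_smul_right]
  have ha0 := a.ne_zero
  have hb0 := b.ne_zero
  constructor
  · rintro ⟨c, hc, e⟩
    refine ⟨c * b / a, by simp [hc], ?_⟩
    field_simp
    linear_combination e
  · rintro ⟨c, hc, e⟩
    refine ⟨c * a / b, by simp [hc], ?_⟩
    field_simp
    rw [e]; try ring

theorem ne_smul_of_perp {d u x : Fin 3 → K} (hd : ∀ v, dt d v v = 0 → v = 0) 
    (hx : x ≠ 0) (hu : u ≠ 0) (h : dt d u x = 0) :
    ∀ c : K, c • u ≠ x := by
  rintro c rfl
  rw [dt_smul_right] at h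
  rcases mul_eq_zero.1 h with h | h
  · simp [h] at hx
  · exact hu (hd _ h)

/-- reflection -/
def dtrefl (d m v : Fin 3 → K) : Fin 3 → K := v - (2 * dt d v m / dt d m m) • m

theorem dt_refl {d m : Fin 3 → K} (hm : dt d m m ≠ 0) (v w : Fin 3 → K) :
    dt d (dtrefl d m v) (dtrefl d m w) = dt d v w := by
  simp only [dtrefl, dt_sub_left, dt_sub_right, dt_smul_left, dt_smul_right]
  rw [dt_comm d m w]
  field_simp
  ring

theorem exists_isom {d : Fin 3 → K} (hd : ∀ v, dt d v v = 0 → v = 0) {u x : Fin 3 → K}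
    (h : dt d u u = dt d x x) : ∃ R : (Fin 3 → K) → (Fin 3 → K), R u = x ∧
      ∀ a b, dt d (R a) (R b) = dt d a b := by
  by_cases hux : u = x
  · exact ⟨id, hux, fun _ _ => rfl⟩
  have hm : dt d (u - x) (u - x) ≠ 0 := fun e => hux (sub_eq_zero.1 (hd _ e))
  refine ⟨dtrefl d (u - x), ?_, dt_refl hm⟩
  have : 2 * dt d u (u - x) / dt d (u - x) (u - x) = 1 := by
    rw [div_eq_one_iff_eq hm]
    simp only [dt_sub_left, dt_sub_right]
    rw [dt_comm d x u, ← h]; ring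
  rw [dtrefl, this]; simp

theorem exists_perp2 (d v w : Fin 3 → K) : ∃ r, r ≠ 0 ∧ dt d r v = 0 ∧ dt d r w = 0 := by
  let f : (Fin 3 → K) →ₗ[K] (K × K) :=
    { toFun := fun r => (dt d r v, dt d r w)
      map_add' := by intro x y; simp [dt_add_left]
      map_smul' := by intro x y; simp [dt_smul_left] }
  have := f.ker_ne_bot_of_finrank_lt (by simp)
  obtain ⟨r, hr, h0⟩ := (Submodule.ne_bot_iff _).1 this
  have e : (dt d r v, dt d r w) = 0 := hr
  simp only [Prod.mk_eq_zero] at e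
  exact ⟨r, h0, e.1, e.2⟩

theorem cross_zero_of {a b x : Fin 3 → K} (ha : a ⬝ᵥ x = 0) (hb : b ⬝ᵥ x = 0) :
    crossProduct (crossProduct a b) x = 0 := by
  rw [cross_cross_eq_smul_sub_smul, ha, hb]; simp

theorem par_of_perp {d : Fin 3 → K} (hd : ∀ v, dt d v v = 0 → v = 0) {v w x y : Fin 3 → K}
    (hx : x ≠ 0) (hw : w ≠ 0) 
    (hvw : ∀ c : K, c • w ≠ v) (h1 : dt d x v = 0) (h2 : dt d x w = 0)
    (h3 : dt d y v = 0) (h4 : dt d y w = 0) : ∃ c : K, c • x = y := by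
  -- y minus projection is orthogonal to v, w, x
  refine ⟨dt d x y / dt d x x, ?_⟩
  have hxx : dt d x x ≠ 0 := fun e => hx (hd _ e)
  have hww : dt d w w ≠ 0 := fun e => hw (hd _ e)
  symm
  rw [← sub_eq_zero]
  set z := y - (dt d x y / dt d x x) • x with hz
  set v' := v - (dt d w v / dt d w w) • w with hv'
  have hv0 : v' ≠ 0 := by
    intro e
    exact hvw _ (sub_eq_zero.1 e).symm
  have hvv : dt d v' v' ≠ 0 := fun e => hv0 (hd _ e)
  have e1 : dt d z x = 0 := by
    rw [hz, dt_sub_left, dt_smul_left, dt_comm d y x]; field_simp; ring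
  have e2 : dt d z w = 0 := by
    rw [hz, dt_sub_left, dt_smul_left, h2, h4]; ring
  have e3 : dt d z v' = 0 := by
    rw [hv', dt_sub_right, dt_smul_right, e2, hz, dt_sub_left, dt_smul_left, h1, h3]; ring
  have f1 : dt d x w = 0 := h2
  have f2 : dt d x v' = 0 := by
    rw [hv', dt_sub_right, dt_smul_right, h2, h1]; ring
  have f3 : dt d w v' = 0 := by
    rw [hv', dt_sub_right, dt_smul_right]; field_simp; ring
  have li : LinearIndependent K ![x, w, v'] := by
    rw [Fintype.linearIndependent_iff]
    intro g hg
    simp only [Fin.sum_univ_three, Matrix.cons_val_zero, Matrix.cons_val_one, Matrix.cons_val] at hg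
    have g0 := congrArg (dt d x) hg
    have g1 := congrArg (dt d w) hg
    have g2 := congrArg (dt d v') hg
    simp only [dt_add_right, dt_smul_right, dt_zero_right, f1, f2, f3, dt_comm d w x, dt_comm d v' w,
      dt_comm d v' x, mul_zero, add_zero, zero_add, mul_eq_zero, hxx, hww, hvv, or_false] at g0 g1 g2
    intro i; fin_cases i <;> simp [g0, g1, g2]
  have sp := li.span_eq_top_of_card_eq_finrank (by simp)
  have : z ∈ Submodule.span K (Set.range ![x, w, v']) := by rw [sp]; trivial
  apply hd
  let f : (Fin 3 → K) →ₗ[K] K :=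
    { toFun := fun r => dt d z r
      map_add' := by intro x y; simp [dt_add_right]
      map_smul' := by intro x y; simp [dt_smul_right] }
  have : Submodule.span K (Set.range ![x, w, v']) ≤ LinearMap.ker f := by
    rw [Submodule.span_le]
    rintro _ ⟨i, rfl⟩
    fin_cases i <;> simp [f, e1, e2, e3]
  exact this ‹_›

theorem EP_plane {d : Fin 3 → K} (hd : ∀ v, dt d v v = 0 → v = 0) (h2 : (2 : K) ≠ 0) :
    EP (pp d) (ss d) where
  psymm := by intro p q h; rw [pp, dt_comm]; exact h
  irr := by intro p h; exact p.rep_nonzero (hd _ h)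
  uniq := by
    intro p q r s hpq
    induction p with | h p hp => induction q with | h q hq =>
    induction r with | h r hr => induction s with | h s hs =>
    simp only [pp_mk]
    intro a b c e
    rw [Ne, Projectivization.mk_eq_mk_iff'] at hpq
    push Not at hpq
    rw [Projectivization.mk_eq_mk_iff']
    exact par_of_perp hd hs hq hpq c e a b
  ex := by
    intro p q
    induction p with | h p hp => induction q with | h q hq =>
    obtain ⟨r, h0, h1, h2⟩ := exists_perp2 d p q
    exact ⟨.mk K r h0, (pp_mk ..).2 h1, (pp_mk ..).2 h2⟩
  srefl := by intro p; exact ⟨1, by simp, by simp⟩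
  ssymm := by
    rintro p q ⟨c, hc, h⟩
    refine ⟨c⁻¹, by simp [hc], ?_⟩
    rw [h]; field_simp
  strans := by
    rintro p q r ⟨c, hc, h⟩ ⟨c', hc', h'⟩
    refine ⟨c * c', by simp [hc, hc'], ?_⟩
    rw [h, h']; ring
  frame := by
    intro a b c q
    induction a with | h a ha => induction b with | h b hb =>
    induction c with | h c hc => induction q with | h q hq =>
    simp only [pp_mk, ss_mk]
    rintro hab hac hbc ⟨k, hk, e⟩
    obtain ⟨R, h1, h2⟩ := exists_isom hd (u := a) (x := k • q) (by
      rw [e, dt_smul_left, dt_smul_right]; ring)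
    have nz : ∀ x, x ≠ 0 → R x ≠ 0 := by
      intro x hx h
      apply hx; apply hd
      rw [← h2, h, dt_zero_left]
    refine ⟨.mk K (R b) (nz b hb), .mk K (R c) (nz c hc), ?_, ?_, ?_, ?_, ?_⟩
    · rw [ss_mk]; exact ⟨1, by simp, by simp [h2]⟩
    · rw [ss_mk]; exact ⟨1, by simp, by simp [h2]⟩
    · rw [pp_mk]
      have := h2 a b
      rw [h1, hab, dt_smul_left] at this
      simpa [hk] using this
    · rw [pp_mk]
      have := h2 a c
      rw [h1, hac, dt_smul_left] at this
      simpa [hk] using this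
    · rw [pp_mk, h2, hbc]
  rot := by
    intro p r
    induction p with | h p hp => induction r with | h r hr =>
    rw [pp_mk]
    intro hpr
    obtain ⟨t, h0, h1, h3⟩ := exists_perp2 d p r
    have hrr : dt d r r ≠ 0 := fun e => hr (hd _ e)
    have hm0 : r + t ≠ 0 := by
      apply dt_zero_left' d _ r
      rw [dt_add_left, h3]; simpa using hrr
    have hm : dt d (r + t) (r + t) ≠ 0 := fun e => hm0 (hd _ e)
    have n : dtrefl d (r + t) r ≠ 0 := by
      apply dt_zero_left' d _ (dtrefl d (r + t) r)
      rw [dt_refl hm]; exact hrr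
    refine ⟨.mk K _ n, ?_, ?_, ?_⟩
    · have e1 : dt d p (r + t) = 0 := by rw [dt_add_right, hpr, dt_comm d p t, h1]; ring
      rw [pp_mk, dtrefl, dt_sub_right, dt_smul_right, e1, hpr]; ring
    · rw [Ne, Projectivization.mk_eq_mk_iff']
      rintro ⟨c, hc⟩
      have e2 : dt d r (r + t) = dt d r r := by rw [dt_add_right, dt_comm d r t, h3]; ring
      have e3 : dt d t (r + t) = dt d t t := by rw [dt_add_right, h3]; ring
      rw [dtrefl, e2] at hc
      have := congrArg (dt d t) hc
      rw [dt_sub_right, dt_smul_right, dt_smul_right, e3, h3] at this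
      have htt : dt d t t ≠ 0 := fun e => h0 (hd _ e)
      simp [htt, hm, hrr, h2] at this
    · rw [ss_mk]; exact ⟨1, by simp, by rw [dt_refl hm]; ring⟩

theorem infinite_of_aniso {d : Fin 3 → K} (hd : ∀ v, dt d v v = 0 → v = 0) (h2 : (2 : K) ≠ 0) :
    Infinite K := by
  by_contra hfin
  rw [not_infinite_iff_finite] at hfin
  cases nonempty_fintype K
  have hc : ringChar K ≠ 2 := by
    intro hc
    apply h2
    have := ringChar.Nat.cast_ringChar (R := K)
    rw [hc] at this
    exact_mod_cast this
  have d0 : d 0 ≠ 0 := by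
    intro h
    have := congrFun (hd ![1, 0, 0] (by simp [dt, h])) 0
    simp at this
  have d1 : d 1 ≠ 0 := by
    intro h
    have := congrFun (hd ![0, 1, 0] (by simp [dt, h])) 1
    simp at this
  obtain ⟨a, b, h⟩ := FiniteField.exists_root_sum_quadratic 
    (f := Polynomial.C (d 0) * Polynomial.X ^ 2 + Polynomial.C 0 * Polynomial.X + Polynomial.C (d 2))
    (g := Polynomial.C (d 1) * Polynomial.X ^ 2 + Polynomial.C 0 * Polynomial.X + Polynomial.C 0)
    (Polynomial.degree_quadratic d0) (Polynomial.degree_quadratic d1)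
    (FiniteField.odd_card_of_char_ne_two hc)
  simp at h
  have := congrFun (hd ![a, b, 1] (by simp [dt]; linear_combination h)) 2
  simp at this

end plane


section inj
variable {K : Type*} [Field K]

theorem harm {d : Fin 3 → K} (hd : ∀ v, dt d v v = 0 → v = 0) (h2 : (2 : K) ≠ 0)
    (f : ℙ K (Fin 3 → K) → ℙ K (Fin 3 → K)) (hp : ∀ p q, pp d p q → pp d (f p) (f q))
    {u w s : Fin 3 → K} (hu : u ≠ 0) (hw : w ≠ 0) (hs : s ≠ 0) (huw : dt d u w = 0)
    (hus : dt d u s = 0) (hws : dt d w s = 0) (n1 : u + w ≠ 0) (n2 : u + w + s ≠ 0) (n3 : u - w ≠ 0)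
    (hf : f (.mk K _ n1) = f (.mk K _ hu)) (hT1 : f (.mk K _ n2) ≠ f (.mk K _ hu))
    (hT2 : f (.mk K _ n2) ≠ f (.mk K _ hs)) : f (.mk K _ n3) = f (.mk K _ hu) := by
  have h := EP_plane hd h2
  have huu : dt d u u ≠ 0 := fun e => hu (hd _ e)
  have hss : dt d s s ≠ 0 := fun e => hs (hd _ e)
  have n4 : w + s ≠ 0 := by
    apply dt_zero_left' d _ s; rw [dt_add_left, hws]; simpa using hss
  have n5 : u + s ≠ 0 := by
    apply dt_zero_left' d _ s; rw [dt_add_left, hus]; simpa using hss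
  set A : ℙ K (Fin 3 → K) := .mk K u hu with hA
  set B : ℙ K (Fin 3 → K) := .mk K w hw with hB
  set S : ℙ K (Fin 3 → K) := .mk K s hs with hS
  set C : ℙ K (Fin 3 → K) := .mk K _ n1 with hC
  set C' : ℙ K (Fin 3 → K) := .mk K _ n3 with hC'
  set T : ℙ K (Fin 3 → K) := .mk K _ n2 with hT
  set U : ℙ K (Fin 3 → K) := .mk K _ n4 with hU
  set W : ℙ K (Fin 3 → K) := .mk K _ n5 with hW
  have pAB : pp d A B := (pp_mk ..).2 huw
  have pAS : pp d A S := (pp_mk ..).2 hus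
  have pBS : pp d B S := (pp_mk ..).2 hws
  -- T' ⊥ w'
  obtain ⟨D, hD1, hD2⟩ := h.ex S C
  have hDT : pp d D T := by
    revert hD1 hD2
    rw [hS, hC, hT]
    induction D with | h z hz => 
    simp only [pp_mk, dt_add_right]
    intro a b; rw [a, b]; simp
  have qD : f D = f B := by
    have nn : f S ≠ f A := (h.ne (hp _ _ pAS)).symm
    refine h.uniq nn (hp _ _ hD1) (hf ▸ hp _ _ hD2) (hp _ _ pBS) (h.psymm (hp _ _ pAB))
  have qT : pp d (f B) (f T) := qD ▸ hp _ _ hDT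
  -- U' = s'
  have pUA : pp d A U := (pp_mk ..).2 (by rw [dt_add_right, huw, hus]; simp)
  obtain ⟨M, hM1, hM2⟩ := h.ex A T
  have hMU : pp d M U := by
    revert hM1 hM2
    rw [hA, hT, hU]
    induction M with | h z hz => 
    simp only [pp_mk, dt_add_right]
    intro a b; rw [a] at b; simpa using b
  have qM : f M = f B := h.uniq hT1.symm (hp _ _ hM1) (hp _ _ hM2) (h.psymm (hp _ _ pAB)) qT
  have qU : f U = f S := h.uniq (h.ne (hp _ _ pAB)) (h.psymm (hp _ _ pUA))
    (h.psymm (qM ▸ hp _ _ hMU)) (h.psymm (hp _ _ pAS)) (h.psymm (hp _ _ pBS))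
  -- W' = T'
  have pWB : pp d B W := (pp_mk ..).2 (by rw [dt_add_right, dt_comm, huw, hws]; simp)
  obtain ⟨N, hN1, hN2⟩ := h.ex T B
  have hNW : pp d N W := by
    revert hN1 hN2
    rw [hB, hT, hW]
    induction N with | h z hz => 
    simp only [pp_mk, dt_add_right]
    intro a b; rw [b] at a; simpa using a
  have qW : f W = f T := by
    by_contra hne
    have : f N = f B := h.uniq hne (hp _ _ hNW) (hp _ _ hN1) (hp _ _ pWB) qT
    exact h.ne (hp _ _ hN2) this
  -- finish
  obtain ⟨O, hO1, hO2⟩ := h.ex U W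
  have hOC : pp d O C' := by
    revert hO1 hO2
    rw [hU, hW, hC']
    induction O with | h z hz => 
    simp only [pp_mk, dt_add_right, dt_sub_right]
    intro a b; linear_combination b - a
  have qO : f O = f B := by
    refine h.uniq hT2.symm (qU ▸ hp _ _ hO1) (qW ▸ hp _ _ hO2) (hp _ _ pBS) qT
  have pC'S : pp d C' S := (pp_mk ..).2 (by rw [dt_sub_left, hus, hws]; simp)
  exact h.uniq (h.ne (hp _ _ pBS)) (h.psymm (qO ▸ hp _ _ hOC)) (hp _ _ pC'S) (hp _ _ pAB)
    (hp _ _ pAS)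

theorem finj {d : Fin 3 → K} (hd : ∀ v, dt d v v = 0 → v = 0) (h2 : (2 : K) ≠ 0)
    (f : ℙ K (Fin 3 → K) → ℙ K (Fin 3 → K)) (hp : ∀ p q, pp d p q → pp d (f p) (f q))
    (hsi : ∀ p q, ss d p q → f p = f q → p = q) : Function.Injective f := by
  have h := EP_plane hd h2
  intro p p2 hf
  induction p with | h v hv => induction p2 with | h u0 hu0 =>
  by_contra hne
  have huv : dt d u0 v ≠ 0 := by
    intro e
    have := hp _ _ ((pp_mk d u0 v hu0 hv).2 e)
    exact h.ne this hf.symm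
  have huu0 : dt d u0 u0 ≠ 0 := fun e => hu0 (hd _ e)
  have hvv : dt d v v ≠ 0 := fun e => hv (hd _ e)
  obtain ⟨u, w, rfl, huw, hu, hmu⟩ : ∃ u w, u + w = v ∧ dt d u w = 0 ∧ ∃ hu : u ≠ 0, 
      Projectivization.mk K u0 hu0 = .mk K u hu := by
    set k := dt d u0 v / dt d u0 u0 with hk
    have hk0 : k ≠ 0 := div_ne_zero huv huu0
    have n : k • u0 ≠ 0 := smul_ne_zero hk0 hu0
    refine ⟨k • u0, v - k • u0, by simp, ?_, n, ?_⟩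
    · rw [dt_smul_left, dt_sub_right, dt_smul_right, hk]; field_simp; ring
    · rw [eq_comm, Projectivization.mk_eq_mk_iff']; exact ⟨k, rfl⟩
  rw [hmu] at hne hf
  have hw : w ≠ 0 := by
    rintro rfl
    apply hne
    congr 1
    simp
  obtain ⟨s0, hs0, hs1, hs2⟩ := exists_perp2 d u w
  have hss0 : dt d s0 s0 ≠ 0 := fun e => hs0 (hd _ e)
  have huu : dt d u u ≠ 0 := fun e => hu (hd _ e)
  have hww : dt d w w ≠ 0 := fun e => hw (hd _ e)
  have := infinite_of_aniso hd h2
  set c := dt d s0 s0 / dt d (u + w) (u + w) with hc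
  obtain ⟨m, hm0, hmc⟩ : ∃ m : K, m ≠ 0 ∧ m ^ 2 ≠ c := by
    have hnz : (Polynomial.X * (Polynomial.X ^ 2 - Polynomial.C c) : Polynomial K) ≠ 0 :=
      mul_ne_zero Polynomial.X_ne_zero (Polynomial.X_pow_sub_C_ne_zero (by norm_num) c)
    classical
    obtain ⟨m, hm⟩ := Infinite.exists_notMem_finset
      (Polynomial.X * (Polynomial.X ^ 2 - Polynomial.C c) : Polynomial K).roots.toFinset
    rw [Multiset.mem_toFinset, Polynomial.mem_roots hnz] at hm
    simp [sub_eq_zero] at hm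
    exact ⟨m, hm.1, hm.2⟩
  have hcm : c - m ^ 2 ≠ 0 := sub_ne_zero.2 (Ne.symm hmc)
  set κ := 2 * m / (c - m ^ 2) with hκ
  have hκ0 : κ ≠ 0 := div_ne_zero (mul_ne_zero h2 hm0) hcm
  have hκe : 1 + κ ^ 2 * c = (1 + m * κ) ^ 2 := by
    have : κ * (c - m ^ 2) = 2 * m := by rw [hκ]; field_simp
    linear_combination κ * this
  have hs : κ • s0 ≠ 0 := smul_ne_zero hκ0 hs0
  set s := κ • s0 with hsdef
  have hus : dt d u s = 0 := by rw [hsdef, dt_smul_right, dt_comm, hs1]; simp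
  have hws : dt d w s = 0 := by rw [hsdef, dt_smul_right, dt_comm, hs2]; simp
  have hss : dt d s s ≠ 0 := fun e => hs (hd _ e)
  have nrm : dt d (u + w) (u + w) + dt d s s = (1 + m * κ) ^ 2 * dt d (u + w) (u + w) := by
    rw [← hκe, hc, hsdef, dt_smul_left, dt_smul_right]
    field_simp
  have n1 : u + w + s ≠ 0 := by
    apply dt_zero_left' d _ s; rw [dt_add_left, dt_add_left, hus, hws]; simpa using hss
  have n2 : u + w + -s ≠ 0 := by
    rw [← sub_eq_add_neg]
    apply dt_zero_left' d _ s; rw [dt_sub_left, dt_add_left, hus, hws]; simpa using hss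
  have e1 : dt d (u + w + s) (u + w + s) = (1 + m * κ) ^ 2 * dt d (u + w) (u + w) := by
    rw [← nrm]; simp only [dt_add_left, dt_add_right, hus, hws, dt_comm d s]; ring
  have e2 : dt d (u + w + -s) (u + w + -s) = (1 + m * κ) ^ 2 * dt d (u + w) (u + w) := by
    rw [← nrm, ← sub_eq_add_neg]
    simp only [dt_add_left, dt_add_right, dt_sub_left, dt_sub_right, hus, hws, dt_comm d s]; ring
  have hmk : 1 + m * κ ≠ 0 := by
    intro e
    rw [e] at e1
    exact n1 (hd _ (by rw [e1]; ring))
  have n3 : u - w ≠ 0 := by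
    apply dt_zero_left' d _ u; rw [dt_sub_left, dt_comm d w, huw]; simpa using huu
  have hns : -s ≠ 0 := neg_ne_zero.2 hs
  have hS : Projectivization.mk K s hs = .mk K (-s) hns := by
    rw [Projectivization.mk_eq_mk_iff']; exact ⟨-1, by simp⟩
  have t1 : f (.mk K _ n1) ≠ f (.mk K u hu) := by
    intro e
    have := hsi _ _ ((ss_mk _ _ _ n1 hv).2 ⟨_, hmk, e1⟩) (e.trans hf.symm)
    rw [Projectivization.mk_eq_mk_iff'] at this
    obtain ⟨k, hk⟩ := this
    have := congrArg (dt d s) hk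
    simp only [dt_smul_right, dt_add_right, hus, hws, dt_comm d s u, dt_comm d s w] at this
    exact hss (by linear_combination - this)
  have t2 : f (.mk K _ n2) ≠ f (.mk K u hu) := by
    intro e
    have := hsi _ _ ((ss_mk _ _ _ n2 hv).2 ⟨_, hmk, e2⟩) (e.trans hf.symm)
    rw [Projectivization.mk_eq_mk_iff'] at this
    obtain ⟨k, hk⟩ := this
    have := congrArg (dt d s) hk
    simp only [dt_smul_right, dt_add_right, ← sub_eq_add_neg, dt_sub_right, 
      hus, hws, dt_comm d s u, dt_comm d s w] at this
    exact hss (by linear_combination this)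
  have t3 : f (.mk K _ n1) ≠ f (.mk K _ n2) := by
    intro e
    have := hsi _ _ ((ss_mk _ _ _ n1 n2).2 ⟨1, by simp, by rw [e1, e2]; ring⟩) e
    rw [Projectivization.mk_eq_mk_iff'] at this
    obtain ⟨k, hk⟩ := this
    have a1 := congrArg (dt d s) hk
    have a2 := congrArg (dt d u) hk
    simp only [dt_smul_right, dt_add_right, ← sub_eq_add_neg, dt_sub_right, 
      hus, hws, huw, dt_comm d s u, dt_comm d s w] at a1 a2
    have : k = 1 := by
      apply mul_right_cancel₀ huu; linear_combination a2
    subst this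
    have : 2 * dt d s s = 0 := by linear_combination -a1
    simp [h2, hss] at this
  have key : f (.mk K _ n3) = f (.mk K u hu) := by
    by_cases hq : f (.mk K _ n1) = f (.mk K s hs)
    · refine harm hd h2 f hp hu hw hns huw ?_ ?_ hv n2 n3 hf t2 ?_
      · rw [← neg_one_smul K, dt_smul_right, hus]; simp
      · rw [← neg_one_smul K, dt_smul_right, hws]; simp
      · rw [← hS, ← hq]; exact t3.symm
    · exact harm hd h2 f hp hu hw hs huw hus hws hv n1 n3 hf t1 hq
  have := hsi _ _ ((ss_mk d _ _ n3 hv).2 ⟨1, by simp, by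
    simp only [dt_add_left, dt_add_right, dt_sub_left, dt_sub_right, huw, dt_comm d w u]; ring⟩) 
    (key.trans hf.symm)
  rw [Projectivization.mk_eq_mk_iff'] at this
  obtain ⟨k, hk⟩ := this
  have a1 := congrArg (dt d u) hk
  have a2 := congrArg (dt d w) hk
  simp only [dt_smul_right, dt_add_right, dt_sub_right, huw, dt_comm d w u] at a1 a2
  have : k = 1 := by
    apply mul_right_cancel₀ huu; linear_combination a1
  subst this
  have : 2 * dt d w w = 0 := by linear_combination a2
  simp [h2, hww] at this

end inj


section ft
variable {K : Type*} [Field K]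

theorem nz0 (x y : K) : ![1, x, y] ≠ 0 := by
  intro h; have := congrFun h 0; simp at this
theorem nz1 (y : K) : ![0, 1, y] ≠ 0 := by
  intro h; have := congrFun h 1; simp at this
theorem nz2 : ![(0 : K), 0, 1] ≠ 0 := by
  intro h; have := congrFun h 2; simp at this

theorem zero_of_perp3 {d : Fin 3 → K} (hd : ∀ v, dt d v v = 0 → v = 0) {a b c r : Fin 3 → K}
    (ha : a ≠ 0) (hb : b ≠ 0) (hc : c ≠ 0) (hab : dt d a b = 0) (hac : dt d a c = 0)
    (hbc : dt d b c = 0) (h1 : dt d r a = 0) (h2 : dt d r b = 0) (h3 : dt d r c = 0) : r = 0 := by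
  obtain ⟨k, rfl⟩ := par_of_perp hd (v := a) (w := b) (x := c) (y := r) hc hb
    (ne_smul_of_perp hd ha hb (by rw [dt_comm, hab])) (by rw [dt_comm, hac]) (by rw [dt_comm, hbc]) h1 h2
  rw [dt_smul_left] at h3
  rcases mul_eq_zero.1 h3 with h | h
  · simp [h]
  · exact absurd (hd _ h) hc

theorem expand3 {d : Fin 3 → K} (hd : ∀ v, dt d v v = 0 → v = 0) {a b c : Fin 3 → K}
    (ha : a ≠ 0) (hb : b ≠ 0) (hc : c ≠ 0) (hab : dt d a b = 0) (hac : dt d a c = 0)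
    (hbc : dt d b c = 0) (r : Fin 3 → K) : 
    r = (dt d r a / dt d a a) • a + (dt d r b / dt d b b) • b + (dt d r c / dt d c c) • c := by
  have haa : dt d a a ≠ 0 := fun e => ha (hd _ e)
  have hbb : dt d b b ≠ 0 := fun e => hb (hd _ e)
  have hcc : dt d c c ≠ 0 := fun e => hc (hd _ e)
  rw [← sub_eq_zero]
  have hba : dt d b a = 0 := by rw [dt_comm, hab]
  have hca : dt d c a = 0 := by rw [dt_comm, hac]
  have hcb : dt d c b = 0 := by rw [dt_comm, hbc]
  apply zero_of_perp3 hd ha hb hc hab hac hbc <;>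
  simp only [dt_sub_left, dt_add_left, dt_smul_left, hab, hac, hbc, hba, hca, hcb] <;>
  field_simp <;> ring

theorem lemA {d : Fin 3 → K} (hd : ∀ v, dt d v v = 0 → v = 0) {a b c : Fin 3 → K}
    (ha : a ≠ 0) (hb : b ≠ 0) (hc : c ≠ 0) (hab : dt d a b = 0) (hac : dt d a c = 0)
    (hbc : dt d b c = 0) (P : ℙ K (Fin 3 → K)) (hP : pp d P (.mk K c hc)) (hPb : P ≠ .mk K b hb) :
    ∃ s : K, ∃ hn : a + s • b ≠ 0, P = .mk K _ hn := by
  induction P with | h r hr =>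
  rw [pp_mk] at hP
  have e := expand3 hd ha hb hc hab hac hbc r
  rw [hP, zero_div, zero_smul, add_zero] at e
  set x := dt d r a / dt d a a
  set y := dt d r b / dt d b b
  have hx : x ≠ 0 := by
    intro hx
    rw [hx, zero_smul, zero_add] at e
    apply hPb
    rw [Projectivization.mk_eq_mk_iff']
    exact ⟨y, e.symm⟩
  have : r = x • (a + (y / x) • b) := by
    rw [e, smul_add, smul_smul, mul_div_cancel₀ _ hx]
  have hn : a + (y / x) • b ≠ 0 := by
    intro h
    rw [h] at this
    simp [hr] at this
  refine ⟨y / x, hn, ?_⟩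
  rw [Projectivization.mk_eq_mk_iff']
  exact ⟨x, this.symm⟩

theorem uniqA {d : Fin 3 → K} (hd : ∀ v, dt d v v = 0 → v = 0) {a b : Fin 3 → K}
    (ha : a ≠ 0) (hb : b ≠ 0) (hab : dt d a b = 0) {s t : K} (h1 : a + s • b ≠ 0) 
    (h2 : a + t • b ≠ 0) (h : Projectivization.mk K _ h1 = .mk K _ h2) : s = t := by
  rw [Projectivization.mk_eq_mk_iff'] at h
  obtain ⟨k, hk⟩ := h
  have haa : dt d a a ≠ 0 := fun e => ha (hd _ e)
  have hbb : dt d b b ≠ 0 := fun e => hb (hd _ e)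
  have a1 := congrArg (dt d a) hk
  have a2 := congrArg (dt d b) hk
  simp only [dt_smul_right, dt_add_right, hab, dt_comm d b a] at a1 a2
  have : k = 1 := by
    apply mul_right_cancel₀ haa; linear_combination a1
  subst this
  apply mul_right_cancel₀ hbb; linear_combination -a2

theorem collin {d : Fin 3 → K} 
    (f : ℙ K (Fin 3 → K) → ℙ K (Fin 3 → K)) (hp : ∀ p q, pp d p q → pp d (f p) (f q))
    {v1 v2 v3 w1 w2 w3 : Fin 3 → K} (hv1 : v1 ≠ 0) (hv2 : v2 ≠ 0) (hv3 : v3 ≠ 0)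
    (hw1 : w1 ≠ 0) (hw2 : w2 ≠ 0) (hw3 : w3 ≠ 0) (h1 : f (.mk K v1 hv1) = .mk K w1 hw1)
    (h2 : f (.mk K v2 hv2) = .mk K w2 hw2) (h3 : f (.mk K v3 hv3) = .mk K w3 hw3)
    (k l : K) (h : v3 = k • v1 + l • v2) :
    ∃ r, r ≠ 0 ∧ dt d r w1 = 0 ∧ dt d r w2 = 0 ∧ dt d r w3 = 0 := by
  obtain ⟨z, hz, e1, e2⟩ := exists_perp2 d v1 v2
  have e3 : dt d z v3 = 0 := by rw [h, dt_add_right, dt_smul_right, dt_smul_right, e1, e2]; ring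
  have q1 := hp _ _ ((pp_mk d _ _ hz hv1).2 e1)
  have q2 := hp _ _ ((pp_mk d _ _ hz hv2).2 e2)
  have q3 := hp _ _ ((pp_mk d _ _ hz hv3).2 e3)
  rw [h1] at q1
  rw [h2] at q2
  rw [h3] at q3
  revert q1 q2 q3
  induction f (.mk K z hz) with | h r hr =>
  simp only [pp_mk]
  intro q1 q2 q3
  exact ⟨r, hr, q1, q2, q3⟩

theorem ftpg {d : Fin 3 → K} (hd : ∀ v, dt d v v = 0 → v = 0) (h2 : (2 : K) ≠ 0)
    (f : ℙ K (Fin 3 → K) → ℙ K (Fin 3 → K)) (hp : ∀ p q, pp d p q → pp d (f p) (f q))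
    (hi : Function.Injective f) : ∃ σ : K →+* K, ∃ a b c : Fin 3 → K, 
      a ≠ 0 ∧ b ≠ 0 ∧ c ≠ 0 ∧ dt d a b = 0 ∧ dt d a c = 0 ∧ dt d b c = 0 ∧ 
      ∀ v hv, ∃ hn : σ (v 0) • a + σ (v 1) • b + σ (v 2) • c ≠ 0, 
        f (.mk K v hv) = .mk K _ hn := by
  have h := EP_plane hd h2
  set E0 : ℙ K (Fin 3 → K) := .mk K _ (nz0 0 0) with hE0
  set E1 : ℙ K (Fin 3 → K) := .mk K _ (nz1 0) with hE1
  set E2 : ℙ K (Fin 3 → K) := .mk K _ nz2 with hE2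
  have p01 : pp d E0 E1 := (pp_mk ..).2 (by simp [dt])
  have p02 : pp d E0 E2 := (pp_mk ..).2 (by simp [dt])
  have p12 : pp d E1 E2 := (pp_mk ..).2 (by simp [dt])
  have pA : ∀ x, pp d (.mk K _ (nz0 x 0)) E2 := fun x => (pp_mk ..).2 (by simp [dt])
  have pB : ∀ x, pp d (.mk K _ (nz0 0 x)) E1 := fun x => (pp_mk ..).2 (by simp [dt])
  have pC : ∀ x, pp d (.mk K _ (nz1 x)) E0 := fun x => (pp_mk ..).2 (by simp [dt])
  have nA : ∀ x, Projectivization.mk K _ (nz0 x 0) ≠ E1 := by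
    intro x
    rw [hE1, Ne, Projectivization.mk_eq_mk_iff']
    rintro ⟨c, hc⟩
    have := congrFun hc 0
    simp at this
  have nB : ∀ x, Projectivization.mk K _ (nz0 0 x) ≠ E2 := by
    intro x
    rw [hE2, Ne, Projectivization.mk_eq_mk_iff']
    rintro ⟨c, hc⟩
    have := congrFun hc 0
    simp at this
  have nC : ∀ x, Projectivization.mk K _ (nz1 x) ≠ E2 := by
    intro x
    rw [hE2, Ne, Projectivization.mk_eq_mk_iff']
    rintro ⟨c, hc⟩
    have := congrFun hc 1
    simp at this
  obtain ⟨a, ha, hfa⟩ : ∃ a, ∃ ha : a ≠ 0, f E0 = .mk K a ha :=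
    ⟨(f E0).rep, (f E0).rep_nonzero, (f E0).mk_rep.symm⟩
  obtain ⟨b', hb', hfb'⟩ : ∃ a, ∃ ha : a ≠ 0, f E1 = .mk K a ha :=
    ⟨(f E1).rep, (f E1).rep_nonzero, (f E1).mk_rep.symm⟩
  obtain ⟨c', hc', hfc'⟩ : ∃ a, ∃ ha : a ≠ 0, f E2 = .mk K a ha :=
    ⟨(f E2).rep, (f E2).rep_nonzero, (f E2).mk_rep.symm⟩
  have hab' : dt d a b' = 0 := (pp_mk d a b' ha hb').1 (hfa ▸ hfb' ▸ hp _ _ p01)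
  have hac' : dt d a c' = 0 := (pp_mk d a c' ha hc').1 (hfa ▸ hfc' ▸ hp _ _ p02)
  have hbc' : dt d b' c' = 0 := (pp_mk d b' c' hb' hc').1 (hfb' ▸ hfc' ▸ hp _ _ p12)
  obtain ⟨s1, hs1, e1⟩ := lemA hd ha hb' hc' hab' hac' hbc' (f (.mk K _ (nz0 1 0)))
    (hfc' ▸ hp _ _ (pA 1)) (hfb' ▸ hi.ne (nA 1))
  obtain ⟨t1, ht1, e2⟩ := lemA hd ha hc' hb' hac' hab' (by rw [dt_comm, hbc']) (f (.mk K _ (nz0 0 1)))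
    (hfb' ▸ hp _ _ (pB 1)) (hfc' ▸ hi.ne (nB 1))
  have s10 : s1 ≠ 0 := by
    rintro rfl
    simp only [zero_smul, add_zero, ← hfa] at e1
    have := hi e1
    rw [hE0, Projectivization.mk_eq_mk_iff'] at this
    obtain ⟨c, hc⟩ := this
    have := congrFun hc 1
    simp at this
  have t10 : t1 ≠ 0 := by
    rintro rfl
    simp only [zero_smul, add_zero, ← hfa] at e2
    have := hi e2
    rw [hE0, Projectivization.mk_eq_mk_iff'] at this
    obtain ⟨c, hc⟩ := this
    have := congrFun hc 2
    simp at this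
  obtain ⟨b, rfl⟩ : ∃ b, b' = s1⁻¹ • b := ⟨s1 • b', by rw [smul_smul, inv_mul_cancel₀ s10, one_smul]⟩
  obtain ⟨c, rfl⟩ : ∃ c, c' = t1⁻¹ • c := ⟨t1 • c', by rw [smul_smul, inv_mul_cancel₀ t10, one_smul]⟩
  have hb : b ≠ 0 := by rintro rfl; simp at hb'
  have hc : c ≠ 0 := by rintro rfl; simp at hc'
  have hfb : f E1 = .mk K b hb := by
    rw [hfb', Projectivization.mk_eq_mk_iff']; exact ⟨_, rfl⟩
  have hfc : f E2 = .mk K c hc := by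
    rw [hfc', Projectivization.mk_eq_mk_iff']; exact ⟨_, rfl⟩
  have hab : dt d a b = 0 := (pp_mk d a b ha hb).1 (hfa ▸ hfb ▸ hp _ _ p01)
  have hac : dt d a c = 0 := (pp_mk d a c ha hc).1 (hfa ▸ hfc ▸ hp _ _ p02)
  have hbc : dt d b c = 0 := (pp_mk d b c hb hc).1 (hfb ▸ hfc ▸ hp _ _ p12)
  have cA := fun x => lemA hd ha hb hc hab hac hbc (f (.mk K _ (nz0 x 0)))
    (hfc ▸ hp _ _ (pA x)) (hfb ▸ hi.ne (nA x))
  have cB := fun x => lemA hd ha hc hb hac hab (by rw [dt_comm, hbc]) (f (.mk K _ (nz0 0 x)))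
    (hfb ▸ hp _ _ (pB x)) (hfc ▸ hi.ne (nB x))
  have cC := fun x => lemA hd hb hc ha hbc (by rw [dt_comm, hab]) (by rw [dt_comm, hac])
    (f (.mk K _ (nz1 x)))
    (hfa ▸ hp _ _ (pC x)) (hfc ▸ hi.ne (nC x))
  choose s sn hs using cA
  choose t tn ht using cB
  choose r rn hr using cC
  have hs0 : s 0 = 0 := by
    apply uniqA hd ha hb hab (sn 0) (t := 0) (by simpa using ha)
    rw [← hs]; simp only [zero_smul, add_zero]; exact hfa
  have ht0 : t 0 = 0 := by
    apply uniqA hd ha hc hac (tn 0) (t := 0) (by simpa using ha)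
    rw [← ht]; simp only [zero_smul, add_zero]; exact hfa
  have hs1' : s 1 = 1 := by
    apply uniqA hd ha hb hab (sn 1) (t := 1) (by 
      rw [smul_smul, mul_inv_cancel₀ s10] at hs1; exact hs1)
    rw [← hs, e1]; congr 1; rw [smul_smul, mul_inv_cancel₀ s10]
  have ht1' : t 1 = 1 := by
    apply uniqA hd ha hc hac (tn 1) (t := 1) (by 
      rw [smul_smul, mul_inv_cancel₀ t10] at ht1; exact ht1)
    rw [← ht, e2]; congr 1; rw [smul_smul, mul_inv_cancel₀ t10]
  have rr : ∀ z, z ≠ 0 → ¬ (dt d z a = 0 ∧ dt d z b = 0 ∧ dt d z c = 0) := by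
    rintro z hz ⟨h1, h2, h3⟩
    exact hz (zero_of_perp3 hd ha hb hc hab hac hbc h1 h2 h3)
  have haa : dt d a a ≠ 0 := fun e => ha (hd _ e)
  -- general affine points
  have gen : ∀ x y, ∃ hn : a + s x • b + t y • c ≠ 0, f (.mk K _ (nz0 x y)) = .mk K _ hn := by
    intro x y
    obtain ⟨w, hw, hfw⟩ : ∃ a, ∃ ha : a ≠ 0, f (.mk K _ (nz0 x y)) = .mk K a ha :=
      ⟨(f _).rep, (f _).rep_nonzero, (f _).mk_rep.symm⟩
    have ew := expand3 hd ha hb hc hab hac hbc w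
    set c0 := dt d w a / dt d a a
    set c1 := dt d w b / dt d b b
    set c2 := dt d w c / dt d c c
    have q1 : c1 = c0 * s x := by
      obtain ⟨z, hz, z1, z2, z3⟩ := collin f hp (nz0 x 0) nz2 (nz0 x y) (sn x) hc hw (hs x) hfc hfw 1 y
        (by ext i; fin_cases i <;> simp)
      have := rr z hz
      rw [ew] at z3
      simp only [dt_add_right, dt_smul_right, z2] at z1 z3
      have hzb : dt d z b ≠ 0 := by
        intro e
        rw [e] at z1
        exact this ⟨by linear_combination z1, e, z2⟩
      apply mul_right_cancel₀ hzb
      linear_combination z3 - c0 * z1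
    have q2 : c2 = c0 * t y := by
      obtain ⟨z, hz, z1, z2, z3⟩ := collin f hp (nz0 0 y) (nz1 0) (nz0 x y) (tn y) hb hw (ht y) hfb hfw 1 x
        (by ext i; fin_cases i <;> simp)
      have := rr z hz
      rw [ew] at z3
      simp only [dt_add_right, dt_smul_right, z2] at z1 z3
      have hzb : dt d z c ≠ 0 := by
        intro e
        rw [e] at z1
        exact this ⟨by linear_combination z1, z2, e⟩
      apply mul_right_cancel₀ hzb
      linear_combination z3 - c0 * z1
    have ew' : w = c0 • (a + s x • b + t y • c) := by
      rw [ew, q1, q2]; simp only [smul_add, smul_smul]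
    have hn : a + s x • b + t y • c ≠ 0 := by
      apply dt_zero_left' d _ a
      simp only [dt_add_left, dt_smul_left, dt_comm d b a, dt_comm d c a, hab, hac]
      simpa using haa
    refine ⟨hn, ?_⟩
    rw [hfw, Projectivization.mk_eq_mk_iff']
    exact ⟨c0, ew'.symm⟩
  have main : ∀ x y m, t y = t (y - m * x) + s x * r m := by
    intro x y m
    obtain ⟨n1, g1⟩ := gen x y
    obtain ⟨z, hz, z1, z2, z3⟩ := collin f hp (nz0 0 (y - m * x)) (nz1 m) (nz0 x y) (tn _) (rn _) n1
      (ht _) (hr m) g1 1 x (by ext i; fin_cases i <;> simp; ring)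
    have := rr z hz
    simp only [dt_add_right, dt_smul_right] at z1 z2 z3
    have hzb : dt d z c ≠ 0 := by
      intro e
      rw [e] at z1 z2
      exact this ⟨by linear_combination z1, by linear_combination z2, e⟩
    apply mul_right_cancel₀ hzb
    linear_combination z3 - z1 - s x * z2
  have m1 : ∀ x m, t (m * x) = s x * r m := by
    intro x m
    have := main x (m * x) m
    rw [sub_self, ht0] at this
    linear_combination this
  have m2 : ∀ m, r m = t m := by
    intro m
    have := m1 1 m
    rw [hs1', mul_one] at this
    rw [this]; ring
  have m3 : ∀ m, s m = t m := by
    intro m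
    have := m1 m 1
    rw [m2, ht1', one_mul] at this
    rw [this]; ring
  let σ : K →+* K := 
    { toFun := t
      map_one' := ht1'
      map_zero' := ht0
      map_mul' := by
        intro x y
        rw [m1, m2, m3]; ring
      map_add' := by
        intro x y
        have := main y (x + y) 1
        rw [m2, m3, ht1'] at this
        rw [this]; ring_nf }
  have hσ : ∀ x, σ x = t x := fun _ => rfl
  refine ⟨σ, a, b, c, ha, hb, hc, hab, hac, hbc, ?_⟩
  have scale : ∀ (k : K), k ≠ 0 → ∀ u hu, (∃ hn : σ (u 0) • a + σ (u 1) • b + σ (u 2) • c ≠ 0, 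
        f (.mk K u hu) = .mk K _ hn) → ∀ v hv, v = k • u → 
        (∃ hn : σ (v 0) • a + σ (v 1) • b + σ (v 2) • c ≠ 0, 
        f (.mk K v hv) = .mk K _ hn) := by
    rintro k hk u hu ⟨hn, e⟩ v hv rfl
    have E : σ ((k • u) 0) • a + σ ((k • u) 1) • b + σ ((k • u) 2) • c = 
        σ k • (σ (u 0) • a + σ (u 1) • b + σ (u 2) • c) := by
      simp only [Pi.smul_apply, smul_eq_mul, map_mul, smul_add, smul_smul]
    have hk' : σ k ≠ 0 := by simpa using hk
    refine ⟨by rw [E]; exact smul_ne_zero hk' hn, ?_⟩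
    have : Projectivization.mk K (k • u) hv = .mk K u hu := by
      rw [Projectivization.mk_eq_mk_iff']; exact ⟨_, rfl⟩
    rw [this, e, eq_comm, Projectivization.mk_eq_mk_iff']
    exact ⟨_, E.symm⟩
  intro v hv
  by_cases v0 : v 0 = 0
  · by_cases v1 : v 1 = 0
    · have v2 : v 2 ≠ 0 := by
        intro v2; apply hv; ext i; fin_cases i <;> simp [v0, v1, v2]
      refine scale (v 2) v2 _ nz2 ?_ v hv ?_
      · simp only [Matrix.cons_val_zero, Matrix.cons_val_one, Matrix.cons_val, map_zero, zero_smul,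
          zero_add, map_one, one_smul]
        exact ⟨hc, hfc⟩
      · ext i; fin_cases i <;> simp [v0, v1]
    · refine scale (v 1) v1 _ (nz1 (v 2 / v 1)) ?_ v hv ?_
      · simp only [Matrix.cons_val_zero, Matrix.cons_val_one, Matrix.cons_val, map_zero, zero_smul,
          zero_add, map_one, one_smul]
        have q : ∃ hn : b + r (v 2 / v 1) • c ≠ 0, f (.mk K _ (nz1 (v 2 / v 1))) = .mk K _ hn := ⟨rn _, hr _⟩
        rw [m2] at q
        exact q
      · ext i; fin_cases i <;> simp [v0]; field_simp
  · refine scale (v 0) v0 _ (nz0 (v 1 / v 0) (v 2 / v 0)) ?_ v hv ?_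
    · simp only [Matrix.cons_val_zero, Matrix.cons_val_one, Matrix.cons_val, map_one, one_smul]
      have := gen (v 1 / v 0) (v 2 / v 0)
      rw [m3] at this
      exact this
    · ext i; fin_cases i <;> simp <;> field_simp

theorem f_good {d : Fin 3 → K} (hd : ∀ v, dt d v v = 0 → v = 0) (h2 : (2 : K) ≠ 0)
    (hF : ∀ f : K →+* K, Function.Surjective f)
    (f : ℙ K (Fin 3 → K) → ℙ K (Fin 3 → K)) (hp : ∀ p q, pp d p q → pp d (f p) (f q))
    (hsi : ∀ p q, ss d p q → f p = f q → p = q) : 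
    Function.Surjective f ∧ (∀ p q, pp d (f p) (f q) → pp d p q) ∧ 
      (∀ p q, ss d (f p) (f q) → ss d p q) := by
  obtain ⟨σ, a, b, c, ha, hb, hc, hab, hac, hbc, hf⟩ := ftpg hd h2 f hp (finj hd h2 f hp hsi)
  have hσs := hF σ
  have haa : dt d a a ≠ 0 := fun e => ha (hd _ e)
  have hba : dt d b a = 0 := by rw [dt_comm, hab]
  have hca : dt d c a = 0 := by rw [dt_comm, hac]
  have hcb : dt d c b = 0 := by rw [dt_comm, hbc]
  have d0 : d 0 ≠ 0 := by
    intro h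
    have := congrFun (hd ![1, 0, 0] (by simp [dt, h])) 0
    simp at this
  have sd0 : σ (d 0) ≠ 0 := by simpa using d0
  set L : (Fin 3 → K) → (Fin 3 → K) := fun v => σ (v 0) • a + σ (v 1) • b + σ (v 2) • c with hL
  have eL : ∀ v w, dt d (L v) (L w) = σ (v 0) * σ (w 0) * dt d a a + σ (v 1) * σ (w 1) * dt d b b +
      σ (v 2) * σ (w 2) * dt d c c := by
    intro v w
    simp only [hL, dt_add_left, dt_add_right, dt_smul_left, dt_smul_right, hab, hac, hbc, hba, hca, hcb]
    ring
  have pL : ∀ v w, v ≠ 0 → w ≠ 0 → dt d v w = 0 → dt d (L v) (L w) = 0 := by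
    intro v w hv hw e
    have := hp _ _ ((pp_mk _ _ _ hv hw).2 e)
    obtain ⟨n1, e1⟩ := hf v hv
    obtain ⟨n2, e2⟩ := hf w hw
    rw [e1, e2, pp_mk] at this
    exact this
  have k1 : σ (d 1) * dt d a a = σ (d 0) * dt d b b := by
    have := pL ![d 1, -d 0, 0] ![1, 1, 0] (by intro h; exact d0 (by simpa using congrFun h 1)) (nz0 _ _)
      (by simp [dt]; ring)
    rw [eL] at this
    simp at this
    linear_combination this
  have k2 : σ (d 2) * dt d a a = σ (d 0) * dt d c c := by
    have := pL ![d 2, 0, -d 0] ![1, 0, 1] (by intro h; exact d0 (by simpa using congrFun h 2)) (nz0 _ _)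
      (by simp [dt]; ring)
    rw [eL] at this
    simp at this
    linear_combination this
  have key : ∀ v w, σ (d 0) * dt d (L v) (L w) = dt d a a * σ (dt d v w) := by
    intro v w
    rw [eL]
    simp only [dt, map_add, map_mul]
    simp only [dt] at k1 k2
    linear_combination - σ (v 1) * σ (w 1) * k1 - σ (v 2) * σ (w 2) * k2
  refine ⟨?_, ?_, ?_⟩
  · intro P
    induction P with | h w hw =>
    have ew := expand3 hd ha hb hc hab hac hbc w
    obtain ⟨x, hx⟩ := hσs (dt d w a / dt d a a)
    obtain ⟨y, hy⟩ := hσs (dt d w b / dt d b b)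
    obtain ⟨z, hz⟩ := hσs (dt d w c / dt d c c)
    have e : w = L ![x, y, z] := by
      simp only [hL, Matrix.cons_val_zero, Matrix.cons_val_one, Matrix.cons_val, hx, hy, hz]
      exact ew
    have hn : ![x, y, z] ≠ 0 := by
      intro h
      rw [h] at e
      simp [hL] at e
      exact hw e
    refine ⟨.mk K _ hn, ?_⟩
    obtain ⟨n1, e1⟩ := hf _ hn
    rw [e1]
    congr 1
    exact e.symm
  · intro p q
    induction p with | h v hv => induction q with | h w hw =>
    obtain ⟨n1, e1⟩ := hf v hv
    obtain ⟨n2, e2⟩ := hf w hw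
    rw [e1, e2, pp_mk, pp_mk]
    intro h
    have := key v w
    simp only [hL] at this
    rw [h] at this
    simpa [haa] using this
  · intro p q
    induction p with | h v hv => induction q with | h w hw =>
    obtain ⟨n1, e1⟩ := hf v hv
    obtain ⟨n2, e2⟩ := hf w hw
    rw [e1, e2, ss_mk, ss_mk]
    rintro ⟨k, hk, h⟩
    obtain ⟨l, rfl⟩ := hσs k
    have q1 := key v v
    have q2 := key w w
    simp only [hL] at q1 q2
    rw [h] at q1
    refine ⟨l, by simpa using hk, ?_⟩
    apply σ.injective
    apply mul_left_cancel₀ haa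
    simp only [map_mul, map_pow]
    linear_combination -q1 + σ l ^ 2 * q2

end ft


section coords
variable {K : Type*} [Field K]

/-- first Clifford coordinate -/
def pv (α β : K) (x y : Fin 4 → K) : Fin 3 → K :=
  ![(x 0 * y 1 - x 1 * y 0) + β * (x 2 * y 3 - x 3 * y 2),
    (x 0 * y 2 - x 2 * y 0) + α * (x 3 * y 1 - x 1 * y 3),
    (x 0 * y 3 - x 3 * y 0) + (x 1 * y 2 - x 2 * y 1)]

/-- second Clifford coordinate -/
def qv (α β : K) (x y : Fin 4 → K) : Fin 3 → K :=
  ![(x 0 * y 1 - x 1 * y 0) - β * (x 2 * y 3 - x 3 * y 2),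
    (x 0 * y 2 - x 2 * y 0) - α * (x 3 * y 1 - x 1 * y 3),
    (x 0 * y 3 - x 3 * y 0) - (x 1 * y 2 - x 2 * y 1)]

/-- the quaternion norm form -/
def nf (α β : K) (x y : Fin 4 → K) : K :=
  x 0 * y 0 + α * x 1 * y 1 + β * x 2 * y 2 + α * β * x 3 * y 3

theorem pv_qv_norm (α β : K) (x y : Fin 4 → K) :
    dt ![α, β, α * β] (pv α β x y) (pv α β x y) = dt ![α, β, α * β] (qv α β x y) (qv α β x y) := by
  simp [dt, pv, qv]; ring

theorem pv_qv_det (α β : K) (x y u v : Fin 4 → K) :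
    dt ![α, β, α * β] (pv α β x y) (pv α β u v) - dt ![α, β, α * β] (qv α β x y) (qv α β u v) =
      2 * (α * β) * Matrix.det (Matrix.of ![x, y, u, v]) := by
  simp [dt, pv, qv, Matrix.det_succ_row_zero, Fin.sum_univ_succ, Fin.succAbove]; ring

theorem pv_qv_gram (α β : K) (x y u v : Fin 4 → K) :
    dt ![α, β, α * β] (pv α β x y) (pv α β u v) + dt ![α, β, α * β] (qv α β x y) (qv α β u v) =
      2 * (nf α β x u * nf α β y v - nf α β x v * nf α β y u) := by
  simp [dt, pv, qv, nf]; ring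

theorem pv_change (α β : K) (u v : Fin 4 → K) (a b c d : K) :
    pv α β (a • u + b • v) (c • u + d • v) = (a * d - b * c) • pv α β u v ∧
    qv α β (a • u + b • v) (c • u + d • v) = (a * d - b * c) • qv α β u v := by
  constructor <;> ext i <;> fin_cases i <;> simp [pv, qv] <;> ring

theorem plu_of_pq {α β : K} (hα : α ≠ 0) (hβ : β ≠ 0) (h2 : (2 : K) ≠ 0) {x y u v : Fin 4 → K} {k : K}
    (h1 : pv α β x y = k • pv α β u v) (h3 : qv α β x y = k • qv α β u v) (i j : Fin 4) :
    x i * y j - x j * y i = k * (u i * v j - u j * v i) := by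
  have a0 := congrFun h1 0
  have a1 := congrFun h1 1
  have a2 := congrFun h1 2
  have b0 := congrFun h3 0
  have b1 := congrFun h3 1
  have b2 := congrFun h3 2
  simp [pv, qv] at a0 a1 a2 b0 b1 b2
  have c01 : x 0 * y 1 - x 1 * y 0 = k * (u 0 * v 1 - u 1 * v 0) := by
    apply mul_left_cancel₀ h2; linear_combination a0 + b0
  have c02 : x 0 * y 2 - x 2 * y 0 = k * (u 0 * v 2 - u 2 * v 0) := by
    apply mul_left_cancel₀ h2; linear_combination a1 + b1
  have c03 : x 0 * y 3 - x 3 * y 0 = k * (u 0 * v 3 - u 3 * v 0) := by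
    apply mul_left_cancel₀ h2; linear_combination a2 + b2
  have c23 : x 2 * y 3 - x 3 * y 2 = k * (u 2 * v 3 - u 3 * v 2) := by
    apply mul_left_cancel₀ h2; apply mul_left_cancel₀ hβ; linear_combination a0 - b0
  have c31 : x 3 * y 1 - x 1 * y 3 = k * (u 3 * v 1 - u 1 * v 3) := by
    apply mul_left_cancel₀ h2; apply mul_left_cancel₀ hα; linear_combination a1 - b1
  have c12 : x 1 * y 2 - x 2 * y 1 = k * (u 1 * v 2 - u 2 * v 1) := by
    apply mul_left_cancel₀ h2; linear_combination a2 - b2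
  fin_cases i <;> fin_cases j <;> simp only [Fin.mk_zero, Fin.mk_one, Fin.reduceFinMk, Fin.zero_eta]
    <;> first | ring1 | linear_combination c01 | linear_combination c02 | linear_combination c03 | linear_combination c12 | linear_combination c23 | linear_combination c31 | linear_combination - c01 | linear_combination - c02 | linear_combination - c03 | linear_combination - c12 | linear_combination - c23 | linear_combination - c31

theorem mem_of_plu {x y u v : Fin 4 → K} {k : K}
    (h : ∀ i j, x i * y j - x j * y i = k * (u i * v j - u j * v i)) {i j : Fin 4}
    (hij : x i * y j - x j * y i ≠ 0) : ∃ a b : K, u = a • x + b • y := by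
  have hk : k ≠ 0 := by
    rintro rfl
    rw [h] at hij; simp at hij
  refine ⟨(u i * y j - u j * y i) / (x i * y j - x j * y i), 
    (x i * u j - x j * u i) / (x i * y j - x j * y i), ?_⟩
  ext l
  simp only [Pi.add_apply, Pi.smul_apply, smul_eq_mul]
  rw [div_mul_eq_mul_div, div_mul_eq_mul_div, ← add_div, eq_div_iff hij]
  have e1 := h i j
  have e2 := h j l
  have e3 := h i l
  linear_combination u l * e1 - u j * e3 + u i * e2

theorem exists_pq {α β : K} (hα : α ≠ 0) (hβ : β ≠ 0) (h2 : (2 : K) ≠ 0) {v w : Fin 3 → K}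
    (hv : v ≠ 0) (h : dt ![α, β, α * β] v v = dt ![α, β, α * β] w w) :
    ∃ (x y : Fin 4 → K) (k : K), k ≠ 0 ∧ pv α β x y = k • v ∧ qv α β x y = k • w := by
  obtain ⟨a, ha⟩ : ∃ a, v 0 + w 0 = 2 * a := ⟨(v 0 + w 0) / 2, by field_simp⟩
  obtain ⟨b, hb⟩ : ∃ a, v 1 + w 1 = 2 * a := ⟨(v 1 + w 1) / 2, by field_simp⟩
  obtain ⟨c, hc⟩ : ∃ a, v 2 + w 2 = 2 * a := ⟨(v 2 + w 2) / 2, by field_simp⟩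
  obtain ⟨a', ha'⟩ : ∃ a, v 0 - w 0 = 2 * β * a := ⟨(v 0 - w 0) / (2 * β), by field_simp⟩
  obtain ⟨b', hb'⟩ : ∃ a, v 1 - w 1 = 2 * α * a := ⟨(v 1 - w 1) / (2 * α), by field_simp⟩
  obtain ⟨c', hc'⟩ : ∃ a, v 2 - w 2 = 2 * a := ⟨(v 2 - w 2) / 2, by field_simp⟩
  have v0 : v 0 = a + β * a' := by apply mul_left_cancel₀ h2; linear_combination ha + ha'
  have w0 : w 0 = a - β * a' := by apply mul_left_cancel₀ h2; linear_combination ha - ha'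
  have v1 : v 1 = b + α * b' := by apply mul_left_cancel₀ h2; linear_combination hb + hb'
  have w1 : w 1 = b - α * b' := by apply mul_left_cancel₀ h2; linear_combination hb - hb'
  have v2 : v 2 = c + c' := by apply mul_left_cancel₀ h2; linear_combination hc + hc'
  have w2 : w 2 = c - c' := by apply mul_left_cancel₀ h2; linear_combination hc - hc'
  have pl : a * a' + b * b' + c * c' = 0 := by
    simp [dt, v0, v1, v2, w0, w1, w2] at h
    apply mul_left_cancel₀ h2
    apply mul_left_cancel₀ h2
    apply mul_left_cancel₀ hα
    apply mul_left_cancel₀ hβ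
    linear_combination h
  have ev : v = ![a + β * a', b + α * b', c + c'] := by
    ext i; fin_cases i <;> simp [v0, v1, v2]
  have ew : w = ![a - β * a', b - α * b', c - c'] := by
    ext i; fin_cases i <;> simp [w0, w1, w2]
  subst ev ew
  -- rows of the skew matrix
  have main : a ≠ 0 ∨ b ≠ 0 ∨ c ≠ 0 ∨ a' ≠ 0 ∨ b' ≠ 0 ∨ c' ≠ 0 := by
    by_contra hcon
    push Not at hcon
    obtain ⟨rfl, rfl, rfl, rfl, rfl, rfl⟩ := hcon
    apply hv; ext i; fin_cases i <;> simp
  have fin : ∀ x y : Fin 4 → K, ∀ k, k ≠ 0 → x 0 * y 1 - x 1 * y 0 = k * a → x 0 * y 2 - x 2 * y 0 = k * b →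
      x 0 * y 3 - x 3 * y 0 = k * c → x 2 * y 3 - x 3 * y 2 = k * a' → x 3 * y 1 - x 1 * y 3 = k * b' →
      x 1 * y 2 - x 2 * y 1 = k * c' → ∃ (x y : Fin 4 → K) (k : K), k ≠ 0 ∧ 
        pv α β x y = k • ![a + β * a', b + α * b', c + c'] ∧ 
        qv α β x y = k • ![a - β * a', b - α * b', c - c'] := by
    intro x y k hk e1 e2 e3 e4 e5 e6
    refine ⟨x, y, k, hk, ?_, ?_⟩
    · ext i; fin_cases i <;> simp [pv, e1, e2, e3, e4, e5, e6] <;> ring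
    · ext i; fin_cases i <;> simp [qv, e1, e2, e3, e4, e5, e6] <;> ring
  rcases main with h | h | h | h | h | h
  · refine fin ![0, a, b, c] ![-a, 0, c', -b'] a h ?_ ?_ ?_ ?_ ?_ ?_ <;> simp <;> 
      first | ring1 | linear_combination pl | linear_combination - pl
  · refine fin ![0, a, b, c] ![-b, -c', 0, a'] b h ?_ ?_ ?_ ?_ ?_ ?_ <;> simp <;> 
      first | ring1 | linear_combination pl | linear_combination - pl
  · refine fin ![0, a, b, c] ![-c, b', -a', 0] c h ?_ ?_ ?_ ?_ ?_ ?_ <;> simp <;> 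
      first | ring1 | linear_combination pl | linear_combination - pl
  · refine fin ![-b, -c', 0, a'] ![-c, b', -a', 0] a' h ?_ ?_ ?_ ?_ ?_ ?_ <;> simp <;> 
      first | ring1 | linear_combination pl | linear_combination - pl
  · refine fin ![-c, b', -a', 0] ![-a, 0, c', -b'] b' h ?_ ?_ ?_ ?_ ?_ ?_ <;> simp <;> 
      first | ring1 | linear_combination pl | linear_combination - pl
  · refine fin ![-a, 0, c', -b'] ![-b, -c', 0, a'] c' h ?_ ?_ ?_ ?_ ?_ ?_ <;> simp <;> 
      first | ring1 | linear_combination pl | linear_combination - pl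

end coords

section lines

/-- linear independence of a pair -/
def LI2 (x y : V) : Prop := ∀ s t : F, s • x + t • y = 0 → s = 0 ∧ t = 0

theorem exists_LI2 {W : Submodule F V} (h : Module.finrank F W = 2) :
    ∃ x y : V, LI2 (F := F) x y ∧ W = Submodule.span F {x, y} := by
  haveI : FiniteDimensional F W := Module.finite_of_finrank_pos (by omega)
  let b := Module.finBasisOfFinrankEq F W h
  refine ⟨b 0, b 1, ?_, ?_⟩
  · have := b.linearIndependent
    intro s t hst
    have h1 := (LinearIndependent.pair_iff (R := F) (x := b 0) (y := b 1)).1 (by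
      have e : ![b 0, b 1] = b := by
        funext i; fin_cases i <;> rfl
      rw [e]; exact this) s t
    apply h1
    apply Subtype.ext
    simpa using hst
  · apply le_antisymm
    · intro w hw
      rw [Submodule.mem_span_pair]
      refine ⟨b.repr ⟨w, hw⟩ 0, b.repr ⟨w, hw⟩ 1, ?_⟩
      have := congrArg Subtype.val (b.sum_repr ⟨w, hw⟩)
      simp only [Fin.sum_univ_two] at this
      exact this
    · rw [Submodule.span_le]
      rintro w (rfl | rfl)
      · exact (b 0).2
      · exact (b 1).2

theorem finrank_LI2 {x y : V} (h : LI2 (F := F) x y) : Module.finrank F (Submodule.span F {x, y}) = 2 := by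
  have h1 : LinearIndependent F ![x, y] := LinearIndependent.pair_iff.2 h
  have := finrank_span_eq_card h1
  rw [Matrix.range_cons_cons_empty] at this
  simpa using this

variable {B : LinearMap.BilinForm F V} {e : Module.Basis (Fin 4) F V} {δ α β : F}

/-- good coordinates -/
structure Co (B : LinearMap.BilinForm F V) (e : Module.Basis (Fin 4) F V) (δ α β : F) : Prop where
  hδ : δ ≠ 0
  hα : α ≠ 0
  hβ : β ≠ 0
  h2 : (2 : F) ≠ 0
  hB : ∀ x y, B x y = δ * nf α β (e.equivFun x) (e.equivFun y)
  an : ∀ x, B x x = 0 → x = 0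

theorem nf_comm (α β : F) (x y : Fin 4 → F) : nf α β x y = nf α β y x := by simp [nf]; ring

theorem Co.comm (C : Co B e δ α β) (x y : V) : B x y = B y x := by rw [C.hB, C.hB, nf_comm]

theorem Co.hd (C : Co B e δ α β) : ∀ v, dt ![α, β, α * β] v v = 0 → v = 0 := by
  intro v hv
  have h := C.an (e.equivFun.symm ![0, v 0, v 1, v 2]) (by
    rw [C.hB]
    simp only [LinearEquiv.apply_symm_apply]
    have : nf α β ![0, v 0, v 1, v 2] ![0, v 0, v 1, v 2] = dt ![α, β, α * β] v v := by
      simp [nf, dt]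
    rw [this, hv, mul_zero])
  rw [LinearEquiv.map_eq_zero_iff] at h
  ext i
  fin_cases i
  · simpa using congrFun h 1
  · simpa using congrFun h 2
  · simpa using congrFun h 3

theorem meet_det (e : Module.Basis (Fin 4) F V) {x y u v : V} (hx : LI2 (F := F) x y) (hu : LI2 (F := F) u v) :
    Submodule.span F {x, y} ⊓ Submodule.span F {u, v} ≠ ⊥ ↔
      Matrix.det (Matrix.of ![e.equivFun x, e.equivFun y, e.equivFun u, e.equivFun v]) = 0 := by
  rw [← Matrix.exists_vecMul_eq_zero_iff, Submodule.ne_bot_iff]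
  have key : ∀ m : Fin 4 → F, Matrix.vecMul m (Matrix.of ![e.equivFun x, e.equivFun y, e.equivFun u, e.equivFun v]) = 
      e.equivFun (m 0 • x + m 1 • y + m 2 • u + m 3 • v) := by
    intro m
    ext i
    simp [Matrix.vecMul, dotProduct, Fin.sum_univ_four]
  constructor
  · rintro ⟨z, ⟨h1, h2⟩, hz⟩
    obtain ⟨a, b, rfl⟩ := Submodule.mem_span_pair.1 h1
    obtain ⟨c, d, h⟩ := Submodule.mem_span_pair.1 h2
    refine ⟨![a, b, -c, -d], ?_, ?_⟩
    · intro h0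
      apply hz
      have a0 := congrFun h0 0
      have b0 := congrFun h0 1
      simp at a0 b0
      simp [a0, b0]
    · rw [key, LinearEquiv.map_eq_zero_iff]
      simp
      rw [← h]; module
  · rintro ⟨m, hm, h⟩
    rw [key, LinearEquiv.map_eq_zero_iff] at h
    refine ⟨m 0 • x + m 1 • y, ⟨Submodule.mem_span_pair.2 ⟨_, _, rfl⟩, Submodule.mem_span_pair.2 ⟨- m 2, - m 3, ?_⟩⟩, ?_⟩
    · rw [← sub_eq_zero, ← neg_eq_zero, ← h]; module
    · intro h0
      obtain ⟨e0, e1⟩ := hx _ _ h0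
      rw [h0] at h
      obtain ⟨e2, e3⟩ := hu (m 2) (m 3) (by rw [← h]; module)
      apply hm
      ext i; fin_cases i <;> simp [e0, e1, e2, e3]

theorem meet_orth (B : LinearMap.BilinForm F V) {x y u v : V} (hx : LI2 (F := F) x y) :
    Submodule.span F {x, y} ⊓ B.orthogonal (Submodule.span F {u, v}) ≠ ⊥ ↔
      B u x * B v y - B v x * B u y = 0 := by
  have : B u x * B v y - B v x * B u y = Matrix.det !![B u x, B v x; B u y, B v y] := by
    rw [Matrix.det_fin_two_of]
  rw [this, ← Matrix.exists_vecMul_eq_zero_iff, Submodule.ne_bot_iff]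
  have key : ∀ m : Fin 2 → F, Matrix.vecMul m !![B u x, B v x; B u y, B v y] = ![B u (m 0 • x + m 1 • y), B v (m 0 • x + m 1 • y)] := by
    intro m
    ext i
    fin_cases i <;> simp [Matrix.vecMul, dotProduct]
  have orth : ∀ z, z ∈ B.orthogonal (Submodule.span F {u, v}) ↔ B u z = 0 ∧ B v z = 0 := by
    intro z
    rw [LinearMap.BilinForm.mem_orthogonal_iff]
    constructor
    · intro h
      exact ⟨h u (Submodule.subset_span (by simp)), h v (Submodule.subset_span (by simp))⟩
    · rintro ⟨h1, h2⟩ n hn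
      obtain ⟨a, b, rfl⟩ := Submodule.mem_span_pair.1 hn
      simp [h1, h2]
  constructor
  · rintro ⟨z, ⟨h1, h2⟩, hz⟩
    obtain ⟨a, b, rfl⟩ := Submodule.mem_span_pair.1 h1
    obtain ⟨h3, h4⟩ := (orth _).1 h2
    refine ⟨![a, b], ?_, ?_⟩
    · intro h0
      apply hz
      have a0 := congrFun h0 0
      have b0 := congrFun h0 1
      simp at a0 b0
      simp [a0, b0]
    · rw [key]
      simp only [Matrix.cons_val_zero, Matrix.cons_val_one]
      rw [h3, h4]; ext i; fin_cases i <;> rfl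
  · rintro ⟨m, hm, h⟩
    rw [key] at h
    have a0 := congrFun h 0
    have b0 := congrFun h 1
    refine ⟨m 0 • x + m 1 • y, ⟨Submodule.mem_span_pair.2 ⟨_, _, rfl⟩, (orth _).2 ⟨a0, b0⟩⟩, ?_⟩
    intro h0
    obtain ⟨e0, e1⟩ := hx _ _ h0
    apply hm
    ext i; fin_cases i <;> simp [e0, e1]

/-- coordinates of a pair -/
noncomputable def pV (e : Module.Basis (Fin 4) F V) (α β : F) (x y : V) : Fin 3 → F := pv α β (e.equivFun x) (e.equivFun y)
/-- coordinates of a pair -/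
noncomputable def qV (e : Module.Basis (Fin 4) F V) (α β : F) (x y : V) : Fin 3 → F := qv α β (e.equivFun x) (e.equivFun y)

theorem Co.gram (C : Co B e δ α β) (x y u v : V) : 
    δ ^ 2 * (dt ![α, β, α * β] (pV e α β x y) (pV e α β u v) + dt ![α, β, α * β] (qV e α β x y) (qV e α β u v)) =
    2 * (B u x * B v y - B v x * B u y) := by
  rw [pV, pV, qV, qV, pv_qv_gram, C.comm u, C.comm v, C.comm v, C.comm u, C.hB, C.hB, C.hB, C.hB]
  ring

theorem Co.om (C : Co B e δ α β) {x y u v : V} (hx : LI2 (F := F) x y) (hu : LI2 (F := F) u v) :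
    OrthoMeet B (Submodule.span F {x, y}) (Submodule.span F {u, v}) ↔
      dt ![α, β, α * β] (pV e α β x y) (pV e α β u v) = 0 ∧ 
      dt ![α, β, α * β] (qV e α β x y) (qV e α β u v) = 0 := by
  rw [OrthoMeet, meet_det e hx hu, meet_orth B hx]
  have h1 := pv_qv_det α β (e.equivFun x) (e.equivFun y) (e.equivFun u) (e.equivFun v)
  have h2 := C.gram x y u v
  rw [← pV, ← pV, ← qV, ← qV] at h1
  have := C.h2
  have := C.hα
  have := C.hβ
  have := C.hδ
  constructor
  · rintro ⟨h3, h4⟩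
    rw [h3, mul_zero] at h1
    rw [h4, mul_zero] at h2
    have h5 := (mul_eq_zero.1 h2).resolve_left (pow_ne_zero 2 C.hδ)
    constructor
    · apply mul_left_cancel₀ C.h2; linear_combination h5 + h1
    · apply mul_left_cancel₀ C.h2; linear_combination h5 - h1
  · rintro ⟨h3, h4⟩
    rw [h3, h4] at h1 h2
    constructor
    · rw [sub_zero, eq_comm, mul_eq_zero] at h1
      exact h1.resolve_left (mul_ne_zero C.h2 (mul_ne_zero C.hα C.hβ))
    · rw [add_zero, mul_zero, eq_comm, mul_eq_zero] at h2
      exact h2.resolve_left C.h2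

theorem Co.nrm (_C : Co B e δ α β) (x y : V) : dt ![α, β, α * β] (pV e α β x y) (pV e α β x y) = 
    dt ![α, β, α * β] (qV e α β x y) (qV e α β x y) := pv_qv_norm _ _ _ _

theorem Co.pne (C : Co B e δ α β) {x y : V} (hx : LI2 (F := F) x y) : pV e α β x y ≠ 0 := by
  intro h
  have h1 := C.gram x y x y
  rw [← C.nrm, h, dt_zero_left, add_zero, mul_zero, eq_comm, mul_eq_zero] at h1
  have h2 := h1.resolve_left C.h2
  have h3 := C.an (B x x • y - B x y • x) (by
    simp
    rw [C.comm y x] at *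
    linear_combination B x x * h2)
  have h4 := (hx (- B x y) (B x x) (by rw [← h3]; module)).2
  have h5 := C.an x h4
  have := hx 1 0 (by simp [h5])
  simp at this

theorem Co.qne (C : Co B e δ α β) {x y : V} (hx : LI2 (F := F) x y) : qV e α β x y ≠ 0 := by
  intro h
  have := C.nrm x y
  rw [h, dt_zero_left] at this
  exact C.pne hx (C.hd _ this)

theorem Co.change (_C : Co B e δ α β) (u v : V) (a b c d : F) :
    pV e α β (a • u + b • v) (c • u + d • v) = (a * d - b * c) • pV e α β u v ∧
    qV e α β (a • u + b • v) (c • u + d • v) = (a * d - b * c) • qV e α β u v := by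
  simp only [pV, qV, map_add, map_smul]
  exact pv_change _ _ _ _ _ _ _ _

theorem pV_swap (x y : V) : pV e α β y x = - pV e α β x y ∧ qV e α β y x = - qV e α β x y := by
  constructor <;> ext i <;> fin_cases i <;> simp [pV, qV, pv, qv] <;> ring

theorem Co.li (C : Co B e δ α β) {x y : V} (hx : pV e α β x y ≠ 0) : LI2 (F := F) x y := by
  intro s t h
  by_contra hcon
  rw [not_and_or] at hcon
  apply hx
  rcases hcon with hs | ht
  · have := (C.change x y s t 0 1).1
    rw [h] at this
    have h0 : pV e α β 0 ((0:F) • x + (1:F) • y) = 0 := by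
      ext i; fin_cases i <;> simp [pV, pv]
    rw [h0, mul_one, mul_zero, sub_zero, eq_comm, smul_eq_zero] at this
    exact this.resolve_left hs
  · have := (C.change x y s t 1 0).1
    rw [h] at this
    have h0 : pV e α β 0 ((1:F) • x + (0:F) • y) = 0 := by
      ext i; fin_cases i <;> simp [pV, pv]
    rw [h0, mul_one, mul_zero, zero_sub, eq_comm, smul_eq_zero, neg_eq_zero] at this
    exact this.resolve_left ht

/-- equal spans from proportional coordinates -/
theorem Co.span_le (C : Co B e δ α β) {x y u v : V} {k : F} (hx : LI2 (F := F) x y)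
    (h1 : pV e α β x y = k • pV e α β u v) (h2 : qV e α β x y = k • qV e α β u v) :
    Submodule.span F {u, v} ≤ Submodule.span F {x, y} := by
  have plu := plu_of_pq C.hα C.hβ C.h2 h1 h2
  obtain ⟨i, j, hij⟩ : ∃ i j, (e.equivFun x) i * (e.equivFun y) j - (e.equivFun x) j * (e.equivFun y) i ≠ 0 := by
    by_contra hcon
    push Not at hcon
    apply C.pne hx
    ext i
    fin_cases i <;> simp only [pV, pv, hcon] <;> simp
  have key : ∀ w : V, (∃ a b : F, e.equivFun w = a • e.equivFun x + b • e.equivFun y) → w ∈ Submodule.span F {x, y} := by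
    rintro w ⟨a, b, h⟩
    rw [Submodule.mem_span_pair]
    refine ⟨a, b, ?_⟩
    apply e.equivFun.injective
    rw [h]; simp only [map_add, map_smul]
  rw [Submodule.span_le]
  rintro w (rfl | rfl)
  · exact key _ (mem_of_plu plu hij)
  · apply key
    refine mem_of_plu (k := -k) (v := e.equivFun u) ?_ hij
    intro i j; rw [plu]; ring

theorem Co.span_eq_iff (C : Co B e δ α β) {x y u v : V} (hx : LI2 (F := F) x y) (hu : LI2 (F := F) u v) :
    Submodule.span F {x, y} = Submodule.span F {u, v} ↔ ∃ k : F, k ≠ 0 ∧ pV e α β x y = k • pV e α β u v ∧ 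
      qV e α β x y = k • qV e α β u v := by
  constructor
  · intro h
    have h1 : x ∈ Submodule.span F {u, v} := h ▸ Submodule.subset_span (by simp)
    have h2 : y ∈ Submodule.span F {u, v} := h ▸ Submodule.subset_span (by simp)
    obtain ⟨a, b, rfl⟩ := Submodule.mem_span_pair.1 h1
    obtain ⟨c, d, rfl⟩ := Submodule.mem_span_pair.1 h2
    have := C.change u v a b c d
    refine ⟨_, ?_, this⟩
    intro h0
    rw [h0, zero_smul] at this
    exact C.pne hx this.1
  · rintro ⟨k, hk, h1, h2⟩
    apply le_antisymm
    · refine C.span_le (k := k⁻¹) hu ?_ ?_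
      · rw [h1, smul_smul, inv_mul_cancel₀ hk, one_smul]
      · rw [h2, smul_smul, inv_mul_cancel₀ hk, one_smul]
    · exact C.span_le hx h1 h2

theorem Co.exv (C : Co B e δ α β) {v w : Fin 3 → F} (hv : v ≠ 0) (h : dt ![α, β, α * β] v v = dt ![α, β, α * β] w w) :
    ∃ x y : V, LI2 (F := F) x y ∧ ∃ k : F, k ≠ 0 ∧ pV e α β x y = k • v ∧ qV e α β x y = k • w := by
  obtain ⟨x, y, k, hk, h1, h2⟩ := exists_pq C.hα C.hβ C.h2 hv h
  have e1 : pV e α β (e.equivFun.symm x) (e.equivFun.symm y) = k • v := by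
    rw [pV, LinearEquiv.apply_symm_apply, LinearEquiv.apply_symm_apply, h1]
  have e2 : qV e α β (e.equivFun.symm x) (e.equivFun.symm y) = k • w := by
    rw [qV, LinearEquiv.apply_symm_apply, LinearEquiv.apply_symm_apply, h2]
  exact ⟨_, _, C.li (by rw [e1]; exact smul_ne_zero hk hv), k, hk, e1, e2⟩

theorem Co.interface (C : Co B e δ α β) : ∃ P Q : ELine F V → ℙ F (Fin 3 → F), 
    (∀ a, ss ![α, β, α * β] (P a) (Q a)) ∧ 
    (∀ a b, OrthoMeet B a.1 b.1 ↔ pp ![α, β, α * β] (P a) (P b) ∧ pp ![α, β, α * β] (Q a) (Q b)) ∧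
    (∀ p q, ss ![α, β, α * β] p q → ∃ a a', a ≠ a' ∧ ∀ c, (P c = p ∧ Q c = q) ↔ (c = a ∨ c = a')) := by
  choose X Y hXY hs using fun a : ELine F V => exists_LI2 a.2
  refine ⟨fun a => .mk F (pV e α β (X a) (Y a)) (C.pne (hXY a)), 
    fun a => .mk F (qV e α β (X a) (Y a)) (C.qne (hXY a)), ?_, ?_, ?_⟩
  · intro a
    rw [ss_mk]
    exact ⟨1, one_ne_zero, by rw [C.nrm]; ring⟩
  · intro a b
    rw [pp_mk, pp_mk, hs a, hs b]
    exact C.om (hXY a) (hXY b)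
  · intro p q
    induction p using Projectivization.ind with | h v hv => ?_
    induction q using Projectivization.ind with | h w hw => ?_
    rw [ss_mk]
    rintro ⟨c, hc, hcv⟩
    have n1 : dt ![α, β, α * β] v v = dt ![α, β, α * β] (c • w) (c • w) := by
      rw [hcv, dt_smul_left, dt_smul_right]; ring
    have n2 : dt ![α, β, α * β] v v = dt ![α, β, α * β] (-(c • w)) (-(c • w)) := by
      rw [n1, ← neg_one_smul F (c • w), dt_smul_left _ _ _ (-1), dt_smul_right _ _ _ (-1)]; ring
    obtain ⟨x, y, hx, k, hk, ep, eq⟩ := C.exv hv n1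
    obtain ⟨x', y', hx', k', hk', ep', eq'⟩ := C.exv hv n2
    have hcw : c • w ≠ 0 := smul_ne_zero hc hw
    refine ⟨⟨_, finrank_LI2 hx⟩, ⟨_, finrank_LI2 hx'⟩, ?_, ?_⟩
    · intro h
      have h := congrArg Subtype.val h
      obtain ⟨l, hl, h1, h2⟩ := (C.span_eq_iff hx hx').1 h
      rw [ep, ep', smul_smul] at h1
      rw [eq, eq'] at h2
      have h1 := smul_left_injective F hv h1
      have h2 : k = -(l * k') := smul_left_injective F hcw (by
        show k • (c • w) = (-(l * k')) • (c • w)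
        rw [h2]; module)
      have h1 : k = l * k' := h1
      rw [h1] at h2
      apply mul_ne_zero C.h2 (mul_ne_zero hl hk')
      linear_combination h2
    · intro b
      rw [Projectivization.mk_eq_mk_iff', Projectivization.mk_eq_mk_iff']
      have hb : ∀ (x y : V) (hx : LI2 (F := F) x y), b = ⟨_, finrank_LI2 hx⟩ ↔ ∃ k : F, k ≠ 0 ∧ pV e α β (X b) (Y b) = k • pV e α β x y ∧ 
          qV e α β (X b) (Y b) = k • qV e α β x y := by
        intro x y hx
        rw [← C.span_eq_iff (hXY b) hx, ← hs b]
        exact Subtype.ext_iff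
      rw [hb _ _ hx, hb _ _ hx', ep, eq, ep', eq']
      constructor
      · rintro ⟨⟨m, hm⟩, ⟨n, hn⟩⟩
        have hn0 : dt ![α, β, α * β] v v ≠ 0 := fun h => hv (C.hd _ h)
        have := C.nrm (X b) (Y b)
        have hn' : qV e α β (X b) (Y b) = (n / c) • (c • w) := by
          rw [← hn, smul_smul, div_mul_cancel₀ _ hc]
        have hm0 : m ≠ 0 := by
          rintro rfl; rw [zero_smul] at hm; exact C.pne (hXY b) hm.symm
        rw [hn', ← hm, dt_smul_left, dt_smul_right, dt_smul_left, dt_smul_right, ← n1, ← mul_assoc, ← mul_assoc] at this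
        have := mul_right_cancel₀ hn0 this
        rcases mul_self_eq_mul_self_iff.1 this with h | h
        · left
          refine ⟨m / k, div_ne_zero hm0 hk, ?_, ?_⟩
          · rw [smul_smul, div_mul_cancel₀ _ hk, hm]
          · rw [smul_smul, div_mul_cancel₀ _ hk, h, hn']
        · right
          refine ⟨m / k', div_ne_zero hm0 hk', ?_, ?_⟩
          · rw [smul_smul, div_mul_cancel₀ _ hk', hm]
          · rw [smul_smul, div_mul_cancel₀ _ hk', h, hn', neg_smul, smul_neg, neg_neg]
      · rintro (⟨l, hl, h1, h2⟩ | ⟨l, hl, h1, h2⟩)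
        · exact ⟨⟨l * k, by rw [h1, smul_smul]⟩, ⟨l * k * c, by rw [h2, smul_smul, smul_smul]⟩⟩
        · exact ⟨⟨l * k', by rw [h1, smul_smul]⟩, ⟨- (l * k' * c), by rw [h2, ← neg_smul, smul_smul, smul_smul]; ring_nf⟩⟩

end lines

section classical
variable {B : LinearMap.BilinForm F V}

theorem basis_of_ortho (hdim : Module.finrank F V = 4) (hs : ∀ x y, B x y = B y x)
    (an : ∀ x : V, B x x = 0 → x = 0) {e0 e1 e2 e3 : V} (n0 : e0 ≠ 0) (n1 : e1 ≠ 0) (n2 : e2 ≠ 0) (n3 : e3 ≠ 0)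
    (h01 : B e0 e1 = 0) (h02 : B e0 e2 = 0) (h03 : B e0 e3 = 0) (h12 : B e1 e2 = 0) (h13 : B e1 e3 = 0)
    (h23 : B e2 e3 = 0) : ∃ e : Module.Basis (Fin 4) F V, e 0 = e0 ∧ e 1 = e1 ∧ e 2 = e2 ∧ e 3 = e3 := by
  have li : LinearIndependent F ![e0, e1, e2, e3] := by
    rw [Fintype.linearIndependent_iff]
    intro g hg
    simp only [Fin.sum_univ_four] at hg
    have hg : g 0 • e0 + g 1 • e1 + g 2 • e2 + g 3 • e3 = 0 := hg
    have k0 := congrArg (B e0) hg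
    have k1 := congrArg (B e1) hg
    have k2 := congrArg (B e2) hg
    have k3 := congrArg (B e3) hg
    simp only [map_add, map_smul, map_zero, hs e1 e0, hs e2 e0, hs e3 e0, hs e2 e1, hs e3 e1, hs e3 e2, h01, h02, h03, h12, h13, h23, smul_eq_mul, mul_zero, add_zero, zero_add] at k0 k1 k2 k3
    have k0 := (mul_eq_zero.1 k0).resolve_right (fun h => n0 (an _ h))
    have k1 := (mul_eq_zero.1 k1).resolve_right (fun h => n1 (an _ h))
    have k2 := (mul_eq_zero.1 k2).resolve_right (fun h => n2 (an _ h))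
    have k3 := (mul_eq_zero.1 k3).resolve_right (fun h => n3 (an _ h))
    intro i
    fin_cases i
    · exact k0
    · exact k1
    · exact k2
    · exact k3
  refine ⟨basisOfLinearIndependentOfCardEqFinrank li (by simp [hdim]), ?_, ?_, ?_, ?_⟩ <;> simp

theorem co_of_ortho (hdim : Module.finrank F V = 4) (hs : ∀ x y, B x y = B y x) (h2 : (2 : F) ≠ 0)
    (an : ∀ x : V, B x x = 0 → x = 0) {e0 e1 e2 e3 : V} (n0 : e0 ≠ 0) (n1 : e1 ≠ 0) (n2 : e2 ≠ 0) (n3 : e3 ≠ 0)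
    (h01 : B e0 e1 = 0) (h02 : B e0 e2 = 0) (h03 : B e0 e3 = 0) (h12 : B e1 e2 = 0) (h13 : B e1 e3 = 0)
    (h23 : B e2 e3 = 0) (hd : B e0 e0 * B e3 e3 = B e1 e1 * B e2 e2) : 
    ∃ (e : Module.Basis (Fin 4) F V) (δ α β : F), Co B e δ α β := by
  obtain ⟨e, rfl, rfl, rfl, rfl⟩ := basis_of_ortho hdim hs an n0 n1 n2 n3 h01 h02 h03 h12 h13 h23
  have d0 : B (e 0) (e 0) ≠ 0 := fun h => n0 (an _ h)
  have d1 : B (e 1) (e 1) ≠ 0 := fun h => n1 (an _ h)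
  have d2 : B (e 2) (e 2) ≠ 0 := fun h => n2 (an _ h)
  refine ⟨e, B (e 0) (e 0), B (e 1) (e 1) / B (e 0) (e 0), B (e 2) (e 2) / B (e 0) (e 0), d0, 
    div_ne_zero d1 d0, div_ne_zero d2 d0, h2, ?_, an⟩
  intro x y
  have h33 : B (e 3) (e 3) = B (e 1) (e 1) * B (e 2) (e 2) / B (e 0) (e 0) := by
    rw [eq_div_iff d0, ← hd]; ring
  conv_lhs => rw [← e.sum_equivFun x, ← e.sum_equivFun y]
  generalize e.equivFun x = u
  generalize e.equivFun y = v
  simp only [Fin.sum_univ_four, map_add, map_smul, LinearMap.add_apply, LinearMap.smul_apply, smul_eq_mul,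
    hs (e 1) (e 0), hs (e 2) (e 0), hs (e 3) (e 0), hs (e 2) (e 1), hs (e 3) (e 1), hs (e 3) (e 2), 
    h01, h02, h03, h12, h13, h23, h33, nf]
  field_simp
  ring

theorem exists_perp_in (an : ∀ x : V, B x x = 0 → x = 0) {W : Submodule F V} (h : Module.finrank F W = 2) 
    {z : V} (hz : z ∈ W) (hz0 : z ≠ 0) : ∃ w ∈ W, w ≠ 0 ∧ B z w = 0 := by
  obtain ⟨x, y, hx, rfl⟩ := exists_LI2 h
  refine ⟨B z y • x - B z x • y, ?_, ?_, ?_⟩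
  · rw [Submodule.mem_span_pair]; exact ⟨B z y, - B z x, by module⟩
  · intro h0
    obtain ⟨h1, h2⟩ := hx (B z y) (- B z x) (by rw [← h0]; module)
    obtain ⟨s, t, hst⟩ := Submodule.mem_span_pair.1 hz
    apply hz0
    apply an
    nth_rewrite 2 [← hst]
    rw [neg_eq_zero] at h2
    simp [h1, h2]
  · simp; ring

theorem span_of_ortho (hs : ∀ x y, B x y = B y x) (an : ∀ x : V, B x x = 0 → x = 0) {W : Submodule F V} (h : Module.finrank F W = 2) 
    {f g : V} (hf : f ∈ W) (hg : g ∈ W) (f0 : f ≠ 0) (g0 : g ≠ 0) (hfg : B f g = 0) : 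
    LI2 (F := F) f g ∧ W = Submodule.span F {f, g} := by
  have li : LI2 (F := F) f g := by
    intro s t hst
    have k0 := congrArg (B f) hst
    have k1 := congrArg (B g) hst
    simp only [map_add, map_smul, map_zero, hs g f, hfg, smul_eq_mul, mul_zero, add_zero, zero_add] at k0 k1
    exact ⟨(mul_eq_zero.1 k0).resolve_right (fun h => f0 (an _ h)), (mul_eq_zero.1 k1).resolve_right (fun h => g0 (an _ h))⟩
  refine ⟨li, ?_⟩
  haveI : FiniteDimensional F W := Module.finite_of_finrank_pos (by omega)
  refine (Submodule.eq_of_le_of_finrank_eq ?_ ?_).symm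
  · rw [Submodule.span_le]
    rintro w (rfl | rfl)
    · exact hf
    · exact hg
  · rw [h, finrank_LI2 li]

theorem exists_perp3 (hdim : Module.finrank F V = 4) (x y z : V) : ∃ w : V, w ≠ 0 ∧ B x w = 0 ∧ B y w = 0 ∧ B z w = 0 := by
  haveI : FiniteDimensional F V := Module.finite_of_finrank_pos (by omega)
  have := LinearMap.ker_ne_bot_of_finrank_lt (f := LinearMap.pi ![B x, B y, B z]) (by simp [hdim])
  obtain ⟨w, hw, hw0⟩ := (Submodule.ne_bot_iff _).1 this
  rw [LinearMap.mem_ker] at hw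
  exact ⟨w, hw0, congrFun hw 0, congrFun hw 1, congrFun hw 2⟩

theorem mo_symm (hs : ∀ x y, B x y = B y x) {a b : Submodule F V} (ha : Module.finrank F a = 2) (hb : Module.finrank F b = 2)
    (h : a ⊓ B.orthogonal b ≠ ⊥) : b ⊓ B.orthogonal a ≠ ⊥ := by
  obtain ⟨x, y, hx, rfl⟩ := exists_LI2 ha
  obtain ⟨u, v, hu, rfl⟩ := exists_LI2 hb
  rw [meet_orth B hx] at h
  rw [meet_orth B hu, hs x u, hs x v, hs y u, hs y v]
  linear_combination h

theorem exists_co (hdim : Module.finrank F V = 4) (hs : ∀ x y, B x y = B y x) (h2 : (2 : F) ≠ 0)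
    (an : ∀ x : V, B x x = 0 → x = 0) (hc : IsClassical B) :
    ∃ (e : Module.Basis (Fin 4) F V) (δ α β : F), Co B e δ α β := by
  obtain ⟨a, b, ha, hb, ⟨x1, x2, x3, hx1, hx2, hx3, n12, n13, n23, x1a, x1b, x2a, x2b, x3a, x3b⟩, hba, hba'⟩ := hc
  obtain ⟨e0, ⟨e0x, e0a⟩, e00⟩ := (Submodule.ne_bot_iff _).1 x1a.1
  obtain ⟨e2, ⟨e2x, e2a⟩, e20⟩ := (Submodule.ne_bot_iff _).1 x1a.2
  obtain ⟨e1, e1a, e10, h01⟩ := exists_perp_in an ha e0a e00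
  obtain ⟨e3, e30, h03, h13, h23⟩ := exists_perp3 (B := B) hdim e0 e1 e2
  have h02 : B e0 e2 = 0 := LinearMap.BilinForm.mem_orthogonal_iff.1 e2a e0 e0a
  have h12 : B e1 e2 = 0 := LinearMap.BilinForm.mem_orthogonal_iff.1 e2a e1 e1a
  have sa := (span_of_ortho hs an ha e0a e1a e00 e10 h01).2
  have sx := (span_of_ortho hs an hx1 e0x e2x e00 e20 h02).2
  obtain ⟨e, E0, E1, E2, E3⟩ := basis_of_ortho hdim hs an e00 e10 e20 e30 h01 h02 h03 h12 h13 h23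
  have d0 : B e0 e0 ≠ 0 := fun h => e00 (an _ h)
  have d1 : B e1 e1 ≠ 0 := fun h => e10 (an _ h)
  have d2 : B e2 e2 ≠ 0 := fun h => e20 (an _ h)
  have d3 : B e3 e3 ≠ 0 := fun h => e30 (an _ h)
  have expd : ∀ v, ∃ c0 c1 c2 c3 : F, v = c0 • e0 + c1 • e1 + c2 • e2 + c3 • e3 := by
    intro v
    refine ⟨e.equivFun v 0, e.equivFun v 1, e.equivFun v 2, e.equivFun v 3, ?_⟩
    conv_lhs => rw [← e.sum_equivFun v]
    rw [Fin.sum_univ_four, E0, E1, E2, E3]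
  have h10 := hs e1 e0 ▸ h01
  have h20 := hs e2 e0 ▸ h02
  have h30 := hs e3 e0 ▸ h03
  have h21 := hs e2 e1 ▸ h12
  have h31 := hs e3 e1 ▸ h13
  have h32 := hs e3 e2 ▸ h23
  have perp02 : ∀ v, B e0 v = 0 → B e2 v = 0 → ∃ n t : F, v = n • e1 + t • e3 := by
    intro v k0 k2
    obtain ⟨c0, c1, c2, c3, rfl⟩ := expd v
    simp [h01, h02, h03, h20, h21, h23, d0, d2] at k0 k2
    exact ⟨c1, c3, by rw [k0, k2]; module⟩
  have perp01 : ∀ v, B e0 v = 0 → B e1 v = 0 → ∃ n t : F, v = n • e2 + t • e3 := by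
    intro v k0 k2
    obtain ⟨c0, c1, c2, c3, rfl⟩ := expd v
    simp [h01, h02, h03, h10, h12, h13, d0, d1] at k0 k2
    exact ⟨c2, c3, by rw [k0, k2]; module⟩
  -- the line b
  obtain ⟨f, ⟨fx, fb⟩, f0⟩ := (Submodule.ne_bot_iff _).1 x1b.1
  obtain ⟨g, ⟨gb, gx⟩, g0⟩ := (Submodule.ne_bot_iff _).1 (mo_symm hs hx1 hb x1b.2)
  rw [sx] at fx
  obtain ⟨m, s, rfl⟩ := Submodule.mem_span_pair.1 fx
  obtain ⟨n, t, rfl⟩ := perp02 g (LinearMap.BilinForm.mem_orthogonal_iff.1 gx e0 e0x) (LinearMap.BilinForm.mem_orthogonal_iff.1 gx e2 e2x)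
  obtain ⟨lb, sb⟩ := span_of_ortho hs an hb fb gb f0 g0 (by simp [h01, h03, h21, h23])
  -- the line x
  obtain ⟨x, hx, xa, xb, nx, nx'⟩ : ∃ x : Submodule F V, Module.finrank F x = 2 ∧ OrthoMeet B x a ∧ OrthoMeet B x b ∧ 
      x ≠ x1 ∧ x ≠ Submodule.span F {e1, e3} := by
    by_cases h : x2 = Submodule.span F {e1, e3}
    · exact ⟨x3, hx3, x3a, x3b, n13.symm, by rw [← h]; exact n23.symm⟩
    · exact ⟨x2, hx2, x2a, x2b, n12.symm, h⟩
  obtain ⟨p, ⟨px, pa⟩, p0⟩ := (Submodule.ne_bot_iff _).1 xa.1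
  obtain ⟨r, ⟨rx, ra⟩, r0⟩ := (Submodule.ne_bot_iff _).1 xa.2
  rw [sa] at pa
  obtain ⟨l, μ, rfl⟩ := Submodule.mem_span_pair.1 pa
  obtain ⟨κ, ν, rfl⟩ := perp01 r (LinearMap.BilinForm.mem_orthogonal_iff.1 ra e0 e0a) (LinearMap.BilinForm.mem_orthogonal_iff.1 ra e1 e1a)
  obtain ⟨lx, sxx⟩ := span_of_ortho hs an hx px rx p0 r0 (by simp [h02, h03, h12, h13])
  have xb1 := xb.1
  have xb2 := xb.2
  rw [sxx, sb, meet_det e lx lb] at xb1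
  rw [sxx, sb, meet_orth B lx] at xb2
  have R1 : l * ν * (s * n) = μ * κ * (m * t) := by
    simp [← E0, ← E1, ← E2, ← E3, Matrix.det_succ_row_zero, Fin.sum_univ_succ, Fin.succAbove] at xb1
    first | linear_combination xb1 | linear_combination - xb1
  have R2 : B e0 e0 * B e3 e3 * (l * ν * (m * t)) = B e1 e1 * B e2 e2 * (μ * κ * (s * n)) := by
    simp [h01, h02, h03, h12, h13, h23, h10, h20, h30, h21, h31, h32] at xb2
    linear_combination xb2
  have cancel : ∀ {W : Submodule F V} {k : F} {v : V}, k ≠ 0 → k • v ∈ W → v ∈ W := fun {W k v} hk h => (Submodule.smul_mem_iff W hk).1 h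
  have N1 : l * ν ≠ 0 ∨ μ * κ ≠ 0 := by
    by_contra hcon
    push Not at hcon
    obtain ⟨z1, z2⟩ := hcon
    by_cases hl : l = 0
    · subst hl
      have hμ : μ ≠ 0 := by rintro rfl; simp at p0
      have hκ : κ = 0 := (mul_eq_zero.1 z2).resolve_left hμ
      subst hκ
      have hν : ν ≠ 0 := by rintro rfl; simp at r0
      rw [zero_smul, zero_add] at px rx
      exact nx' (span_of_ortho hs an hx (cancel hμ px) (cancel hν rx) e10 e30 h13).2
    · have hν : ν = 0 := (mul_eq_zero.1 z1).resolve_left hl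
      subst hν
      have hκ : κ ≠ 0 := by rintro rfl; simp at r0
      have hμ : μ = 0 := (mul_eq_zero.1 z2).resolve_right hκ
      subst hμ
      rw [zero_smul, add_zero] at px rx
      exact nx ((span_of_ortho hs an hx (cancel hl px) (cancel hκ rx) e00 e20 h02).2.trans sx.symm)
  have N2 : s * n ≠ 0 ∨ m * t ≠ 0 := by
    by_contra hcon
    push Not at hcon
    obtain ⟨z1, z2⟩ := hcon
    by_cases hm : m = 0
    · subst hm
      have h1 : s ≠ 0 := by rintro rfl; simp at f0
      have h3 : n = 0 := (mul_eq_zero.1 z1).resolve_left h1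
      subst h3
      have h4 : t ≠ 0 := by rintro rfl; simp at g0
      rw [zero_smul, zero_add] at fb gb
      have e2b := cancel h1 fb
      have e3b := cancel h4 gb
      have sb' := (span_of_ortho hs an hb e2b e3b e20 e30 h23).2
      apply hba'
      apply le_antisymm
      · rw [sb', Submodule.span_le]
        have : ∀ w, B e0 w = 0 → B e1 w = 0 → w ∈ B.orthogonal a := by
          intro w k0 k1
          rw [LinearMap.BilinForm.mem_orthogonal_iff, sa]
          intro z hz
          obtain ⟨i, j, rfl⟩ := Submodule.mem_span_pair.1 hz
          simp [k0, k1]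
        rintro w (rfl | rfl)
        · exact this _ h02 h12
        · exact this _ h03 h13
      · intro w hw
        obtain ⟨i, j, rfl⟩ := perp01 w (LinearMap.BilinForm.mem_orthogonal_iff.1 hw e0 e0a) (LinearMap.BilinForm.mem_orthogonal_iff.1 hw e1 e1a)
        exact b.add_mem (b.smul_mem _ e2b) (b.smul_mem _ e3b)
    · have ht : t = 0 := (mul_eq_zero.1 z2).resolve_left hm
      subst ht
      have hn : n ≠ 0 := by rintro rfl; simp at g0
      have hs0 : s = 0 := (mul_eq_zero.1 z1).resolve_right hn
      subst hs0
      rw [zero_smul, add_zero] at fb gb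
      exact hba ((span_of_ortho hs an hb (cancel hm fb) (cancel hn gb) e00 e10 h01).2.trans sa.symm)
  have R3 : B e1 e1 * B e2 e2 * (s * n) ^ 2 = B e0 e0 * B e3 e3 * (m * t) ^ 2 := by
    rcases N1 with N | N
    · apply mul_left_cancel₀ N
      linear_combination B e1 e1 * B e2 e2 * (s * n) * R1 - (m * t) * R2
    · apply mul_left_cancel₀ N
      linear_combination B e0 e0 * B e3 e3 * (m * t) * R1 - (s * n) * R2
  have hsn : s * n ≠ 0 := by
    intro h
    rw [h] at R3
    have := N2.resolve_left (fun h' => h' h)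
    have h5 : B e0 e0 * B e3 e3 * (m * t) ^ 2 = 0 := by rw [← R3]; ring
    exact mul_ne_zero (mul_ne_zero d0 d3) (pow_ne_zero 2 this) h5
  have hmt : m * t ≠ 0 := by
    intro h
    rw [h] at R3
    have h5 : B e1 e1 * B e2 e2 * (s * n) ^ 2 = 0 := by rw [R3]; ring
    exact mul_ne_zero (mul_ne_zero d1 d2) (pow_ne_zero 2 hsn) h5
  refine co_of_ortho hdim hs h2 an e00 e10 e20 (e3 := (m * t / (s * n)) • e3) (smul_ne_zero (div_ne_zero hmt hsn) e30) 
    h01 h02 ?_ h12 ?_ ?_ ?_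
  · simp [h03]
  · simp [h13]
  · simp [h23]
  · simp only [map_smul, LinearMap.smul_apply, smul_eq_mul]
    have hsn2 : (s * n) ^ 2 ≠ 0 := pow_ne_zero 2 hsn
    apply mul_left_cancel₀ hsn2
    have h6 : (s * n) * (m * t / (s * n)) = m * t := mul_div_cancel₀ _ hsn
    generalize m * t / (s * n) = c at h6 ⊢
    rw [← h6] at R3
    linear_combination - R3

end classical

section assembly
variable {L E : Type*} {perp sim : E → E → Prop}

/-- pair coordinates for lines -/
structure LC (perp sim : E → E → Prop) (om : L → L → Prop) (P Q : L → E) : Prop where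
  hs : ∀ a, sim (P a) (Q a)
  hom : ∀ a b, om a b ↔ perp (P a) (P b) ∧ perp (Q a) (Q b)
  fib : ∀ p q, sim p q → ∃ a a', a ≠ a' ∧ ∀ c, (P c = p ∧ Q c = q) ↔ (c = a ∨ c = a')

variable {om : L → L → Prop} {P Q P' Q' : L → E} {φ : L → L}

theorem LC.ex (m : LC perp sim om P Q) {p q : E} (h : sim p q) : ∃ c, P c = p ∧ Q c = q := by
  obtain ⟨a, a', -, h⟩ := m.fib p q h
  exact ⟨a, (h a).2 (Or.inl rfl)⟩

theorem LC.swap (h : EP perp sim) (m : LC perp sim om P Q) : LC perp sim om Q P where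
  hs a := h.ssymm (m.hs a)
  hom a b := by rw [m.hom, and_comm]
  fib p q hpq := by
    obtain ⟨a, a', h1, h2⟩ := m.fib q p (h.ssymm hpq)
    exact ⟨a, a', h1, fun c => by rw [← h2, and_comm]⟩

/-- fibre counting -/
theorem LC.count (m : LC perp sim om P Q) (m' : LC perp sim om P' Q') (hinj : Function.Injective φ)
    {p q p1 q1 p' q' : E} (h1 : sim p q) (h2 : sim p1 q1) 
    (H1 : ∀ c, P c = p → Q c = q → P' (φ c) = p' ∧ Q' (φ c) = q')
    (H2 : ∀ c, P c = p1 → Q c = q1 → P' (φ c) = p' ∧ Q' (φ c) = q') : p = p1 ∧ q = q1 := by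
  obtain ⟨a, a', ne, ha⟩ := m.fib p q h1
  obtain ⟨b, hb1, hb2⟩ := m.ex h2
  have A := (ha a).2 (Or.inl rfl)
  have A' := (ha a').2 (Or.inr rfl)
  have B1 := H1 a A.1 A.2
  have B2 := H1 a' A'.1 A'.2
  have B3 := H2 b hb1 hb2
  have hs := m'.hs (φ a)
  rw [B1.1, B1.2] at hs
  obtain ⟨c, c', -, hc⟩ := m'.fib p' q' hs
  have C1 := (hc _).1 B1
  have C2 := (hc _).1 B2
  have C3 := (hc _).1 B3
  have n1 : φ a ≠ φ a' := fun h => ne (hinj h)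
  have key : b = a ∨ b = a' := by
    have : φ b = φ a ∨ φ b = φ a' := by
      rcases C1 with C1 | C1 <;> rcases C2 with C2 | C2 <;> rcases C3 with C3 | C3 <;> 
        rw [C1, C2] at n1 <;> rw [C1, C2, C3] <;> simp at n1 ⊢
    exact this.imp (fun h => hinj h) (fun h => hinj h)
  have := (ha b).2 key
  rw [← hb1, ← hb2]
  exact ⟨this.1.symm, this.2.symm⟩

theorem LC.core (h : EP perp sim) (m : LC perp sim om P Q) (m' : LC perp sim om P' Q') (hinj : Function.Injective φ)
    (hφ : ∀ a b, om a b → om (φ a) (φ b)) (f g : E → E) (hf : ∀ a, P' (φ a) = f (P a)) (hg : ∀ a, Q' (φ a) = g (Q a))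
    (good : ∀ f : E → E, (∀ p q, perp p q → perp (f p) (f q)) → (∀ p q, sim p q → f p = f q → p = q) →
      Function.Surjective f ∧ (∀ p q, perp (f p) (f q) → perp p q) ∧ (∀ p q, sim (f p) (f q) → sim p q)) :
    Function.Surjective φ ∧ ∀ a b, om (φ a) (φ b) → om a b := by
  have fp : ∀ p q, perp p q → perp (f p) (f q) ∧ perp (g p) (g q) := by
    intro p q hpq
    obtain ⟨a, a1, a2⟩ := m.ex (h.srefl p)
    obtain ⟨b, b1, b2⟩ := m.ex (h.srefl q)
    have := (m'.hom _ _).1 (hφ a b ((m.hom a b).2 ⟨by rwa [a1, b1], by rwa [a2, b2]⟩))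
    rwa [hf, hf, hg, hg, a1, b1, a2, b2] at this
  have fi : ∀ p q, sim p q → f p = f q → p = q := by
    intro p q hpq e
    refine (m.count m' hinj (p' := f p) (q' := g p) (h.srefl p) (h.ssymm hpq) ?_ ?_).1
    · intro c c1 c2; rw [hf, hg, c1, c2]; exact ⟨rfl, rfl⟩
    · intro c c1 c2; rw [hf, hg, c1, c2, e]; exact ⟨rfl, rfl⟩
  have gi : ∀ p q, sim p q → g p = g q → p = q := by
    intro p q hpq e
    refine (m.count m' hinj (p' := f p) (q' := g p) (h.srefl p) hpq ?_ ?_).2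
    · intro c c1 c2; rw [hf, hg, c1, c2]; exact ⟨rfl, rfl⟩
    · intro c c1 c2; rw [hf, hg, c1, c2, e]; exact ⟨rfl, rfl⟩
  obtain ⟨fs, fr, fr'⟩ := good f (fun p q hpq => (fp p q hpq).1) fi
  obtain ⟨gs, gr, gr'⟩ := good g (fun p q hpq => (fp p q hpq).2) gi
  constructor
  · intro c
    obtain ⟨p, hp⟩ := fs (P' c)
    obtain ⟨q, hq⟩ := gs (Q' c)
    have s1 : sim (f q) (g q) := by
      obtain ⟨b, b1, b2⟩ := m.ex (h.srefl q)
      have := m'.hs (φ b)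
      rwa [hf, hg, b1, b2] at this
    have s2 : sim (f p) (g q) := by rw [hp, hq]; exact m'.hs c
    have s3 := fr' p q (h.strans s2 (h.ssymm s1))
    obtain ⟨a, a', ne, ha⟩ := m.fib p q s3
    have A := (ha a).2 (Or.inl rfl)
    have A' := (ha a').2 (Or.inr rfl)
    obtain ⟨d, d', -, hd⟩ := m'.fib _ _ (m'.hs c)
    have C1 := (hd c).1 ⟨rfl, rfl⟩
    have C2 := (hd (φ a)).1 (by rw [hf, hg, A.1, A.2]; exact ⟨hp, hq⟩)
    have C3 := (hd (φ a')).1 (by rw [hf, hg, A'.1, A'.2]; exact ⟨hp, hq⟩)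
    have n1 : φ a ≠ φ a' := fun h => ne (hinj h)
    have : φ a = c ∨ φ a' = c := by
      rcases C1 with C1 | C1 <;> rcases C2 with C2 | C2 <;> rcases C3 with C3 | C3 <;> 
        rw [C2, C3] at n1 <;> rw [C1, C2, C3] <;> simp at n1 ⊢
    rcases this with h | h
    · exact ⟨_, h⟩
    · exact ⟨_, h⟩
  · intro a b hab
    rw [m'.hom, hf, hf, hg, hg] at hab
    rw [m.hom]
    exact ⟨fr _ _ hab.1, gr _ _ hab.2⟩

theorem LC.final [Nonempty E] (h : EP perp sim) (m : LC perp sim om P Q) (hinj : Function.Injective φ)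
    (hφ : ∀ a b, om a b → om (φ a) (φ b)) 
    (good : ∀ f : E → E, (∀ p q, perp p q → perp (f p) (f q)) → (∀ p q, sim p q → f p = f q → p = q) →
      Function.Surjective f ∧ (∀ p q, perp (f p) (f q) → perp p q) ∧ (∀ p q, sim (f p) (f q) → sim p q)) :
    Function.Surjective φ ∧ ∀ a b, om (φ a) (φ b) → om a b := by
  have step1 : ∀ a b, P a = P b → Q a = Q b → P (φ a) = P (φ b) ∧ Q (φ a) = Q (φ b) := by
    intro a b e1 e2
    obtain ⟨p1, h1⟩ := h.experp (P a)
    obtain ⟨p2, h2, h3⟩ := h.third h1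
    obtain ⟨q1, q2, s1, s2, t1, t2, t3⟩ := h.frame h1 h2 h3 (m.hs a)
    obtain ⟨c, c1, c2⟩ := m.ex s1
    obtain ⟨d, d1, d2⟩ := m.ex s2
    have ac := (m.hom _ _).1 (hφ a c ((m.hom _ _).2 (by rw [c1, c2]; exact ⟨h1, t1⟩)))
    have ad := (m.hom _ _).1 (hφ a d ((m.hom _ _).2 (by rw [d1, d2]; exact ⟨h2, t2⟩)))
    have bc := (m.hom _ _).1 (hφ b c ((m.hom _ _).2 (by rw [c1, c2, ← e1, ← e2]; exact ⟨h1, t1⟩)))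
    have bd := (m.hom _ _).1 (hφ b d ((m.hom _ _).2 (by rw [d1, d2, ← e1, ← e2]; exact ⟨h2, t2⟩)))
    have cd := (m.hom _ _).1 (hφ c d ((m.hom _ _).2 (by rw [c1, c2, d1, d2]; exact ⟨h3, t3⟩)))
    refine ⟨h.uniq ?_ ac.1 ad.1 bc.1 bd.1, h.uniq ?_ ac.2 ad.2 bc.2 bd.2⟩
    · intro e; rw [e] at cd; exact h.irr cd.1
    · intro e; rw [e] at cd; exact h.irr cd.2
  have exl : ∀ p q, ∃ c : L, sim p q → P c = p ∧ Q c = q := by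
    intro p q
    by_cases hpq : sim p q
    · obtain ⟨c, hc⟩ := m.ex hpq
      exact ⟨c, fun _ => hc⟩
    · obtain ⟨c, hc⟩ := m.ex (h.srefl p)
      exact ⟨c, fun h => absurd h hpq⟩
  choose ln hln using exl
  have hΦ : ∀ a p q, P a = p → Q a = q → P (φ a) = P (φ (ln p q)) ∧ Q (φ a) = Q (φ (ln p q)) := by
    intro a p q h1 h2
    have s : sim p q := by rw [← h1, ← h2]; exact m.hs a
    exact step1 _ _ (by rw [h1, (hln p q s).1]) (by rw [h2, (hln p q s).2])
  have pm : PM perp sim (fun p q => P (φ (ln p q))) (fun p q => Q (φ (ln p q))) := 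
    { psim := fun {p q} _ => m.hs _
      inj := by
        intro p q p' q' s s' e1 e2
        refine m.count m hinj s s' (p' := P (φ (ln p q))) (q' := Q (φ (ln p q))) (fun c c1 c2 => hΦ c p q c1 c2) ?_
        intro c c1 c2
        have e1 : P (φ (ln p q)) = P (φ (ln p' q')) := e1
        have e2 : Q (φ (ln p q)) = Q (φ (ln p' q')) := e2
        rw [e1, e2]
        exact hΦ c p' q' c1 c2
      perp1 := by
        intro p q p' q' s s' t t'
        refine ((m.hom _ _).1 (hφ _ _ ((m.hom _ _).2 ?_))).1
        rw [(hln p q s).1, (hln p q s).2, (hln p' q' s').1, (hln p' q' s').2]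
        exact ⟨t, t'⟩
      perp2 := by
        intro p q p' q' s s' t t'
        refine ((m.hom _ _).1 (hφ _ _ ((m.hom _ _).2 ?_))).2
        rw [(hln p q s).1, (hln p q s).2, (hln p' q' s').1, (hln p' q' s').2]
        exact ⟨t, t'⟩ }
  rcases pm.main h with ⟨f, g, hfg⟩ | ⟨f, g, hfg⟩
  · refine m.core h m hinj hφ f g ?_ ?_ good
    · intro a
      rw [(hΦ a _ _ rfl rfl).1]; exact (hfg _ _ (m.hs a)).1
    · intro a
      rw [(hΦ a _ _ rfl rfl).2]; exact (hfg _ _ (m.hs a)).2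
  · refine m.core h (m.swap h) hinj hφ f g ?_ ?_ good
    · intro a
      rw [(hΦ a _ _ rfl rfl).2]; exact (hfg _ _ (m.hs a)).2
    · intro a
      rw [(hΦ a _ _ rfl rfl).1]; exact (hfg _ _ (m.hs a)).1

end assembly

theorem main_of_co {B : LinearMap.BilinForm F V} {e : Module.Basis (Fin 4) F V} {δ α β : F} (C : Co B e δ α β)
    (hF : ∀ f : F →+* F, Function.Surjective f)
    (φ : ELine F V → ELine F V)
    (hinj : Function.Injective φ)
    (hφ : ∀ a b : ELine F V, Related B a.1 b.1 → Related B (φ a).1 (φ b).1) :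
    Function.Bijective φ ∧
      ∀ a b : ELine F V, Related B a.1 b.1 ↔ Related B (φ a).1 (φ b).1 := by
  obtain ⟨P, Q, i1, i2, i3⟩ := C.interface
  have m : LC (pp ![α, β, α * β]) (ss ![α, β, α * β]) (fun a b : ELine F V => OrthoMeet B a.1 b.1) P Q := ⟨i1, i2, i3⟩
  have h := EP_plane C.hd C.h2
  haveI : Nonempty (ℙ F (Fin 3 → F)) := ⟨.mk F ![1, 0, 0] (fun h => by simpa using congrFun h 0)⟩
  have hφ' : ∀ a b : ELine F V, OrthoMeet B a.1 b.1 → OrthoMeet B (φ a).1 (φ b).1 := by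
    intro a b hab
    rcases hφ a b (Or.inl hab) with h1 | h1
    · exact h1
    · have := hinj (Subtype.ext h1)
      subst this
      exact absurd ((i2 _ _).1 hab).1 h.irr
  obtain ⟨h1, h2⟩ := m.final h hinj hφ' (f_good C.hd C.h2 hF)
  refine ⟨⟨hinj, h1⟩, fun a b => ⟨hφ a b, ?_⟩⟩
  rintro (h3 | h3)
  · exact Or.inl (h2 a b h3)
  · exact Or.inr (congrArg Subtype.val (hinj (Subtype.ext h3)))

/-- **Theorem 2.** If every ring homomorphism `F → F` is surjective, then any injection `φ` of
the set of lines of a 3-dimensional classical elliptic space with `a ∼ b → φ(a) ∼ φ(b)` is an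
elliptic Plücker transformation: `φ` is bijective and `a ∼ b ↔ φ(a) ∼ φ(b)`. -/
theorem injection_preserving_related_is_pluecker
    (hdim : Module.finrank F V = 4)
    (B : LinearMap.BilinForm F V)
    (hsymm : B.IsSymm)
    (hnondeg : B.Nondegenerate)
    (haniso : ∀ x : V, B x x = 0 → x = 0)
    (hchar : (2 : F) ≠ 0)
    (hclassical : IsClassical B)
    (hF : ∀ f : F →+* F, Function.Surjective f)
    (φ : ELine F V → ELine F V)
    (hinj : Function.Injective φ)
    (hφ : ∀ a b : ELine F V, Related B a.1 b.1 → Related B (φ a).1 (φ b).1) :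
    Function.Bijective φ ∧
      ∀ a b : ELine F V, Related B a.1 b.1 ↔ Related B (φ a).1 (φ b).1 := by
  obtain ⟨e, δ, α, β, C⟩ := exists_co hdim (fun x y => hsymm.eq x y) hchar haniso hclassical
  exact main_of_co C hF φ hinj hφ
end

section
/- Let φ be an injection of the set of lines of a 3-dimensional classical elliptic space into itself such that a ∼ b implies φ(a) ∼ φ(b) for all lines a, b. Then for all lines a, b: if a ∥ b (a and b are Clifford parallel) then φ(a) ∥ φ(b). -/
variable {F V : Type*} [Field F] [AddCommGroup V] [Module F V]

/-- **Proposition 1 (11).** An injection `φ` of the set of lines of a 3-dimensional classical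
elliptic space with `a ∼ b → φ(a) ∼ φ(b)` preserves Clifford parallelism:
`a ∥ b → φ(a) ∥ φ(b)`. -/
theorem injection_preserves_cliffordParallel
    (hdim : Module.finrank F V = 4)
    (B : LinearMap.BilinForm F V)
    (hsymm : B.IsSymm)
    (hnondeg : B.Nondegenerate)
    (haniso : ∀ x : V, B x x = 0 → x = 0)
    (hchar : (2 : F) ≠ 0)
    (hclassical : IsClassical B)
    (φ : ELine F V → ELine F V)
    (hinj : Function.Injective φ)
    (hφ : ∀ a b : ELine F V, Related B a.1 b.1 → Related B (φ a).1 (φ b).1) :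
    ∀ a b : ELine F V, CliffPar B a.1 b.1 → CliffPar B (φ a).1 (φ b).1 := by
  have key : ∀ x a : ELine F V, OrthoMeet B x.1 a.1 → OrthoMeet B (φ x).1 (φ a).1 := by
    intro x a h
    rcases hφ x a (Or.inl h) with h' | h'
    · exact h'
    · exfalso
      have hxa : x = a := hinj (Subtype.ext h')
      subst hxa
      apply h.2
      rw [Submodule.eq_bot_iff]
      intro v hv
      exact haniso v (LinearMap.BilinForm.mem_orthogonal_iff.mp hv.2 v hv.1)
  have ne : ∀ x y : ELine F V, x.1 ≠ y.1 → (φ x).1 ≠ (φ y).1 := by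
    intro x y h h'
    exact h (congrArg Subtype.val (hinj (Subtype.ext h')))
  rintro a b ⟨x, y, z, hx, hy, hz, hxy, hxz, hyz, xa, xb, ya, yb, za, zb⟩
  exact ⟨(φ ⟨x, hx⟩).1, (φ ⟨y, hy⟩).1, (φ ⟨z, hz⟩).1, (φ ⟨x, hx⟩).2, (φ ⟨y, hy⟩).2,
    (φ ⟨z, hz⟩).2, ne ⟨x, hx⟩ ⟨y, hy⟩ hxy, ne ⟨x, hx⟩ ⟨z, hz⟩ hxz, ne ⟨y, hy⟩ ⟨z, hz⟩ hyz,
    key ⟨x, hx⟩ a xa, key ⟨x, hx⟩ b xb, key ⟨y, hy⟩ a ya, key ⟨y, hy⟩ b yb,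
    key ⟨z, hz⟩ a za, key ⟨z, hz⟩ b zb⟩
end

section
/- Let φ be an injection of the set of lines of a 3-dimensional classical elliptic space into itself such that a ∼ b implies φ(a) ∼ φ(b) for all lines a, b. Then φ commutes with the absolute polarity: for every line a, φ(aᗮ) = (φ(a))ᗮ. -/
variable {F V : Type*} [Field F] [AddCommGroup V] [Module F V]

theorem aux_span (B : LinearMap.BilinForm F V)
    (haniso : ∀ x : V, B x x = 0 → x = 0) (W : Submodule F V)
    (hW : Module.finrank F W = 2) (u v : V) (hu : u ∈ W) (hv : v ∈ W) (hu0 : u ≠ 0) (hv0 : v ≠ 0)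
    (huv : B u v = 0) : Submodule.span F {u, v} = W := by
  have hli : LinearIndependent F ![u, v] := by
    rw [LinearIndependent.pair_iff]
    intro s t h
    have h1 : t * B v v = 0 := by
      have h2 : B (s • u + t • v) v = 0 := by rw [h]; simp
      simpa [huv] using h2
    have ht : t = 0 := (mul_eq_zero.1 h1).resolve_right (fun h => hv0 (haniso _ h))
    subst ht
    refine ⟨?_, rfl⟩
    simpa [hu0] using h
  have : FiniteDimensional F W := Module.finite_of_finrank_pos (by omega)
  apply Submodule.eq_of_le_of_finrank_eq
  · rw [Submodule.span_le]
    rintro x (rfl | rfl) <;> assumption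
  · have := finrank_span_eq_card hli
    have hr : Set.range ![u, v] = {u, v} := by simp [Matrix.range_cons, Matrix.range_empty, Set.pair_comm]
    rw [hr] at this
    rw [hW, this]
    simp

theorem aux_orth (B : LinearMap.BilinForm F V) (W : Submodule F V)
    (hW : Module.finrank F W = 2) (u : V) : ∃ v ∈ W, v ≠ 0 ∧ B u v = 0 := by
  have : FiniteDimensional F W := Module.finite_of_finrank_pos (by omega)
  have h := LinearMap.ker_ne_bot_of_finrank_lt (f := (B u).comp W.subtype) (by simp [hW])
  obtain ⟨⟨x, hx⟩, hxk, hx0⟩ := Submodule.exists_mem_ne_zero_of_ne_bot h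
  refine ⟨x, hx, ?_, ?_⟩
  · simpa using hx0
  · simpa using hxk

theorem aux_fin (hdim : Module.finrank F V = 4) (B : LinearMap.BilinForm F V)
    (hsymm : B.IsSymm) (hnondeg : B.Nondegenerate) (a : Submodule F V)
    (ha : Module.finrank F a = 2) : Module.finrank F (B.orthogonal a) = 2 := by
  have : FiniteDimensional F V := Module.finite_of_finrank_pos (by omega)
  have := LinearMap.BilinForm.finrank_orthogonal hnondeg a
  omega

theorem aux_meet (hdim : Module.finrank F V = 4) (B : LinearMap.BilinForm F V)
    (hsymm : B.IsSymm) (hnondeg : B.Nondegenerate)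
    (haniso : ∀ x : V, B x x = 0 → x = 0) (c d : Submodule F V)
    (hc : Module.finrank F c = 2) (hd : Module.finrank F d = 2) (h : OrthoMeet B c d) :
    ∃ p q r s : V, p ≠ 0 ∧ q ≠ 0 ∧ r ≠ 0 ∧ s ≠ 0 ∧ B p q = 0 ∧ B p r = 0 ∧ B p s = 0 ∧
      B q r = 0 ∧ B q s = 0 ∧ B r s = 0 ∧
      ∀ x : Submodule F V, Module.finrank F x = 2 → OrthoMeet B x c → OrthoMeet B x d →
        x = Submodule.span F {p, s} ∨ x = Submodule.span F {q, r} := by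
  obtain ⟨h1, h2⟩ := h
  obtain ⟨p, ⟨hpc, hpd⟩, hp0⟩ := Submodule.exists_mem_ne_zero_of_ne_bot h1
  obtain ⟨q, ⟨hqc, hqd⟩, hq0⟩ := Submodule.exists_mem_ne_zero_of_ne_bot h2
  obtain ⟨r, hrd, hr0, hpr⟩ := aux_orth B d hd p
  have hcf := aux_fin hdim B hsymm hnondeg c hc
  have hdf := aux_fin hdim B hsymm hnondeg d hd
  obtain ⟨s, hsc, hs0, hrs⟩ := aux_orth B (B.orthogonal c) hcf r
  have hpq : B p q = 0 := hqd p hpd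
  have hrq : B r q = 0 := hqd r hrd
  have hps : B p s = 0 := hsc p hpc
  have hqs : B q s = 0 := hsc q hqc
  have sy : ∀ x y, B x y = B y x := fun x y => hsymm.eq x y
  have hqr : B q r = 0 := by rw [sy, hrq]
  have sc := aux_span B haniso c hc p q hpc hqc hp0 hq0 hpq
  have sd := aux_span B haniso d hd p r hpd hrd hp0 hr0 hpr
  have hrc : r ∈ B.orthogonal c := by
    intro y hy
    rw [← sc, Submodule.mem_span_pair] at hy
    obtain ⟨α, β, rfl⟩ := hy
    change B _ _ = 0
    simp [hpr, hqr]
  have sc' := aux_span B haniso _ hcf r s hrc hsc hr0 hs0 hrs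
  refine ⟨p, q, r, s, hp0, hq0, hr0, hs0, hpq, hpr, hps, hqr, hqs, hrs, ?_⟩
  intro x hx hxc hxd
  obtain ⟨u, ⟨hux, huc⟩, hu0⟩ := Submodule.exists_mem_ne_zero_of_ne_bot hxc.1
  obtain ⟨v, ⟨hvx, hvc⟩, hv0⟩ := Submodule.exists_mem_ne_zero_of_ne_bot hxc.2
  obtain ⟨w, ⟨hwx, hwd⟩, hw0⟩ := Submodule.exists_mem_ne_zero_of_ne_bot hxd.1
  obtain ⟨t, ⟨htx, htd⟩, ht0⟩ := Submodule.exists_mem_ne_zero_of_ne_bot hxd.2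
  have huv : B u v = 0 := hvc u huc
  have sx := aux_span B haniso x hx u v hux hvx hu0 hv0 huv
  have htp : B p t = 0 := htd p hpd
  have htr : B r t = 0 := htd r hrd
  have hsd : B s w = 0 := by
    rw [SetLike.mem_coe, ← sd, Submodule.mem_span_pair] at hwd
    obtain ⟨α, β, rfl⟩ := hwd
    simp [sy s, hps, hrs]
  have hqw : B q w = 0 := by rw [sy]; exact hqd w hwd
  rw [SetLike.mem_coe, ← sc, Submodule.mem_span_pair] at huc
  rw [SetLike.mem_coe, ← sc', Submodule.mem_span_pair] at hvc
  rw [SetLike.mem_coe, ← sx, Submodule.mem_span_pair] at hwx htx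
  obtain ⟨α, β, rfl⟩ := huc
  obtain ⟨γ, δ, rfl⟩ := hvc
  obtain ⟨l, m, rfl⟩ := hwx
  obtain ⟨l', m', rfl⟩ := htx
  have npp : B p p ≠ 0 := fun h => hp0 (haniso _ h)
  have nqq : B q q ≠ 0 := fun h => hq0 (haniso _ h)
  have nrr : B r r ≠ 0 := fun h => hr0 (haniso _ h)
  have nss : B s s ≠ 0 := fun h => hs0 (haniso _ h)
  have e1 : l = 0 ∨ β = 0 := by
    simpa [sy q p, hpq, hqr, hqs, nqq] using hqw
  have e2 : m = 0 ∨ δ = 0 := by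
    simpa [sy s, hps, hrs, hqs, nss] using hsd
  have e3 : l' = 0 ∨ α = 0 := by
    simpa [hpq, hpr, hps, npp] using htp
  have e4 : m' = 0 ∨ γ = 0 := by
    simpa [sy r p, sy r q, hpr, hqr, hrs, nrr] using htr
  by_cases hl : l = 0
  · right
    have hm : m ≠ 0 := by rintro rfl; simp [hl] at hw0
    have hδ := e2.resolve_left hm
    have hγ : γ ≠ 0 := by rintro rfl; simp [hδ] at hv0
    have hm' := e4.resolve_right hγ
    have hl' : l' ≠ 0 := by rintro rfl; simp [hm'] at ht0
    have hα := e3.resolve_left hl'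
    have hβ : β ≠ 0 := by rintro rfl; simp [hα] at hu0
    subst hα hδ
    rw [zero_smul, zero_add] at hux
    rw [zero_smul, add_zero] at hvx
    exact (aux_span B haniso x hx q r ((x.smul_mem_iff hβ).1 hux)
      ((x.smul_mem_iff hγ).1 hvx) hq0 hr0 hqr).symm
  · left
    have hβ := e1.resolve_left hl
    have hα : α ≠ 0 := by rintro rfl; simp [hβ] at hu0
    have hl' := e3.resolve_right hα
    have hm' : m' ≠ 0 := by rintro rfl; simp [hl'] at ht0
    have hγ := e4.resolve_left hm'
    have hδ : δ ≠ 0 := by rintro rfl; simp [hγ] at hv0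
    subst hβ hγ
    rw [zero_smul, add_zero] at hux
    rw [zero_smul, zero_add] at hvx
    exact (aux_span B haniso x hx p s ((x.smul_mem_iff hα).1 hux)
      ((x.smul_mem_iff hδ).1 hvx) hp0 hs0 hps).symm

theorem aux_om (B : LinearMap.BilinForm F V) (a b : Submodule F V) (x y : V)
    (hx0 : x ≠ 0) (hy0 : y ≠ 0) (hxa : x ∈ a) (hxb : x ∈ b) (hya : y ∈ a)
    (hyb : y ∈ B.orthogonal b) : OrthoMeet B a b :=
  ⟨(Submodule.ne_bot_iff _).2 ⟨x, ⟨hxa, hxb⟩, hx0⟩, (Submodule.ne_bot_iff _).2 ⟨y, ⟨hya, hyb⟩, hy0⟩⟩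

theorem aux_orthspan (B : LinearMap.BilinForm F V) (u v x y : V)
    (h1 : B u x = 0) (h2 : B u y = 0) (h3 : B v x = 0) (h4 : B v y = 0) :
    Submodule.span F {x, y} ≤ B.orthogonal (Submodule.span F {u, v}) := by
  intro z hz w hw
  rw [Submodule.mem_span_pair] at hz hw
  obtain ⟨α, β, rfl⟩ := hz
  obtain ⟨γ, δ, rfl⟩ := hw
  change B _ _ = 0
  simp [h1, h2, h3, h4]

theorem aux_rank (B : LinearMap.BilinForm F V)
    (haniso : ∀ x : V, B x x = 0 → x = 0) (u v : V) (hu0 : u ≠ 0) (hv0 : v ≠ 0)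
    (huv : B u v = 0) : Module.finrank F (Submodule.span F {u, v}) = 2 := by
  have hli : LinearIndependent F ![u, v] := by
    rw [LinearIndependent.pair_iff]
    intro s t h
    have h1 : t * B v v = 0 := by
      have h2 : B (s • u + t • v) v = 0 := by rw [h]; simp
      simpa [huv] using h2
    have ht : t = 0 := (mul_eq_zero.1 h1).resolve_right (fun h => hv0 (haniso _ h))
    subst ht
    refine ⟨?_, rfl⟩
    simpa [hu0] using h
  have this := finrank_span_eq_card hli
  have hr : Set.range ![u, v] = {u, v} := by simp [Matrix.range_cons, Matrix.range_empty, Set.pair_comm]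
  rw [hr] at this
  rw [this]
  simp

/-- **Proposition 1 (12).** An injection `φ` of the set of lines of a 3-dimensional classical
elliptic space with `a ∼ b → φ(a) ∼ φ(b)` commutes with the absolute polarity:
`φ(aᗮ) = (φ(a))ᗮ` for every line `a`. -/
theorem injection_commutes_with_polarity
    (hdim : Module.finrank F V = 4)
    (B : LinearMap.BilinForm F V)
    (hsymm : B.IsSymm)
    (hnondeg : B.Nondegenerate)
    (haniso : ∀ x : V, B x x = 0 → x = 0)
    (hchar : (2 : F) ≠ 0)
    (hclassical : IsClassical B)
    (φ : ELine F V → ELine F V)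
    (hinj : Function.Injective φ)
    (hφ : ∀ a b : ELine F V, Related B a.1 b.1 → Related B (φ a).1 (φ b).1) :
    ∀ a b : ELine F V, b.1 = B.orthogonal a.1 → (φ b).1 = B.orthogonal (φ a).1 := by
  intro a b hab
  have : FiniteDimensional F V := Module.finite_of_finrank_pos (by omega)
  have sy : ∀ x y, B x y = B y x := fun x y => hsymm.eq x y
  have ha := a.2
  have hb := b.2
  obtain ⟨e1, he1a, he10, -⟩ := aux_orth B a.1 ha 0
  obtain ⟨e2, he2a, he20, h12⟩ := aux_orth B a.1 ha e1
  obtain ⟨e3, he3b, he30, -⟩ := aux_orth B b.1 hb 0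
  obtain ⟨e4, he4b, he40, h34⟩ := aux_orth B b.1 hb e3
  have hor : ∀ x ∈ a.1, ∀ y ∈ b.1, B x y = 0 := fun x hx y hy => by
    rw [hab] at hy; exact hy x hx
  have h13 := hor _ he1a _ he3b
  have h14 := hor _ he1a _ he4b
  have h23 := hor _ he2a _ he3b
  have h24 := hor _ he2a _ he4b
  have sa := aux_span B haniso a.1 ha e1 e2 he1a he2a he10 he20 h12
  have sb := aux_span B haniso b.1 hb e3 e4 he3b he4b he30 he40 h34
  let c : ELine F V := ⟨Submodule.span F {e1, e3}, aux_rank B haniso _ _ he10 he30 h13⟩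
  let d : ELine F V := ⟨Submodule.span F {e1, e4}, aux_rank B haniso _ _ he10 he40 h14⟩
  have m1c : e1 ∈ c.1 := Submodule.subset_span (by simp)
  have m3c : e3 ∈ c.1 := Submodule.subset_span (by simp)
  have m1d : e1 ∈ d.1 := Submodule.subset_span (by simp)
  have m4d : e4 ∈ d.1 := Submodule.subset_span (by simp)
  have o2c : e2 ∈ B.orthogonal c.1 := aux_orthspan B e1 e3 e2 e4 h12 h14
    (by rw [sy, h23]) h34 (Submodule.subset_span (by simp))
  have o4c : e4 ∈ B.orthogonal c.1 := aux_orthspan B e1 e3 e2 e4 h12 h14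
    (by rw [sy, h23]) h34 (Submodule.subset_span (by simp))
  have o2d : e2 ∈ B.orthogonal d.1 := aux_orthspan B e1 e4 e2 e3 h12 h13
    (by rw [sy, h24]) (by rw [sy, h34]) (Submodule.subset_span (by simp))
  have o3d : e3 ∈ B.orthogonal d.1 := aux_orthspan B e1 e4 e2 e3 h12 h13
    (by rw [sy, h24]) (by rw [sy, h34]) (Submodule.subset_span (by simp))
  have hac : OrthoMeet B a.1 c.1 := aux_om B _ _ e1 e2 he10 he20 he1a m1c he2a o2c
  have had : OrthoMeet B a.1 d.1 := aux_om B _ _ e1 e2 he10 he20 he1a m1d he2a o2d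
  have hbc : OrthoMeet B b.1 c.1 := aux_om B _ _ e3 e4 he30 he40 he3b m3c he4b o4c
  have hbd : OrthoMeet B b.1 d.1 := aux_om B _ _ e4 e3 he40 he30 he4b m4d he3b o3d
  have hcd : OrthoMeet B c.1 d.1 := aux_om B _ _ e1 e3 he10 he30 m1c m1d m3c o3d
  have key : ∀ x y : ELine F V, OrthoMeet B x.1 y.1 → OrthoMeet B (φ x).1 (φ y).1 := by
    intro x y hxy
    rcases hφ x y (Or.inl hxy) with h | h
    · exact h
    · exfalso
      have hxy' : x = y := hinj (Subtype.ext h)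
      subst hxy'
      obtain ⟨z, ⟨hz1, hz2⟩, hz0⟩ := Submodule.exists_mem_ne_zero_of_ne_bot hxy.2
      exact hz0 (haniso z (hz2 z hz1))
  have hne : (φ a).1 ≠ (φ b).1 := by
    intro h
    have : a = b := hinj (Subtype.ext h)
    subst this
    exact he10 (haniso _ (hor _ he1a _ he1a))
  obtain ⟨p, q, r, s, hp, hq, hr, hs, hpq, hpr, hps, hqr, hqs, hrs, H⟩ :=
    aux_meet hdim B hsymm hnondeg haniso _ _ (φ c).2 (φ d).2 (key _ _ hcd)
  have fa := aux_fin hdim B hsymm hnondeg _ (φ a).2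
  apply Submodule.eq_of_le_of_finrank_eq _ ((φ b).2.trans fa.symm)
  rcases H _ (φ a).2 (key _ _ hac) (key _ _ had) with h | h <;>
  rcases H _ (φ b).2 (key _ _ hbc) (key _ _ hbd) with h' | h'
  · exact absurd (h.trans h'.symm) hne
  · rw [h, h']
    exact aux_orthspan B _ _ _ _ hpq hpr (by rw [sy, hqs]) (by rw [sy, hrs])
  · rw [h, h']
    exact aux_orthspan B _ _ _ _ (by rw [sy, hpq]) hqs (by rw [sy, hpr]) hrs
  · exact absurd (h.trans h'.symm) hne
end

section
/- Let φ be an injection of the set of lines of a 3-dimensional classical elliptic space into itself such that a ∼ b implies φ(a) ∼ φ(b) for all lines a, b. Then for all lines a, b: if a ∥ b and b ∉ {a, aᗮ}, then φ(a) ∥ φ(b) and φ(b) ∉ {φ(a), (φ(a))ᗮ}. -/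
variable {F V : Type*} [Field F] [AddCommGroup V] [Module F V]

theorem hx_rank2 {B : LinearMap.BilinForm F V} (haniso : ∀ x : V, B x x = 0 → x = 0)
    {e f : V} (he : e ≠ 0) (hf : f ≠ 0) (hef : B e f = 0) :
    Module.finrank F (Submodule.span F {e, f}) = 2 := by
  have hli : LinearIndependent F ![e, f] := by
    rw [LinearIndependent.pair_iff' he]
    intro a h
    have h2 : a * B e e = 0 := by
      have := hef
      rw [← h] at this
      simpa using this
    rcases mul_eq_zero.mp h2 with h3 | h3
    · apply hf
      rw [← h, h3, zero_smul]
    · exact he (haniso _ h3)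
  have := finrank_span_eq_card hli
  rw [Matrix.range_cons_cons_empty] at this
  simpa using this

theorem hx_span {B : LinearMap.BilinForm F V} (haniso : ∀ x : V, B x x = 0 → x = 0)
    {e f : V} (he : e ≠ 0) (hf : f ≠ 0) (hef : B e f = 0) {W : Submodule F V}
    (hW : Module.finrank F W = 2) (h1 : e ∈ W) (h2 : f ∈ W) :
    W = Submodule.span F {e, f} := by
  have : FiniteDimensional F W := Module.finite_of_finrank_pos (by omega)
  symm
  apply Submodule.eq_of_le_of_finrank_eq
  · rw [Submodule.span_le]
    rintro y (rfl | rfl) <;> assumption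
  · rw [hW, hx_rank2 haniso he hf hef]

theorem hx_ne {W : Submodule F V} {e : V} (h : e ∈ W) (he : e ≠ 0) : W ≠ ⊥ := by
  rintro rfl
  exact he (by simpa using h)

theorem hx_polar [FiniteDimensional F V] (hdim : Module.finrank F V = 4)
    {B : LinearMap.BilinForm F V} (hnondeg : B.Nondegenerate)
    {c d : Submodule F V} (hc : Module.finrank F c = 2) (hd : Module.finrank F d = 2)
    (h : c ⊓ d ≠ ⊥) : B.orthogonal c ⊓ B.orthogonal d ≠ ⊥ := by
  have h1 := Submodule.finrank_sup_add_finrank_inf_eq c d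
  have h2 : Module.finrank F (c ⊓ d : Submodule F V) ≠ 0 := by
    rwa [Ne, Submodule.finrank_eq_zero]
  have h3 := LinearMap.BilinForm.finrank_orthogonal hnondeg (c ⊔ d)
  have h4 : B.orthogonal (c ⊔ d) ≤ B.orthogonal c ⊓ B.orthogonal d :=
    le_inf (LinearMap.BilinForm.orthogonal_le le_sup_left)
      (LinearMap.BilinForm.orthogonal_le le_sup_right)
  intro h5
  rw [h5, le_bot_iff] at h4
  rw [h4, finrank_bot] at h3
  omega

theorem hx_classify {B : LinearMap.BilinForm F V} (hsymm : ∀ x y, B x y = B y x)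
    (haniso : ∀ x : V, B x x = 0 → x = 0)
    {e1 e2 e3 e4 : V} (h1 : e1 ≠ 0) (h2 : e2 ≠ 0) (h3 : e3 ≠ 0) (h4 : e4 ≠ 0)
    (h12 : B e1 e2 = 0) (h13 : B e1 e3 = 0) (h14 : B e1 e4 = 0) (h23 : B e2 e3 = 0)
    (h24 : B e2 e4 = 0) (h34 : B e3 e4 = 0) {x c c' d d' : Submodule F V}
    (hx : Module.finrank F x = 2)
    (hc : c = Submodule.span F {e1, e3}) (hd : d = Submodule.span F {e1, e4})
    (hc' : c' = Submodule.span F {e2, e4}) (hd' : d' = Submodule.span F {e2, e3})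
    (xc : x ⊓ c ≠ ⊥) (xc' : x ⊓ c' ≠ ⊥) (xd : x ⊓ d ≠ ⊥) (xd' : x ⊓ d' ≠ ⊥) :
    x = Submodule.span F {e1, e2} ∨ x = Submodule.span F {e3, e4} := by
  obtain ⟨u, ⟨hu, huc⟩, hu0⟩ := Submodule.exists_mem_ne_zero_of_ne_bot xc
  obtain ⟨w, ⟨hw, hwc⟩, hw0⟩ := Submodule.exists_mem_ne_zero_of_ne_bot xc'
  obtain ⟨v, ⟨hv, hvd⟩, hv0⟩ := Submodule.exists_mem_ne_zero_of_ne_bot xd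
  obtain ⟨z, ⟨hz, hzd⟩, hz0⟩ := Submodule.exists_mem_ne_zero_of_ne_bot xd'
  subst hc hd hc' hd'
  obtain ⟨α, β, rfl⟩ := Submodule.mem_span_pair.mp huc
  obtain ⟨γ, δ, rfl⟩ := Submodule.mem_span_pair.mp hwc
  obtain ⟨p, q, rfl⟩ := Submodule.mem_span_pair.mp hvd
  obtain ⟨r, k, rfl⟩ := Submodule.mem_span_pair.mp hzd
  have h21 := (hsymm e2 e1).trans h12
  have h31 := (hsymm e3 e1).trans h13
  have h41 := (hsymm e4 e1).trans h14
  have h32 := (hsymm e3 e2).trans h23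
  have h42 := (hsymm e4 e2).trans h24
  have h43 := (hsymm e4 e3).trans h34
  have n1 : B e1 e1 ≠ 0 := fun h => h1 (haniso _ h)
  have n2 : B e2 e2 ≠ 0 := fun h => h2 (haniso _ h)
  have n3 : B e3 e3 ≠ 0 := fun h => h3 (haniso _ h)
  have n4 : B e4 e4 ≠ 0 := fun h => h4 (haniso _ h)
  have hxs := hx_span haniso hu0 hw0 (by simp [h12, h14, h32, h34]) hx hu hw
  rw [hxs] at hv hz
  obtain ⟨s, t, hst⟩ := Submodule.mem_span_pair.mp hv
  obtain ⟨s', t', hst'⟩ := Submodule.mem_span_pair.mp hz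
  have a1 := congrArg (B e1) hst
  have a2 := congrArg (B e2) hst
  have a3 := congrArg (B e3) hst
  have a4 := congrArg (B e4) hst
  have b1 := congrArg (B e1) hst'
  have b2 := congrArg (B e2) hst'
  have b3 := congrArg (B e3) hst'
  have b4 := congrArg (B e4) hst'
  simp only [map_add, map_smul, smul_eq_mul, h12, h13, h14, h21, h23, h24, h31, h32, h34, h41,
    h42, h43, mul_zero, add_zero, zero_add, mul_eq_zero, n1, n2, n3, n4, or_false]
    at a1 a2 a3 a4 b1 b2 b3 b4
  have hst0 : s ≠ 0 ∨ t ≠ 0 := by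
    by_contra! h
    apply hv0
    rw [← hst, h.1, h.2]; simp
  have hst0' : s' ≠ 0 ∨ t' ≠ 0 := by
    by_contra! h
    apply hz0
    rw [← hst', h.1, h.2]; simp
  have hab : α ≠ 0 ∨ β ≠ 0 := by
    by_contra! h
    apply hu0
    rw [h.1, h.2]; simp
  have hcd : γ ≠ 0 ∨ δ ≠ 0 := by
    by_contra! h
    apply hw0
    rw [h.1, h.2]; simp
  have key : (β = 0 ∧ δ = 0 ∧ α ≠ 0 ∧ γ ≠ 0) ∨ (α = 0 ∧ γ = 0 ∧ β ≠ 0 ∧ δ ≠ 0) := by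
    clear hst hst' hv hz hxs hu hw huc hwc hvd hzd hu0 hw0 hv0 hz0 xc xd xc' xd' a1 a4 b2 b3
    rcases hst0 with hs0 | ht0
    · have hb := a3.resolve_left hs0
      have ha := hab.resolve_right (fun h => h hb)
      have hs' := b1.resolve_right ha
      have ht' := hst0'.resolve_left (fun h => h hs')
      have hd := b4.resolve_left ht'
      exact Or.inl ⟨hb, hd, ha, hcd.resolve_right (fun h => h hd)⟩
    · have hg := a2.resolve_left ht0
      have hd := hcd.resolve_left (fun h => h hg)
      have ht' := b4.resolve_right hd
      have hs' := hst0'.resolve_right (fun h => h ht')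
      have ha := b1.resolve_left hs'
      exact Or.inr ⟨ha, hg, hab.resolve_left (fun h => h ha), hd⟩
  rcases key with ⟨rfl, rfl, ha, hg⟩ | ⟨rfl, rfl, ha, hg⟩
  · left
    refine hx_span haniso h1 h2 h12 hx ?_ ?_
    · rw [zero_smul, add_zero] at hu
      exact (Submodule.smul_mem_iff _ ha).mp hu
    · rw [zero_smul, add_zero] at hw
      exact (Submodule.smul_mem_iff _ hg).mp hw
  · right
    refine hx_span haniso h3 h4 h34 hx ?_ ?_
    · rw [zero_smul, zero_add] at hu
      exact (Submodule.smul_mem_iff _ ha).mp hu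
    · rw [zero_smul, zero_add] at hw
      exact (Submodule.smul_mem_iff _ hg).mp hw

theorem hx_two [FiniteDimensional F V] (hdim : Module.finrank F V = 4)
    {B : LinearMap.BilinForm F V} (hsymm : B.IsSymm) (hnondeg : B.Nondegenerate)
    (haniso : ∀ x : V, B x x = 0 → x = 0)
    {c d p q : Submodule F V} (hc : Module.finrank F c = 2) (hd : Module.finrank F d = 2)
    (hp : Module.finrank F p = 2) (hq : Module.finrank F q = 2)
    (hcd : OrthoMeet B c d) (hpc : OrthoMeet B p c) (hpd : OrthoMeet B p d)
    (hqc : OrthoMeet B q c) (hqd : OrthoMeet B q d) : q = p ∨ q = B.orthogonal p := by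
  have hs : ∀ x y, B x y = B y x := fun x y => hsymm.eq x y
  have oo := LinearMap.BilinForm.orthogonal_orthogonal hnondeg hsymm.isRefl
  have fo := LinearMap.BilinForm.finrank_orthogonal hnondeg
  have hc' : Module.finrank F (B.orthogonal c) = 2 := by rw [fo]; omega
  have hd' : Module.finrank F (B.orthogonal d) = 2 := by rw [fo]; omega
  have k2 := hx_polar hdim hnondeg hc hd hcd.1
  have k4 := hx_polar hdim hnondeg hc hd' hcd.2
  rw [oo] at k4
  obtain ⟨e1, ⟨e1c, e1d⟩, h1⟩ := Submodule.exists_mem_ne_zero_of_ne_bot hcd.1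
  obtain ⟨e3, ⟨e3c, e3d⟩, h3⟩ := Submodule.exists_mem_ne_zero_of_ne_bot hcd.2
  obtain ⟨e2, ⟨e2c, e2d⟩, h2⟩ := Submodule.exists_mem_ne_zero_of_ne_bot k2
  obtain ⟨e4, ⟨e4c, e4d⟩, h4⟩ := Submodule.exists_mem_ne_zero_of_ne_bot k4
  have h12 : B e1 e2 = 0 := e2c e1 e1c
  have h13 : B e1 e3 = 0 := e3d e1 e1d
  have h14 : B e1 e4 = 0 := e4c e1 e1c
  have h23 : B e2 e3 = 0 := (hs _ _).trans (e2c e3 e3c)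
  have h24 : B e2 e4 = 0 := (hs _ _).trans (e2d e4 e4d)
  have h34 : B e3 e4 = 0 := e4c e3 e3c
  have sc := hx_span haniso h1 h3 h13 hc e1c e3c
  have sd := hx_span haniso h1 h4 h14 hd e1d e4d
  have sc' := hx_span haniso h2 h4 h24 hc' e2c e4c
  have sd' := hx_span haniso h2 h3 h23 hd' e2d e3d
  have P := hx_classify hs haniso h1 h2 h3 h4 h12 h13 h14 h23 h24 h34 hp sc sd sc' sd'
    hpc.1 hpc.2 hpd.1 hpd.2
  have Q := hx_classify hs haniso h1 h2 h3 h4 h12 h13 h14 h23 h24 h34 hq sc sd sc' sd'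
    hqc.1 hqc.2 hqd.1 hqd.2
  have E : B.orthogonal (Submodule.span F {e1, e2}) = Submodule.span F {e3, e4} := by
    refine hx_span haniso h3 h4 h34 (by rw [fo, hx_rank2 haniso h1 h2 h12]; omega) ?_ ?_
    · intro n hn
      obtain ⟨a, b, rfl⟩ := Submodule.mem_span_pair.mp hn
      simp [h13, h23]
    · intro n hn
      obtain ⟨a, b, rfl⟩ := Submodule.mem_span_pair.mp hn
      simp [h14, h24]
  rcases P with P | P <;> rcases Q with Q | Q
  · left; rw [P, Q]
  · right; rw [P, Q, E]
  · right; rw [P, Q, ← E, oo]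
  · left; rw [P, Q]

theorem hx_basis [FiniteDimensional F V] {B : LinearMap.BilinForm F V}
    (hnondeg : B.Nondegenerate) (hdim : Module.finrank F V = 4)
    {a : Submodule F V} (ha : Module.finrank F a = 2) :
    ∃ e f : V, e ≠ 0 ∧ f ≠ 0 ∧ e ∈ a ∧ f ∈ a ∧ B e f = 0 := by
  have ha0 : a ≠ ⊥ := by
    rintro rfl
    simp at ha
  obtain ⟨e, he, he0⟩ := Submodule.exists_mem_ne_zero_of_ne_bot ha0
  have h1 : Module.finrank F (Submodule.span F {e}) = 1 := finrank_span_singleton he0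
  have h2 := LinearMap.BilinForm.finrank_orthogonal hnondeg (Submodule.span F {e})
  have h3 := Submodule.finrank_sup_add_finrank_inf_eq a (B.orthogonal (Submodule.span F {e}))
  have h4 := Submodule.finrank_le (a ⊔ B.orthogonal (Submodule.span F {e}))
  have h5 : a ⊓ B.orthogonal (Submodule.span F {e}) ≠ ⊥ := by
    intro h
    rw [h, finrank_bot] at h3
    omega
  obtain ⟨f, ⟨hf, hf'⟩, hf0⟩ := Submodule.exists_mem_ne_zero_of_ne_bot h5
  exact ⟨e, f, he0, hf0, he, hf, hf' e (Submodule.mem_span_singleton_self e)⟩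

/-- **Proposition 1 (13).** An injection `φ` of the set of lines of a 3-dimensional classical
elliptic space with `a ∼ b → φ(a) ∼ φ(b)` satisfies: if `a ∥ b` and `b ∉ {a, aᗮ}`, then
`φ(a) ∥ φ(b)` and `φ(b) ∉ {φ(a), (φ(a))ᗮ}`. -/
theorem injection_preserves_proper_parallels
    (hdim : Module.finrank F V = 4)
    (B : LinearMap.BilinForm F V)
    (hsymm : B.IsSymm)
    (hnondeg : B.Nondegenerate)
    (haniso : ∀ x : V, B x x = 0 → x = 0)
    (hchar : (2 : F) ≠ 0)
    (hclassical : IsClassical B)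
    (φ : ELine F V → ELine F V)
    (hinj : Function.Injective φ)
    (hφ : ∀ a b : ELine F V, Related B a.1 b.1 → Related B (φ a).1 (φ b).1) :
    ∀ a b : ELine F V, CliffPar B a.1 b.1 → b.1 ≠ a.1 → b.1 ≠ B.orthogonal a.1 →
      CliffPar B (φ a).1 (φ b).1 ∧ (φ b).1 ≠ (φ a).1 ∧ (φ b).1 ≠ B.orthogonal (φ a).1 := by
  have : FiniteDimensional F V := Module.finite_of_finrank_pos (by omega)
  have hs : ∀ x y, B x y = B y x := fun x y => hsymm.eq x y
  have oo := LinearMap.BilinForm.orthogonal_orthogonal hnondeg hsymm.isRefl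
  have fo := LinearMap.BilinForm.finrank_orthogonal hnondeg
  have irr : ∀ a : Submodule F V, ¬ OrthoMeet B a a := by
    rintro a ⟨-, h⟩
    obtain ⟨e, ⟨h1, h2⟩, h0⟩ := Submodule.exists_mem_ne_zero_of_ne_bot h
    exact h0 (haniso e (h2 e h1))
  have pres : ∀ a b : ELine F V, OrthoMeet B a.1 b.1 → OrthoMeet B (φ a).1 (φ b).1 := by
    intro a b h
    rcases hφ a b (Or.inl h) with h1 | h1
    · exact h1
    · have : a = b := hinj (Subtype.ext h1)
      subst this
      exact absurd h (irr _)
  intro a b hab hne hne'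
  refine ⟨?_, ?_, ?_⟩
  · obtain ⟨x, y, z, hx, hy, hz, hxy, hxz, hyz, xa, xb, ya, yb, za, zb⟩ := hab
    have inj : ∀ (u w : ELine F V), u.1 ≠ w.1 → (φ u).1 ≠ (φ w).1 := fun u w h h' =>
      h (congrArg Subtype.val (hinj (Subtype.ext h')))
    exact ⟨(φ ⟨x, hx⟩).1, (φ ⟨y, hy⟩).1, (φ ⟨z, hz⟩).1, (φ ⟨x, hx⟩).2, (φ ⟨y, hy⟩).2,
      (φ ⟨z, hz⟩).2, inj _ _ hxy, inj _ _ hxz, inj _ _ hyz, pres _ _ xa, pres _ _ xb,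
      pres _ _ ya, pres _ _ yb, pres _ _ za, pres _ _ zb⟩
  · intro h
    exact hne (congrArg Subtype.val (hinj (Subtype.ext h)))
  · intro h
    obtain ⟨a, ha⟩ := a
    have ha' : Module.finrank F (B.orthogonal a) = 2 := by rw [fo]; omega
    obtain ⟨e1, e2, h1, h2, e1a, e2a, h12⟩ := hx_basis hnondeg hdim ha
    obtain ⟨e3, e4, h3, h4, e3a, e4a, h34⟩ := hx_basis hnondeg hdim ha'
    have h13 : B e1 e3 = 0 := e3a e1 e1a
    have h14 : B e1 e4 = 0 := e4a e1 e1a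
    have h23 : B e2 e3 = 0 := e3a e2 e2a
    have h24 : B e2 e4 = 0 := e4a e2 e2a
    have hc := hx_rank2 haniso h1 h3 h13
    have hd := hx_rank2 haniso h1 h4 h14
    have mo : ∀ x y z : V, B x z = 0 → B y z = 0 →
        z ∈ B.orthogonal (Submodule.span F {x, y}) := by
      intro x y z hx hy n hn
      obtain ⟨a, b, rfl⟩ := Submodule.mem_span_pair.mp hn
      simp [hx, hy]
    have ml : ∀ x y : V, x ∈ Submodule.span F {x, y} := fun x y =>
      Submodule.subset_span (by simp)
    have mr : ∀ x y : V, y ∈ Submodule.span F {x, y} := fun x y =>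
      Submodule.subset_span (by simp)
    have cd : OrthoMeet B (Submodule.span F {e1, e3}) (Submodule.span F {e1, e4}) :=
      ⟨hx_ne ⟨ml _ _, ml _ _⟩ h1, hx_ne ⟨mr _ _, mo _ _ _ h13 ((hs _ _).trans h34)⟩ h3⟩
    have ac : OrthoMeet B a (Submodule.span F {e1, e3}) :=
      ⟨hx_ne ⟨e1a, ml _ _⟩ h1, hx_ne ⟨e2a, mo _ _ _ h12 ((hs _ _).trans h23)⟩ h2⟩
    have ad : OrthoMeet B a (Submodule.span F {e1, e4}) :=
      ⟨hx_ne ⟨e1a, ml _ _⟩ h1, hx_ne ⟨e2a, mo _ _ _ h12 ((hs _ _).trans h24)⟩ h2⟩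
    have a'c : OrthoMeet B (B.orthogonal a) (Submodule.span F {e1, e3}) :=
      ⟨hx_ne ⟨e3a, mr _ _⟩ h3, hx_ne ⟨e4a, mo _ _ _ h14 h34⟩ h4⟩
    have a'd : OrthoMeet B (B.orthogonal a) (Submodule.span F {e1, e4}) :=
      ⟨hx_ne ⟨e4a, mr _ _⟩ h4, hx_ne ⟨e3a, mo _ _ _ h13 ((hs _ _).trans h34)⟩ h3⟩
    rcases hx_two hdim hsymm hnondeg haniso (φ ⟨_, hc⟩).2 (φ ⟨_, hd⟩).2 (φ ⟨_, ha⟩).2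
      (φ ⟨_, ha'⟩).2 (pres ⟨_, hc⟩ ⟨_, hd⟩ cd) (pres ⟨_, ha⟩ ⟨_, hc⟩ ac)
      (pres ⟨_, ha⟩ ⟨_, hd⟩ ad) (pres ⟨_, ha'⟩ ⟨_, hc⟩ a'c) (pres ⟨_, ha'⟩ ⟨_, hd⟩ a'd)
      with h' | h'
    · have h5 : B.orthogonal a = a := congrArg Subtype.val (hinj (Subtype.ext h'))
      have h6 : e1 ∈ B.orthogonal a := by rw [h5]; exact e1a
      exact h1 (haniso _ (h6 e1 e1a))
    · exact hne' (congrArg Subtype.val (hinj (Subtype.ext (h.trans h'.symm))))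
end

section
/- The relation ≈ of orthogonal intersection of lines is symmetric: for all lines a, b, if a ⊓ b ≠ ⊥ and a ⊓ bᗮ ≠ ⊥, then b ⊓ a ≠ ⊥ and b ⊓ aᗮ ≠ ⊥. (Equivalently, for 2-dimensional subspaces a, b of V one has a ⊓ bᗮ ≠ ⊥ if and only if aᗮ ⊓ b ≠ ⊥.) -/
variable {F V : Type*} [Field F] [AddCommGroup V] [Module F V]

/-- The relation `≈` of orthogonal intersection of lines is symmetric. -/
theorem orthoMeet_symm
    (hdim : Module.finrank F V = 4)
    (B : LinearMap.BilinForm F V)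
    (hsymm : B.IsSymm)
    (hnondeg : B.Nondegenerate)
    (haniso : ∀ x : V, B x x = 0 → x = 0) :
    ∀ a b : Submodule F V, Module.finrank F a = 2 → Module.finrank F b = 2 →
      a ⊓ b ≠ ⊥ → a ⊓ B.orthogonal b ≠ ⊥ → b ⊓ a ≠ ⊥ ∧ b ⊓ B.orthogonal a ≠ ⊥ := by
  intro a b ha hb hab hx
  haveI : FiniteDimensional F V := Module.finite_of_finrank_pos (by omega)
  refine ⟨by rwa [inf_comm], fun h => ?_⟩
  obtain ⟨x, ⟨hxa, hxb⟩, hx0⟩ := Submodule.exists_mem_ne_zero_of_ne_bot hx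
  have h1 := LinearMap.BilinForm.finrank_orthogonal hnondeg a
  have h2 := Submodule.finrank_sup_add_finrank_inf_eq b (B.orthogonal a)
  rw [h, finrank_bot] at h2
  have h3 : b ⊔ B.orthogonal a = ⊤ := Submodule.eq_top_of_finrank_eq (by omega)
  have hmem : x ∈ b ⊔ B.orthogonal a := by rw [h3]; trivial
  obtain ⟨y, hy, z, hz, hyz⟩ := Submodule.mem_sup.1 hmem
  have e1 : B y x = 0 := hxb y hy
  have e2 : B x z = 0 := hz x hxa
  have e3 : B z x = 0 := hsymm.eq_iff.1 e2
  apply hx0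
  apply haniso
  calc B x x = B (y + z) x := by rw [hyz]
    _ = 0 := by rw [map_add, LinearMap.add_apply, e1, e3, add_zero]
end

section
/- Let b₁, b₂ be lines of a 3-dimensional classical elliptic space with b₁ ≈ b₂ (so b₁ and b₂ are distinct and concurrent). Put a' := (b₁ ⊓ b₂)ᗮ ⊓ (b₁ ⊔ b₂). Then a' is a line, a' ≠ a'ᗮ, and the lines intersecting both b₁ and b₂ orthogonally are exactly a' and a'ᗮ: {x : x is a line, x ≈ b₁ and x ≈ b₂} = {a', a'ᗮ}. -/
variable {F V : Type*} [Field F] [AddCommGroup V] [Module F V]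

lemma aux_expand (hdim : Module.finrank F V = 4) (B : LinearMap.BilinForm F V)
    (hs : ∀ x y, B x y = B y x) (ha : ∀ x : V, B x x = 0 → x = 0)
    (p q r s : V) (hp : p ≠ 0) (hq : q ≠ 0) (hr : r ≠ 0) (hs0 : s ≠ 0)
    (hpq : B p q = 0) (hpr : B p r = 0) (hps : B p s = 0) (hqr : B q r = 0) (hqs : B q s = 0)
    (hrs : B r s = 0) (v : V) :
    v = (B p v / B p p) • p + (B q v / B q q) • q + (B r v / B r r) • r + (B s v / B s s) • s := by
  have np : B p p ≠ 0 := fun h => hp (ha p h)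
  have nq : B q q ≠ 0 := fun h => hq (ha q h)
  have nr : B r r ≠ 0 := fun h => hr (ha r h)
  have ns : B s s ≠ 0 := fun h => hs0 (ha s h)
  have hqp := (hs q p).trans hpq
  have hrp := (hs r p).trans hpr
  have hsp := (hs s p).trans hps
  have hrq := (hs r q).trans hqr
  have hsq := (hs s q).trans hqs
  have hsr := (hs s r).trans hrs
  have hli : LinearIndependent F ![p, q, r, s] := by
    rw [Fintype.linearIndependent_iff]
    intro g hg
    simp only [Fin.sum_univ_four, Matrix.cons_val] at hg
    have e1 := congrArg (B p) hg
    have e2 := congrArg (B q) hg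
    have e3 := congrArg (B r) hg
    have e4 := congrArg (B s) hg
    simp only [map_add, map_smul, map_zero, smul_eq_mul, hpq, hpr, hps, hqr, hqs, hrs, hqp, hrp, hsp, hrq,
      hsq, hsr, np, nq, nr, ns, mul_zero, add_zero, zero_add, mul_eq_zero, or_false] at e1 e2 e3 e4
    intro i
    fin_cases i
    exacts [e1, e2, e3, e4]
  have htop := hli.span_eq_top_of_card_eq_finrank (by simp [hdim])
  rw [← sub_eq_zero]
  set w := v - ((B p v / B p p) • p + (B q v / B q q) • q + (B r v / B r r) • r
    + (B s v / B s s) • s) with hw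
  have o1 : B p w = 0 := by
    simp only [hw, map_sub, map_add, map_smul, smul_eq_mul, *]; field_simp; ring
  have o2 : B q w = 0 := by
    simp only [hw, map_sub, map_add, map_smul, smul_eq_mul, *]; field_simp; ring
  have o3 : B r w = 0 := by
    simp only [hw, map_sub, map_add, map_smul, smul_eq_mul, *]; field_simp; ring
  have o4 : B s w = 0 := by
    simp only [hw, map_sub, map_add, map_smul, smul_eq_mul, *]; field_simp; ring
  have hle : Submodule.span F (Set.range ![p, q, r, s]) ≤ LinearMap.ker (B w) := by
    rw [Submodule.span_le]
    rintro _ ⟨i, rfl⟩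
    fin_cases i
    · exact (hs _ _).trans o1
    · exact (hs _ _).trans o2
    · exact (hs _ _).trans o3
    · exact (hs _ _).trans o4
  exact ha w (hle (htop ▸ Submodule.mem_top))

lemma aux_finrank (B : LinearMap.BilinForm F V)
    (hs : ∀ x y, B x y = B y x) (ha : ∀ x : V, B x x = 0 → x = 0)
    (p q : V) (hp : p ≠ 0) (hq : q ≠ 0) (hpq : B p q = 0) :
    Module.finrank F (Submodule.span F {p, q}) = 2 := by
  have np : B p p ≠ 0 := fun h => hp (ha p h)
  have nq : B q q ≠ 0 := fun h => hq (ha q h)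
  have hqp := (hs q p).trans hpq
  have hli : LinearIndependent F ![p, q] := by
    rw [LinearIndependent.pair_iff]
    intro a b hg
    have e1 := congrArg (B p) hg
    have e2 := congrArg (B q) hg
    simp only [map_add, map_smul, map_zero, smul_eq_mul, hpq, hqp, np, nq, mul_zero, add_zero, zero_add,
      mul_eq_zero, or_false] at e1 e2
    exact ⟨e1, e2⟩
  have := finrank_span_eq_card hli
  have e : Set.range ![p, q] = {p, q} := by
    ext x
    constructor
    · rintro ⟨i, rfl⟩
      fin_cases i
      · exact Or.inl rfl
      · exact Or.inr rfl
    · rintro (rfl | rfl)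
      · exact ⟨0, rfl⟩
      · exact ⟨1, rfl⟩
  rw [e, Fintype.card_fin] at this
  exact this

lemma aux_eq [FiniteDimensional F V] (B : LinearMap.BilinForm F V)
    (hs : ∀ x y, B x y = B y x) (ha : ∀ x : V, B x x = 0 → x = 0)
    (b : Submodule F V) (hb : Module.finrank F b = 2)
    (p q : V) (hp : p ≠ 0) (hq : q ≠ 0) (hpq : B p q = 0) (hpb : p ∈ b) (hqb : q ∈ b) :
    b = Submodule.span F {p, q} := by
  symm
  apply Submodule.eq_of_le_of_finrank_eq
  · rw [Submodule.span_le]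
    rintro x (rfl | rfl) <;> assumption
  · rw [aux_finrank B hs ha p q hp hq hpq, hb]

lemma aux_mem (hdim : Module.finrank F V = 4) (B : LinearMap.BilinForm F V)
    (hs : ∀ x y, B x y = B y x) (ha : ∀ x : V, B x x = 0 → x = 0)
    (p q r s : V) (hp : p ≠ 0) (hq : q ≠ 0) (hr : r ≠ 0) (hs0 : s ≠ 0)
    (hpq : B p q = 0) (hpr : B p r = 0) (hps : B p s = 0) (hqr : B q r = 0) (hqs : B q s = 0)
    (hrs : B r s = 0) (v : V) :
    v ∈ Submodule.span F {p, q} ↔ B r v = 0 ∧ B s v = 0 := by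
  constructor
  · rw [Submodule.mem_span_pair]
    rintro ⟨a, b, rfl⟩
    have hrp := (hs r p).trans hpr
    have hsp := (hs s p).trans hps
    have hrq := (hs r q).trans hqr
    have hsq := (hs s q).trans hqs
    simp [*]
  · rintro ⟨h1, h2⟩
    have := aux_expand hdim B hs ha p q r s hp hq hr hs0 hpq hpr hps hqr hqs hrs v
    rw [h1, h2] at this
    rw [Submodule.mem_span_pair]
    exact ⟨_, _, by simpa using this.symm⟩

lemma aux_orth_s7 (B : LinearMap.BilinForm F V) (p q v : V) :
    v ∈ B.orthogonal (Submodule.span F {p, q}) ↔ B p v = 0 ∧ B q v = 0 := by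
  rw [LinearMap.BilinForm.mem_orthogonal_iff]
  constructor
  · intro h
    exact ⟨h p (Submodule.subset_span (by simp)), h q (Submodule.subset_span (by simp))⟩
  · rintro ⟨h1, h2⟩ n hn
    rw [Submodule.mem_span_pair] at hn
    obtain ⟨a, b, rfl⟩ := hn
    simp [h1, h2]

/-- For orthogonally intersecting lines `b₁ ≈ b₂`, the line
`a' := (b₁ ⊓ b₂)ᗮ ⊓ (b₁ ⊔ b₂)` and its polar `a'ᗮ` are exactly the lines intersecting both
`b₁` and `b₂` orthogonally; moreover `a' ≠ a'ᗮ`. -/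
theorem common_orthogonal_transversals
    (hdim : Module.finrank F V = 4)
    (B : LinearMap.BilinForm F V)
    (hsymm : B.IsSymm)
    (hnondeg : B.Nondegenerate)
    (haniso : ∀ x : V, B x x = 0 → x = 0)
    (hchar : (2 : F) ≠ 0)
    (hclassical : IsClassical B)
    (b₁ b₂ : Submodule F V)
    (hb₁ : Module.finrank F b₁ = 2) (hb₂ : Module.finrank F b₂ = 2)
    (hmeet : OrthoMeet B b₁ b₂) :
    Module.finrank F (B.orthogonal (b₁ ⊓ b₂) ⊓ (b₁ ⊔ b₂) : Submodule F V) = 2 ∧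
    B.orthogonal (b₁ ⊓ b₂) ⊓ (b₁ ⊔ b₂) ≠ B.orthogonal (B.orthogonal (b₁ ⊓ b₂) ⊓ (b₁ ⊔ b₂)) ∧
    {x : Submodule F V | Module.finrank F x = 2 ∧ OrthoMeet B x b₁ ∧ OrthoMeet B x b₂} =
      {B.orthogonal (b₁ ⊓ b₂) ⊓ (b₁ ⊔ b₂),
        B.orthogonal (B.orthogonal (b₁ ⊓ b₂) ⊓ (b₁ ⊔ b₂))} := by
  have hs : ∀ x y, B x y = B y x := fun x y => hsymm.eq y x |>.symm ▸ rfl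
  have ha := haniso
  have hfd : FiniteDimensional F V := FiniteDimensional.of_finrank_pos (by omega)
  obtain ⟨hm1, hm2⟩ := hmeet
  obtain ⟨p, ⟨hp1, hp2⟩, hp⟩ := Submodule.exists_mem_ne_zero_of_ne_bot hm1
  obtain ⟨q, ⟨hq1, hq2⟩, hq⟩ := Submodule.exists_mem_ne_zero_of_ne_bot hm2
  rw [SetLike.mem_coe, LinearMap.BilinForm.mem_orthogonal_iff] at hq2
  have hfo : ∀ W : Submodule F V, Module.finrank F (B.orthogonal W) =
      4 - Module.finrank F W := fun W => by
    rw [LinearMap.BilinForm.finrank_orthogonal hnondeg, hdim]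
  have hpq : B p q = 0 := hq2 p hp2
  obtain ⟨r, ⟨hr2, hr'⟩, hr⟩ : ∃ r ∈ b₂ ⊓ B.orthogonal (Submodule.span F {p}), r ≠ 0 := by
    apply Submodule.exists_mem_ne_zero_of_ne_bot
    intro h
    have h1 := Submodule.finrank_add_finrank_le_of_disjoint (disjoint_iff.2 h)
    rw [hfo, finrank_span_singleton hp, hb₂, hdim] at h1
    omega
  have hpr : B p r = 0 := hr' p (Submodule.mem_span_singleton_self p)
  have hqr : B q r = 0 := (hs _ _).trans (hq2 r hr2)
  obtain ⟨s, hs', hs0⟩ : ∃ s ∈ B.orthogonal (Submodule.span F (Set.range ![p, q, r])), s ≠ 0 := by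
    apply Submodule.exists_mem_ne_zero_of_ne_bot
    intro h
    have h1 := hfo (Submodule.span F (Set.range ![p, q, r]))
    have h2 := finrank_range_le_card (R := F) ![p, q, r]
    rw [h, finrank_bot] at h1
    rw [Set.finrank, Fintype.card_fin] at h2
    omega
  have hps : B p s = 0 := hs' p (Submodule.subset_span ⟨0, rfl⟩)
  have hqs : B q s = 0 := hs' q (Submodule.subset_span ⟨1, rfl⟩)
  have hrs : B r s = 0 := hs' r (Submodule.subset_span ⟨2, rfl⟩)
  have hqp := (hs q p).trans hpq
  have hrp := (hs r p).trans hpr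
  have hsp := (hs s p).trans hps
  have hrq := (hs r q).trans hqr
  have hsq := (hs s q).trans hqs
  have hsr := (hs s r).trans hrs
  have np : B p p ≠ 0 := fun h => hp (ha p h)
  have nq : B q q ≠ 0 := fun h => hq (ha q h)
  have nr : B r r ≠ 0 := fun h => hr (ha r h)
  have ns : B s s ≠ 0 := fun h => hs0 (ha s h)
  have E1 := aux_eq B hs ha b₁ hb₁ p q hp hq hpq hp1 hq1
  have E2 := aux_eq B hs ha b₂ hb₂ p r hp hr hpr hp2 hr2
  have M1 : ∀ v, v ∈ b₁ ↔ B r v = 0 ∧ B s v = 0 := fun v => E1 ▸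
    aux_mem hdim B hs ha p q r s hp hq hr hs0 hpq hpr hps hqr hqs hrs v
  have M2 : ∀ v, v ∈ b₂ ↔ B q v = 0 ∧ B s v = 0 := fun v => E2 ▸
    aux_mem hdim B hs ha p r q s hp hr hq hs0 hpr hpq hps hrq hrs hqs v
  have O1 : ∀ v, v ∈ B.orthogonal b₁ ↔ B p v = 0 ∧ B q v = 0 := fun v => E1 ▸ aux_orth_s7 B p q v
  have O2 : ∀ v, v ∈ B.orthogonal b₂ ↔ B p v = 0 ∧ B r v = 0 := fun v => E2 ▸ aux_orth_s7 B p r v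
  have MA := aux_mem hdim B hs ha q r p s hq hr hp hs0 hqr hqp hqs hrp hrs hps
  have MC := aux_mem hdim B hs ha p s q r hp hs0 hq hr hps hpq hpr hsq hsr hqr
  have EA : B.orthogonal (b₁ ⊓ b₂) ⊓ (b₁ ⊔ b₂) = Submodule.span F {q, r} := by
    apply le_antisymm
    · rintro v ⟨hv1, hv2⟩
      rw [MA]
      refine ⟨hv1 p ⟨hp1, hp2⟩, ?_⟩
      have : b₁ ⊔ b₂ ≤ LinearMap.ker (B s) :=
        sup_le (fun v hv => ((M1 v).1 hv).2) (fun v hv => ((M2 v).1 hv).2)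
      exact this hv2
    · rw [Submodule.span_le]
      rintro x (rfl | rfl)
      · exact ⟨fun v hv => (hs _ _).trans ((M2 v).1 hv.2).1, Submodule.mem_sup_left hq1⟩
      · exact ⟨fun v hv => (hs _ _).trans ((M1 v).1 hv.1).1, Submodule.mem_sup_right hr2⟩
  have EC : B.orthogonal (Submodule.span F {q, r}) = Submodule.span F {p, s} := by
    ext v
    rw [aux_orth_s7, MC]
  have ne : ∀ (x y : Submodule F V) (v : V), v ≠ 0 → v ∈ x → v ∈ y → x ⊓ y ≠ ⊥ :=
    fun x y v h0 h1 h2 h => h0 ((Submodule.mem_bot F).1 (h ▸ Submodule.mem_inf.2 ⟨h1, h2⟩))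
  rw [EA, EC]
  refine ⟨aux_finrank B hs ha q r hq hr hqr, ?_, ?_⟩
  · intro h
    have : q ∈ Submodule.span F {p, s} := h ▸ Submodule.subset_span (by simp)
    exact nq ((MC q).1 this).1
  ext x
  simp only [Set.mem_setOf_eq, Set.mem_insert_iff, Set.mem_singleton_iff]
  constructor
  · rintro ⟨hx, ⟨h1, h2⟩, ⟨h3, h4⟩⟩
    obtain ⟨u, ⟨hux, hu⟩, hu0⟩ := Submodule.exists_mem_ne_zero_of_ne_bot h1
    obtain ⟨w, ⟨hwx, hw⟩, hw0⟩ := Submodule.exists_mem_ne_zero_of_ne_bot h2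
    obtain ⟨y, ⟨hyx, hy⟩, hy0⟩ := Submodule.exists_mem_ne_zero_of_ne_bot h3
    obtain ⟨z, ⟨hzx, hz⟩, hz0⟩ := Submodule.exists_mem_ne_zero_of_ne_bot h4
    have huw : B u w = 0 := (LinearMap.BilinForm.mem_orthogonal_iff.1 hw) u hu
    have EX := aux_eq B hs ha x hx u w hu0 hw0 huw hux hwx
    have exp := aux_expand hdim B hs ha p q r s hp hq hr hs0 hpq hpr hps hqr hqs hrs
    have zero : ∀ v, B p v = 0 → B q v = 0 → B r v = 0 → B s v = 0 → v = 0 := by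
      intro v h1 h2 h3 h4
      have := exp v
      rw [h1, h2, h3, h4] at this
      simpa using this
    replace hu := (M1 u).1 hu
    replace hw := (O1 w).1 hw
    replace hy := (M2 y).1 hy
    replace hz := (O2 z).1 hz
    rw [EX, SetLike.mem_coe, Submodule.mem_span_pair] at hyx hzx
    obtain ⟨l, m, rfl⟩ := hyx
    obtain ⟨l', m', rfl⟩ := hzx
    simp only [map_add, map_smul, smul_eq_mul, hu.1, hu.2, hw.1, hw.2, mul_zero, add_zero,
      zero_add, mul_eq_zero] at hy hz
    have k1 : B q u = 0 ∨ B s w = 0 := by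
      by_contra! hc
      apply hy0
      simp [hy.1.resolve_right hc.1, hy.2.resolve_right hc.2]
    have k2 : B p u = 0 ∨ B r w = 0 := by
      by_contra! hc
      apply hz0
      simp [hz.1.resolve_right hc.1, hz.2.resolve_right hc.2]
    rcases k1 with k1 | k1
    · right
      have hpu : B p u ≠ 0 := fun h => hu0 (zero u h k1 hu.1 hu.2)
      have hrw := k2.resolve_left hpu
      rw [EX]
      symm
      refine aux_eq B hs ha _ (aux_finrank B hs ha p s hp hs0 hps) u w hu0 hw0 huw ?_ ?_
      · exact (MC u).2 ⟨k1, hu.1⟩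
      · exact (MC w).2 ⟨hw.2, hrw⟩
    · left
      have hrw : B r w ≠ 0 := fun h => hw0 (zero w hw.1 hw.2 h k1)
      have hpu := k2.resolve_right hrw
      rw [EX]
      symm
      refine aux_eq B hs ha _ (aux_finrank B hs ha q r hq hr hqr) u w hu0 hw0 huw ?_ ?_
      · exact (MA u).2 ⟨hpu, hu.2⟩
      · exact (MA w).2 ⟨hw.1, k1⟩
  · rintro (rfl | rfl)
    · refine ⟨aux_finrank B hs ha q r hq hr hqr, ⟨ne _ _ q hq ?_ hq1, ne _ _ r hr ?_ ?_⟩,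
        ⟨ne _ _ r hr ?_ hr2, ne _ _ q hq ?_ ?_⟩⟩ <;> simp [MA, O1, O2, hpq, hpr, hps, hqr, hqs, hrs, hqp, hrp, hsp, hrq, hsq, hsr]
    · refine ⟨aux_finrank B hs ha p s hp hs0 hps, ⟨ne _ _ p hp ?_ hp1, ne _ _ s hs0 ?_ ?_⟩,
        ⟨ne _ _ p hp ?_ hp2, ne _ _ s hs0 ?_ ?_⟩⟩ <;> simp [MC, O1, O2, hpq, hpr, hps, hqr, hqs, hrs, hqp, hrp, hsp, hrq, hsq, hsr]
end

section
/- For every line a of a 3-dimensional classical elliptic space there exist distinct lines a₁ and a₂ such that a ≈ a₁, a₁ ≈ a₂, a₂ ≈ a, and also aᗮ ≈ a₁ and aᗮ ≈ a₂. (Concretely, choosing points A₀ ∈ a and A₁ ∈ aᗮ, setting A₂ := A₁ᗮ ⊓ aᗮ, a₁ := A₀ ⊔ A₁ and a₂ := A₀ ⊔ A₂ yields such lines.) -/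
variable {F V : Type*} [Field F] [AddCommGroup V] [Module F V]

/-- A two-dimensional subspace contains two nonzero orthogonal vectors. -/
theorem exists_ortho_pair_aux (B : LinearMap.BilinForm F V)
    (haniso : ∀ x : V, B x x = 0 → x = 0)
    (W : Submodule F V) (hW : Module.finrank F W = 2) :
    ∃ u ∈ W, ∃ v ∈ W, u ≠ 0 ∧ v ≠ 0 ∧ B u v = 0 := by
  have : FiniteDimensional F W := Module.finite_of_finrank_pos (by omega)
  let b := Module.finBasisOfFinrankEq F W hW
  have hb := b.linearIndependent.map' W.subtype W.ker_subtype
  have h0 : (b 0 : V) ≠ 0 := hb.ne_zero 0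
  have hB : B (b 0) (b 0) ≠ 0 := fun h => h0 (haniso _ h)
  refine ⟨b 0, (b 0).2, (b 1 : V) - (B (b 0) (b 1) / B (b 0) (b 0)) • (b 0 : V),
    W.sub_mem (b 1).2 (W.smul_mem _ (b 0).2), h0, ?_, ?_⟩
  · intro h
    have h2 := Fintype.linearIndependent_iff.1 hb ![-(B (b 0) (b 1) / B (b 0) (b 0)), 1]
      (by
        simp only [Fin.sum_univ_two, Function.comp, Matrix.cons_val_zero, Matrix.cons_val_one,
          Submodule.subtype_apply, one_smul, neg_smul]
        rw [← h]; abel) 1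
    simp at h2
  · simp only [map_sub, map_smul, smul_eq_mul]
    field_simp
    ring

/-- Two nonzero orthogonal vectors span a line. -/
theorem finrank_span_ortho_aux (B : LinearMap.BilinForm F V)
    (haniso : ∀ x : V, B x x = 0 → x = 0) {u v : V} (hu : u ≠ 0) (hv : v ≠ 0)
    (huv : B u v = 0) : Module.finrank F (Submodule.span F {u, v}) = 2 := by
  have hl : LinearIndependent F ![u, v] := by
    rw [LinearIndependent.pair_iff' hu]
    rintro c rfl
    simp only [map_smul, smul_eq_mul, mul_eq_zero] at huv
    rcases huv with rfl | h
    · simp at hv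
    · exact hu (haniso _ h)
  have := finrank_span_eq_card hl
  rw [show Set.range ![u, v] = {u, v} by simp [Set.pair_comm]] at this
  simpa using this

theorem mem_orthogonal_pair_aux (B : LinearMap.BilinForm F V) {u v x : V}
    (hu : B u x = 0) (hv : B v x = 0) : x ∈ B.orthogonal (Submodule.span F {u, v}) := by
  rw [LinearMap.BilinForm.mem_orthogonal_iff]
  intro n hn
  obtain ⟨s, t, rfl⟩ := Submodule.mem_span_pair.1 hn
  simp [hu, hv]

theorem inf_ne_bot_aux {S T : Submodule F V} {x : V} (hx : x ≠ 0) (hS : x ∈ S) (hT : x ∈ T) :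
    S ⊓ T ≠ ⊥ := fun h => hx ((Submodule.mem_bot F).1 (h ▸ Submodule.mem_inf.2 ⟨hS, hT⟩))

/-- For every line `a` there are distinct lines `a₁, a₂` with
`a ≈ a₁ ≈ a₂ ≈ a` and `aᗮ ≈ a₁`, `aᗮ ≈ a₂`. -/
theorem exists_orthogonal_triangle
    (hdim : Module.finrank F V = 4)
    (B : LinearMap.BilinForm F V)
    (hsymm : B.IsSymm)
    (hnondeg : B.Nondegenerate)
    (haniso : ∀ x : V, B x x = 0 → x = 0)
    (hchar : (2 : F) ≠ 0)
    (hclassical : IsClassical B)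
    (a : Submodule F V) (ha : Module.finrank F a = 2) :
    ∃ a₁ a₂ : Submodule F V, Module.finrank F a₁ = 2 ∧ Module.finrank F a₂ = 2 ∧ a₁ ≠ a₂ ∧
      OrthoMeet B a a₁ ∧ OrthoMeet B a₁ a₂ ∧ OrthoMeet B a₂ a ∧
      OrthoMeet B (B.orthogonal a) a₁ ∧ OrthoMeet B (B.orthogonal a) a₂ := by
  have : FiniteDimensional F V := Module.finite_of_finrank_pos (by omega)
  have ho : Module.finrank F (B.orthogonal a) = 2 := by
    rw [LinearMap.BilinForm.finrank_orthogonal hnondeg, hdim, ha]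
  obtain ⟨p, hp, p', hp', p0, p'0, hpp⟩ := exists_ortho_pair_aux B haniso a ha
  obtain ⟨q, hq, r, hr, q0, r0, hqr⟩ := exists_ortho_pair_aux B haniso _ ho
  have hs : ∀ x y, B x y = 0 → B y x = 0 := fun x y h => hsymm.isRefl x y h
  have ho' : ∀ x ∈ a, ∀ y ∈ B.orthogonal a, B x y = 0 := fun x hx y hy =>
    (LinearMap.BilinForm.mem_orthogonal_iff.1 hy) x hx
  have hl : ∀ x y : V, x ∈ Submodule.span F {x, y} := fun x y =>
    Submodule.subset_span (by simp)
  have hr' : ∀ x y : V, y ∈ Submodule.span F {x, y} := fun x y =>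
    Submodule.subset_span (by simp)
  have hq2 : q ∈ B.orthogonal (Submodule.span F {p, r}) :=
    mem_orthogonal_pair_aux B (ho' p hp q hq) (hs _ _ hqr)
  have hr1 : r ∈ B.orthogonal (Submodule.span F {p, q}) :=
    mem_orthogonal_pair_aux B (ho' p hp r hr) hqr
  refine ⟨Submodule.span F {p, q}, Submodule.span F {p, r},
    finrank_span_ortho_aux B haniso p0 q0 (ho' p hp q hq),
    finrank_span_ortho_aux B haniso p0 r0 (ho' p hp r hr), ?_,
    ⟨inf_ne_bot_aux p0 hp (hl _ _), inf_ne_bot_aux p'0 hp'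
      (mem_orthogonal_pair_aux B hpp (hs _ _ (ho' p' hp' q hq)))⟩,
    ⟨inf_ne_bot_aux p0 (hl _ _) (hl _ _), inf_ne_bot_aux q0 (hr' _ _) hq2⟩,
    ⟨inf_ne_bot_aux p0 (hl _ _) hp, inf_ne_bot_aux r0 (hr' _ _) hr⟩,
    ⟨inf_ne_bot_aux q0 hq (hr' _ _), inf_ne_bot_aux r0 hr hr1⟩,
    ⟨inf_ne_bot_aux r0 hr (hr' _ _), inf_ne_bot_aux q0 hq hq2⟩⟩
  intro h
  exact q0 (haniso q ((LinearMap.BilinForm.mem_orthogonal_iff.1 hq2) q (h ▸ hr' p q)))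
end

section
/- In a 3-dimensional classical elliptic space, any two lines can be joined by a finite chain of orthogonally intersecting lines: for all lines a, b there exists a finite sequence of lines a = c₀, c₁, …, cₙ = b with cᵢ ≈ cᵢ₊₁ for all i < n (that is, a and b are related by the reflexive-transitive closure of ≈). -/
variable {F V : Type*} [Field F] [AddCommGroup V] [Module F V]

theorem ortho_aux_span (hp : V) (r : V) (B : LinearMap.BilinForm F V)
    (haniso : ∀ x : V, B x x = 0 → x = 0) (h0 : hp ≠ 0) (r0 : r ≠ 0) (hr : B hp r = 0) :
    Module.finrank F (Submodule.span F {hp, r}) = 2 := by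
  have hli : LinearIndependent F ![hp, r] := by
    rw [LinearIndependent.pair_iff]
    intro s t h
    have h1 : B hp (s • hp + t • r) = 0 := by rw [h]; simp
    have hs : s = 0 := by
      simp only [map_add, map_smul, hr, smul_eq_mul, mul_zero, add_zero, mul_eq_zero] at h1
      exact h1.resolve_right (fun h => h0 (haniso _ h))
    subst hs
    simpa [r0] using h
  have := finrank_span_eq_card hli
  rw [Matrix.range_cons_cons_empty] at this
  simpa using this

theorem ortho_aux_meet
    (hdim : Module.finrank F V = 4)
    (B : LinearMap.BilinForm F V)
    (hsymm : B.IsSymm)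
    (hnondeg : B.Nondegenerate)
    (haniso : ∀ x : V, B x x = 0 → x = 0) (a b : ELine F V) (h : a.1 ⊓ b.1 ≠ ⊥) :
      Relation.ReflTransGen (fun x y : ELine F V => OrthoMeet B x.1 y.1) a b := by
  have : FiniteDimensional F V := Module.finite_of_finrank_pos (by omega)
  obtain ⟨a, ha⟩ := a
  obtain ⟨b, hb⟩ := b
  simp only at h
  obtain ⟨p, ⟨hpa, hpb⟩, p0⟩ := Submodule.exists_mem_ne_zero_of_ne_bot h
  have hpos : a ⊓ b ≠ ⊥ := h
  have hle : Module.finrank F (a ⊔ b : Submodule F V) ≤ 3 := by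
    have h1 := Submodule.finrank_sup_add_finrank_inf_eq a b
    have h2 := Submodule.one_le_finrank_iff.2 h
    omega
  have hr : B.orthogonal (a ⊔ b) ≠ ⊥ := by
    have h1 := LinearMap.BilinForm.finrank_orthogonal hnondeg (a ⊔ b)
    intro h2
    rw [h2, finrank_bot] at h1
    omega
  obtain ⟨r, hr, r0⟩ := Submodule.exists_mem_ne_zero_of_ne_bot hr
  rw [LinearMap.BilinForm.mem_orthogonal_iff] at hr
  have hra : ∀ x ∈ a, B x r = 0 := fun x hx => hr x (Submodule.mem_sup_left hx)
  have hrb : ∀ x ∈ b, B x r = 0 := fun x hx => hr x (Submodule.mem_sup_right hx)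
  have hsy : ∀ x y, B x y = B y x := fun x y => hsymm.eq x y
  have hc := ortho_aux_span p r B haniso p0 r0 (hra p hpa)
  obtain ⟨q', hq', hq'p⟩ : ∃ q' ∈ a, q' ∉ Submodule.span F {p} := by
    by_contra! hcon
    have := Submodule.finrank_mono (show a ≤ Submodule.span F {p} from hcon)
    rw [finrank_span_singleton p0] at this
    omega
  have hBp : B p p ≠ 0 := fun h => p0 (haniso _ h)
  have hpc : p ∈ Submodule.span F {p, r} := Submodule.subset_span (by simp)
  have hrc : r ∈ Submodule.span F {p, r} := Submodule.subset_span (by simp)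
  have s1 : OrthoMeet B a (Submodule.span F {p, r}) := by
    refine ⟨(Submodule.ne_bot_iff _).2 ⟨p, ⟨hpa, hpc⟩, p0⟩,
      (Submodule.ne_bot_iff _).2 ⟨B p p • q' - B p q' • p, ⟨?_, ?_⟩, ?_⟩⟩
    · exact a.sub_mem (a.smul_mem _ hq') (a.smul_mem _ hpa)
    · change _ ∈ B.orthogonal _
      rw [LinearMap.BilinForm.mem_orthogonal_iff]
      intro n hn
      obtain ⟨s, t, rfl⟩ := Submodule.mem_span_pair.1 hn
      change B _ _ = 0
      have e1 := hra p hpa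
      have e2 := hra q' hq'
      rw [hsy] at e1 e2
      simp [e1, e2]
      ring_nf
      try simp
    · intro h0
      apply hq'p
      rw [Submodule.mem_span_singleton]
      refine ⟨(B p p)⁻¹ * B p q', ?_⟩
      rw [mul_smul, ← sub_eq_zero.1 h0, smul_smul, inv_mul_cancel₀ hBp, one_smul]
  have s2 : OrthoMeet B (Submodule.span F {p, r}) b := by
    refine ⟨(Submodule.ne_bot_iff _).2 ⟨p, ⟨hpc, hpb⟩, p0⟩,
      (Submodule.ne_bot_iff _).2 ⟨r, ⟨hrc, ?_⟩, r0⟩⟩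
    exact hrb
  exact (Relation.ReflTransGen.single (b := (⟨_, hc⟩ : ELine F V)) s1).tail s2

/-- Any two lines of a 3-dimensional classical elliptic space are joined by a finite chain of
orthogonally intersecting lines: `≈` (restricted to lines) has connected reflexive-transitive
closure. -/
theorem orthoMeet_chain_connected
    (hdim : Module.finrank F V = 4)
    (B : LinearMap.BilinForm F V)
    (hsymm : B.IsSymm)
    (hnondeg : B.Nondegenerate)
    (haniso : ∀ x : V, B x x = 0 → x = 0)
    (hchar : (2 : F) ≠ 0)
    (hclassical : IsClassical B) :
    ∀ a b : ELine F V,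
      Relation.ReflTransGen (fun x y : ELine F V => OrthoMeet B x.1 y.1) a b := by
  intro a b
  have : FiniteDimensional F V := Module.finite_of_finrank_pos (by omega)
  have ha : a.1 ≠ ⊥ := by
    intro h
    have := a.2
    rw [h, finrank_bot] at this
    omega
  have hb : b.1 ≠ ⊥ := by
    intro h
    have := b.2
    rw [h, finrank_bot] at this
    omega
  by_cases h : a.1 ⊓ b.1 = ⊥
  · obtain ⟨p, hp, p0⟩ := Submodule.exists_mem_ne_zero_of_ne_bot ha
    obtain ⟨q, hq, q0⟩ := Submodule.exists_mem_ne_zero_of_ne_bot hb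
    have hli : LinearIndependent F ![p, q] := by
      rw [LinearIndependent.pair_iff' p0]
      intro s hs
      have : q ∈ a.1 ⊓ b.1 := ⟨hs ▸ a.1.smul_mem s hp, hq⟩
      rw [h] at this
      exact q0 (by simpa using this)
    have hc : Module.finrank F (Submodule.span F (Set.range ![p, q])) = 2 := by
      simpa using finrank_span_eq_card hli
    refine (ortho_aux_meet hdim B hsymm hnondeg haniso a ⟨_, hc⟩ ?_).trans
      (ortho_aux_meet hdim B hsymm hnondeg haniso ⟨_, hc⟩ b ?_)
    · exact (Submodule.ne_bot_iff _).2 ⟨p, ⟨hp, Submodule.subset_span ⟨0, rfl⟩⟩, p0⟩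
    · exact (Submodule.ne_bot_iff _).2 ⟨q, ⟨Submodule.subset_span ⟨1, rfl⟩, hq⟩, q0⟩
  · exact ortho_aux_meet hdim B hsymm hnondeg haniso a b h
end
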